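/- Let G be a finite group. The product replacement chain (σ_t)_{t≥0} on the set S of generating n-tuples of G satisfies the total-variation cutoff upper bound at time (3/2)·n·log n with window of order n: lim_{β→∞} limsup_{n→∞} max_{σ∈S} d_σ((3/2)·n·log n + β·n) = 0. -/

import Mathlib

open scoped BigOperators
open Filter

attribute [local instance] Classical.propDecidable

noncomputable section

namespace PR

variable (G : Type) [Group G] [Fintype G]

/-- A configuration: an `n`-tuple of elements of `G`. -/
abbrev Config (n : ℕ) := Fin n → G

/-- The set of generating `n`-tuples. -/
def gens (n : ℕ) : Set (Config G n) :=
  {σ | Subgroup.closure (Set.range σ) = ⊤}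

/-- A move of the product replacement chain: an ordered pair of distinct indices
together with a sign (`true` = multiply, `false` = multiply by inverse). -/
abbrev Move (n : ℕ) := {p : Fin n × Fin n // p.1 ≠ p.2} × Bool

/-- Applying a move: replace `σ i` by `σ i * (σ j)^{±1}`. -/
def applyMove {n : ℕ} (σ : Config G n) (m : Move n) : Config G n :=
  Function.update σ m.1.1.1
    (σ m.1.1.1 * (if m.2 then σ m.1.1.2 else (σ m.1.1.2)⁻¹))

/-- One-step transition probability of the product replacement chain. -/
def step {n : ℕ} (σ σ' : Config G n) : ℝ :=
  ((Finset.univ.filter (fun m : Move n => applyMove G σ m = σ')).card : ℝ) /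
    (Fintype.card (Move n) : ℝ)

/-- The law of `σ_t` for the chain started at `σ₀`. -/
def law {n : ℕ} (σ₀ : Config G n) : ℕ → Config G n → ℝ
  | 0 => fun σ' => if σ' = σ₀ then 1 else 0
  | (t + 1) => fun σ' => ∑ τ : Config G n, law σ₀ t τ * step G τ σ'

/-- Probability that `σ_t ∈ E` for the chain started at `σ₀`. -/
def prob {n : ℕ} (σ₀ : Config G n) (t : ℕ) (E : Set (Config G n)) : ℝ :=
  ∑ τ ∈ Finset.univ.filter (fun τ => τ ∈ E), law G σ₀ t τ

/-- Probability of a trajectory event for the chain started at `σ₀`, over the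
time horizon `{0, 1, …, T}`. -/
def pathProb {n : ℕ} (σ₀ : Config G n) (T : ℕ)
    (E : Set (Fin (T + 1) → Config G n)) : ℝ :=
  ∑ p ∈ Finset.univ.filter
      (fun p : Fin (T + 1) → Config G n => p 0 = σ₀ ∧ p ∈ E),
    ∏ t : Fin T, step G (p t.castSucc) (p t.succ)

/-- `n_a(σ)`: the number of sites holding the group element `a`. -/
def nCount {n : ℕ} (σ : Config G n) (a : G) : ℕ :=
  (Finset.univ.filter (fun i => σ i = a)).card

/-- `n^H_non(σ)`: the number of sites whose element lies outside `H`. -/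
def nNon {n : ℕ} (H : Subgroup G) (σ : Config G n) : ℕ :=
  (Finset.univ.filter (fun i => σ i ∉ H)).card

/-- `n^{id}_non(σ)`: the number of sites not holding the identity. -/
def nNonId {n : ℕ} (σ : Config G n) : ℕ :=
  (Finset.univ.filter (fun i => σ i ≠ 1)).card

/-- `S_non(c)`. -/
def SNon (n : ℕ) (c : ℝ) : Set (Config G n) :=
  {σ | σ ∈ gens G n ∧
    ∀ H : Subgroup G, H ≠ ⊤ → c * n ≤ (nNon G H σ : ℝ)}

/-- The `δ`-typical set `S_*(δ)`. -/
def SAst (n : ℕ) (δ : ℝ) : Set (Config G n) :=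
  {σ | σ ∈ gens G n ∧
    Real.sqrt (∑ a : G, ((nCount G σ a : ℝ) / n - 1 / (Fintype.card G : ℝ)) ^ 2) ≤ δ}

/-- `n^{σ₀}_{a,b}(σ)`. -/
def nab {n : ℕ} (σ₀ σ : Config G n) (a b : G) : ℕ :=
  (Finset.univ.filter (fun i => σ₀ i = a ∧ σ i = b)).card

/-- `S_*(σ₀, r)`. -/
def SAstM {n : ℕ} (σ₀ : Config G n) (r : ℝ) : Set (Config G n) :=
  {σ | σ ∈ gens G n ∧
    ∀ a : G, Real.sqrt (∑ b : G,
      ((nab G σ₀ σ a b : ℝ) / (nCount G σ₀ a : ℝ) - 1 / (Fintype.card G : ℝ)) ^ 2) ≤ r}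

/-- The uniform stationary distribution `π` on the set of generating tuples. -/
def statDist (n : ℕ) : Config G n → ℝ := fun σ =>
  if σ ∈ gens G n then
    1 / ((Finset.univ.filter (fun τ : Config G n => τ ∈ gens G n)).card : ℝ)
  else 0

/-- Total-variation distance between two (finitely supported) signed weights,
as the supremum over finite sets `A` of `|p(A) - q(A)|`. -/
def tvDist {α : Type*} (p q : α → ℝ) : ℝ :=
  sSup {x : ℝ | ∃ A : Finset α, x = |∑ a ∈ A, p a - ∑ a ∈ A, q a|}

/-- `d_σ(t) = max_{A ⊆ S} |P_σ(σ_t ∈ A) - π(A)|`. -/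
def dTV {n : ℕ} (σ : Config G n) (t : ℕ) : ℝ :=
  sSup {x : ℝ | ∃ A : Finset (Config G n), ↑A ⊆ gens G n ∧
    x = |∑ τ ∈ A, law G σ t τ - ∑ τ ∈ A, statDist G n τ|}

/-- `max_{σ ∈ S} d_σ(t)`. -/
def dMax (n : ℕ) (t : ℕ) : ℝ :=
  sSup {x : ℝ | ∃ σ ∈ gens G n, x = dTV G σ t}

end PR

namespace PR

set_option linter.unusedSectionVars false

variable {G : Type} [Group G] [Fintype G] {n : ℕ} {A : Type} [Fintype A]

/-- Right multiplication of the entry at site `i` by `h`. -/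
def mulAt (x : Config G n) (i : Fin n) (h : G) : Config G n :=
  Function.update x i (x i * h)

/-- The group element `x j` or its inverse, according to the sign `e`. -/
def src (x : Config G n) (j : Fin n) (e : Bool) : G := if e then x j else (x j)⁻¹

lemma applyMove_eq (x : Config G n) (m : Move n) :
    applyMove G x m = mulAt x m.1.1.1 (src x m.1.1.2 m.2) := rfl

lemma mulAt_self (x : Config G n) (i : Fin n) (h : G) : mulAt x i h i = x i * h := by
  simp [mulAt]

lemma mulAt_ne (x : Config G n) {i k : Fin n} (h : G) (hk : k ≠ i) : mulAt x i h k = x k := by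
  simp [mulAt, hk]

lemma mulAt_one (x : Config G n) (i : Fin n) : mulAt x i 1 = x := by
  simp [mulAt]

/-- The transition operator of the product replacement chain. -/
def avgOp : Module.End ℝ (Config G n → ℝ) where
  toFun f x := (∑ m : Move n, f (applyMove G x m)) / Fintype.card (Move n)
  map_add' f g := by
    funext x
    simp [Finset.sum_add_distrib, add_div]
  map_smul' c f := by
    funext x
    simp [← Finset.mul_sum, mul_div_assoc]

lemma avgOp_apply (f : Config G n → ℝ) (x : Config G n) :
    avgOp f x = (∑ m : Move n, f (applyMove G x m)) / Fintype.card (Move n) := rfl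

lemma sum_move_pair (F : Fin n → Fin n → Bool → ℝ) :
    ∑ m : Move n, F m.1.1.1 m.1.1.2 m.2 =
      ∑ i, ∑ j, ∑ e, F i j e - ∑ i, ∑ e, F i i e := by
  rw [Fintype.sum_prod_type]
  have h1 : ∑ p : {p : Fin n × Fin n // p.1 ≠ p.2}, ∑ e, F p.1.1 p.1.2 e =
      ∑ p ∈ Finset.univ.filter (fun p : Fin n × Fin n => p.1 ≠ p.2), ∑ e, F p.1 p.2 e :=
    (Finset.sum_subtype (Finset.univ.filter (fun p : Fin n × Fin n => p.1 ≠ p.2)) (by simp)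
      (fun p => ∑ e, F p.1 p.2 e)).symm
  rw [h1, Finset.sum_filter, Fintype.sum_prod_type, ← Finset.sum_sub_distrib]
  refine Finset.sum_congr rfl fun i _ => ?_
  have h2 : ∀ j, (if i ≠ j then ∑ e, F i j e else 0) =
      ∑ e, F i j e - (if i = j then ∑ e, F i j e else 0) := by
    intro j
    by_cases h : i = j <;> simp [h]
  simp only [h2, Finset.sum_sub_distrib, Finset.sum_ite_eq, Finset.mem_univ, if_true]

lemma card_move : (Fintype.card (Move n) : ℝ) = 2 * n * (n - 1) := by
  have h := sum_move_pair (n := n) (fun _ _ _ => 1)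
  simp only [Finset.sum_const, Finset.card_univ, nsmul_eq_mul, mul_one, Fintype.card_fin,
    Fintype.card_bool] at h
  rw [h]
  push_cast
  ring

lemma card_move_pos (hn : 2 ≤ n) : (0 : ℝ) < Fintype.card (Move n) := by
  rw [card_move]
  have : (2 : ℝ) ≤ n := by exact_mod_cast hn
  have : (0 : ℝ) < n - 1 := by linarith
  positivity

lemma avgOp_mono {f g : Config G n → ℝ} (h : f ≤ g) : avgOp f ≤ avgOp g := fun x => by
  rw [avgOp_apply, avgOp_apply]
  gcongr with m
  exact h _

lemma avgOp_pow_mono {f g : Config G n → ℝ} (h : f ≤ g) (k : ℕ) :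
    (avgOp ^ k) f ≤ (avgOp ^ k) g := by
  induction k with
  | zero => simpa using h
  | succ k ih =>
    rw [pow_succ']
    exact avgOp_mono ih

lemma avgOp_const (hn : 2 ≤ n) (c : ℝ) :
    avgOp (fun _ : Config G n => c) = fun _ => c := by
  funext x
  have := card_move_pos hn
  rw [avgOp_apply, Finset.sum_const, Finset.card_univ, nsmul_eq_mul]
  field_simp

lemma avgOp_pow_const (hn : 2 ≤ n) (c : ℝ) (k : ℕ) :
    (avgOp ^ k) (fun _ : Config G n => c) = fun _ => c := by
  induction k with
  | zero => rfl
  | succ k ih => rw [pow_succ', Module.End.mul_apply, ih, avgOp_const hn]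

lemma avgOp_pow_nonneg {f : Config G n → ℝ} (h : ∀ x, 0 ≤ f x) (k : ℕ) (x : Config G n) :
    0 ≤ (avgOp ^ k) f x := by
  have := avgOp_pow_mono (f := 0) (g := f) h k x
  simpa using this

lemma avgOp_pow_le (hn : 2 ≤ n) {f : Config G n → ℝ} {c : ℝ} (h : ∀ x, f x ≤ c) (k : ℕ)
    (x : Config G n) : (avgOp ^ k) f x ≤ c := by
  have := avgOp_pow_mono (f := f) (g := fun _ => c) h k x
  rwa [avgOp_pow_const hn] at this

lemma avgOp_pow_add_apply (j k : ℕ) (f : Config G n → ℝ) :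
    (avgOp ^ (j + k)) f = (avgOp ^ j) ((avgOp ^ k) f) := by
  rw [pow_add, Module.End.mul_apply]

lemma sum_law_mul (σ : Config G n) (t : ℕ) (f : Config G n → ℝ) :
    ∑ τ, law G σ t τ * f τ = (avgOp ^ t) f σ := by
  induction t generalizing f with
  | zero => simp [law]
  | succ t ih =>
    rw [pow_succ, Module.End.mul_apply, ← ih]
    simp only [law, Finset.sum_mul]
    rw [Finset.sum_comm]
    refine Finset.sum_congr rfl fun τ _ => ?_
    rw [avgOp_apply]
    simp only [mul_assoc, ← Finset.mul_sum]
    congr 1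
    simp only [step, div_mul_eq_mul_div]
    rw [← Finset.sum_div]
    congr 1
    simp only [Finset.card_filter, Nat.cast_sum, Finset.sum_mul]
    rw [Finset.sum_comm]
    refine Finset.sum_congr rfl fun m _ => ?_
    simp

/-- The number of signed sources equal to `g`. -/
def nu (x : Config G n) (g : G) : ℝ := ∑ j, ∑ e, if src x j e = g then 1 else 0

lemma nu_nonneg (x : Config G n) (g : G) : 0 ≤ nu x g := by
  unfold nu
  exact Finset.sum_nonneg fun j _ => Finset.sum_nonneg fun e _ => by split_ifs <;> norm_num

lemma sum_src (x : Config G n) (φ : G → ℝ) :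
    ∑ j, ∑ e, φ (src x j e) = ∑ g, nu x g * φ g := by
  have h : ∀ g, nu x g * φ g = ∑ j, ∑ e, if src x j e = g then φ g else 0 := fun g => by
    simp only [nu, Finset.sum_mul, ite_mul, one_mul, zero_mul]
  simp only [h]
  rw [Finset.sum_comm (s := (Finset.univ : Finset G))]
  refine Finset.sum_congr rfl fun j _ => ?_
  rw [Finset.sum_comm (s := (Finset.univ : Finset G))]
  refine Finset.sum_congr rfl fun e _ => ?_
  simp

lemma sum_move_src (x : Config G n) (Φ : Fin n → G → ℝ) :
    ∑ m : Move n, Φ m.1.1.1 (src x m.1.1.2 m.2) =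
      ∑ g, nu x g * ∑ i, Φ i g - ∑ i, ∑ e, Φ i (src x i e) := by
  rw [sum_move_pair (fun i j e => Φ i (src x j e))]
  congr 1
  simp only [sum_src, Finset.mul_sum]
  rw [Finset.sum_comm]

/-- The number of sites in class `a` holding the group element `b`. -/
def cnt (κ : Fin n → A) (x : Config G n) (a : A) (b : G) : ℝ :=
  ∑ i, if κ i = a ∧ x i = b then 1 else 0

/-- The size of the class `a`. -/
def csz (κ : Fin n → A) (a : A) : ℝ := ∑ i, if κ i = a then 1 else 0

/-- The deviation of the class counts from equidistribution. -/
def dev (κ : Fin n → A) (x : Config G n) (a : A) (b : G) : ℝ :=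
  cnt κ x a b - csz κ a / Fintype.card G

/-- The squared Euclidean norm of a matrix. -/
def sq (w : A → G → ℝ) : ℝ := ∑ a, ∑ b, w a b ^ 2

/-- The Euclidean inner product of matrices. -/
def ip (w u : A → G → ℝ) : ℝ := ∑ a, ∑ b, w a b * u a b

/-- The energy of a matrix in the direction `g`. -/
def diss (w : A → G → ℝ) (g : G) : ℝ := ∑ a, ∑ b, (w a (b * g) - w a b) ^ 2

/-- The matrix unit. -/
def bump (k : A) (c : G) : A → G → ℝ := fun a b => if k = a ∧ c = b then 1 else 0

/-- The change of the counts when the entry at `i` is multiplied by `h`. -/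
def bumpDiff (κ : Fin n → A) (x : Config G n) (i : Fin n) (h : G) : A → G → ℝ :=
  bump (κ i) (x i * h) - bump (κ i) (x i)

lemma sq_nonneg' (w : A → G → ℝ) : 0 ≤ sq w :=
  Finset.sum_nonneg fun _ _ => Finset.sum_nonneg fun _ _ => sq_nonneg _

lemma diss_nonneg (w : A → G → ℝ) (g : G) : 0 ≤ diss w g :=
  Finset.sum_nonneg fun _ _ => Finset.sum_nonneg fun _ _ => sq_nonneg _

lemma sq_add (w u : A → G → ℝ) : sq (w + u) = sq w + 2 * ip w u + sq u := by
  simp only [sq, ip, Finset.mul_sum, ← Finset.sum_add_distrib]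
  refine Finset.sum_congr rfl fun a _ => Finset.sum_congr rfl fun b _ => ?_
  simp only [Pi.add_apply]
  ring

lemma sq_sub_le (w u : A → G → ℝ) : sq (w - u) ≤ 2 * sq w + 2 * sq u := by
  simp only [sq, Finset.mul_sum, ← Finset.sum_add_distrib]
  refine Finset.sum_le_sum fun a _ => Finset.sum_le_sum fun b _ => ?_
  simp only [Pi.sub_apply]
  nlinarith [sq_nonneg (w a b + u a b)]

lemma ip_sub (w u v : A → G → ℝ) : ip w (u - v) = ip w u - ip w v := by
  simp only [ip, ← Finset.sum_sub_distrib]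
  refine Finset.sum_congr rfl fun a _ => Finset.sum_congr rfl fun b _ => ?_
  simp only [Pi.sub_apply]
  ring

lemma ip_bump (w : A → G → ℝ) (k : A) (c : G) : ip w (bump k c) = w k c := by
  simp [ip, bump, ite_and]

lemma sq_bump (k : A) (c : G) : sq (bump k c) = 1 := by
  simp [sq, bump, ite_and]

lemma ip_bumpDiff (w : A → G → ℝ) (κ : Fin n → A) (x : Config G n) (i : Fin n) (h : G) :
    ip w (bumpDiff κ x i h) = w (κ i) (x i * h) - w (κ i) (x i) := by
  rw [bumpDiff, ip_sub, ip_bump, ip_bump]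

lemma sq_bumpDiff_le (κ : Fin n → A) (x : Config G n) (i : Fin n) (h : G) :
    sq (bumpDiff κ x i h) ≤ 4 := by
  refine (sq_sub_le _ _).trans ?_
  rw [sq_bump, sq_bump]
  norm_num

lemma abs_le_sqrt_sq (w : A → G → ℝ) (a : A) (b : G) : |w a b| ≤ Real.sqrt (sq w) := by
  rw [← Real.sqrt_sq_eq_abs]
  refine Real.sqrt_le_sqrt ?_
  have h1 : w a b ^ 2 ≤ ∑ b, w a b ^ 2 :=
    Finset.single_le_sum (f := fun b => w a b ^ 2) (fun _ _ => sq_nonneg _) (Finset.mem_univ b)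
  exact h1.trans (Finset.single_le_sum (f := fun a => ∑ b, w a b ^ 2)
    (fun _ _ => Finset.sum_nonneg fun _ _ => sq_nonneg _) (Finset.mem_univ a))

lemma ip_le (w u : A → G → ℝ) : ip w u ≤ Real.sqrt (sq w) * Real.sqrt (sq u) := by
  have h := Real.sum_mul_le_sqrt_mul_sqrt (Finset.univ : Finset (A × G))
    (fun p => w p.1 p.2) (fun p => u p.1 p.2)
  simpa only [Fintype.sum_prod_type, ip, sq] using h

lemma cnt_mulAt (κ : Fin n → A) (x : Config G n) (i : Fin n) (h : G) :
    cnt κ (mulAt x i h) = cnt κ x + bumpDiff κ x i h := by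
  funext a b
  simp only [cnt, bumpDiff, bump, Pi.add_apply, Pi.sub_apply]
  have h1 : ∀ k, (if κ k = a ∧ mulAt x i h k = b then (1 : ℝ) else 0) =
      (if κ k = a ∧ x k = b then 1 else 0) + (if k = i then
        ((if κ i = a ∧ x i * h = b then 1 else 0) - (if κ i = a ∧ x i = b then 1 else 0)) else 0) := by
    intro k
    by_cases hk : k = i
    · subst hk
      simp [mulAt_self]
    · simp [mulAt_ne x h hk, hk]
  simp only [h1, Finset.sum_add_distrib, Finset.sum_ite_eq', Finset.mem_univ, if_true]

lemma dev_mulAt (κ : Fin n → A) (x : Config G n) (i : Fin n) (h : G) :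
    dev κ (mulAt x i h) = dev κ x + bumpDiff κ x i h := by
  funext a b
  simp only [dev, cnt_mulAt, Pi.add_apply]
  ring

lemma sum_cnt_mul (κ : Fin n → A) (x : Config G n) (w : A → G → ℝ) :
    ∑ i, w (κ i) (x i) = ∑ a, ∑ b, cnt κ x a b * w a b := by
  simp only [cnt, Finset.sum_mul]
  have : ∀ a, ∑ b, ∑ i, (if κ i = a ∧ x i = b then (1 : ℝ) else 0) * w a b =
      ∑ i, if κ i = a then w a (x i) else 0 := by
    intro a
    rw [Finset.sum_comm]
    refine Finset.sum_congr rfl fun i _ => ?_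
    by_cases h : κ i = a <;> simp [h]
  simp only [this]
  rw [Finset.sum_comm]
  simp

lemma sum_cnt (κ : Fin n → A) (x : Config G n) (a : A) : ∑ b, cnt κ x a b = csz κ a := by
  simp only [cnt, csz]
  rw [Finset.sum_comm]
  refine Finset.sum_congr rfl fun i _ => ?_
  by_cases h : κ i = a <;> simp [h]

lemma card_pos' : (0 : ℝ) < Fintype.card G := by exact_mod_cast Fintype.card_pos

lemma one_le_card : (1 : ℝ) ≤ Fintype.card G := by exact_mod_cast Fintype.card_pos

lemma sum_dev (κ : Fin n → A) (x : Config G n) (a : A) : ∑ b, dev κ x a b = 0 := by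
  simp only [dev, Finset.sum_sub_distrib, sum_cnt, Finset.sum_const, Finset.card_univ,
    nsmul_eq_mul]
  have := card_pos' (G := G)
  field_simp
  ring

lemma sum_shift (φ : G → ℝ) (g : G) : ∑ b, φ (b * g) = ∑ b, φ b :=
  Equiv.sum_comp (Equiv.mulRight g) φ

lemma sum_cnt_shift (κ : Fin n → A) (x : Config G n) (w : A → G → ℝ) (g : G) :
    ∑ i, (w (κ i) (x i * g) - w (κ i) (x i)) =
      ∑ a, ∑ b, dev κ x a b * (w a (b * g) - w a b) := by
  rw [sum_cnt_mul κ x (fun a b => w a (b * g) - w a b)]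
  refine Finset.sum_congr rfl fun a _ => ?_
  have h : ∑ b, (csz κ a / Fintype.card G) * (w a (b * g) - w a b) = 0 := by
    rw [← Finset.mul_sum, Finset.sum_sub_distrib, sum_shift (w a), sub_self, mul_zero]
  rw [← sub_zero (∑ b, cnt κ x a b * _), ← h, ← Finset.sum_sub_distrib]
  refine Finset.sum_congr rfl fun b _ => ?_
  rw [dev]
  ring

lemma ip_shift_self (w : A → G → ℝ) (g : G) :
    ∑ a, ∑ b, w a b * (w a (b * g) - w a b) = - diss w g / 2 := by
  rw [diss, neg_div, Finset.sum_div, ← Finset.sum_neg_distrib]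
  refine Finset.sum_congr rfl fun a _ => ?_
  have h := sum_shift (fun b => w a b ^ 2) g
  have h2 : ∑ b, (w a (b * g) - w a b) ^ 2 =
      ∑ b, w a (b * g) ^ 2 + ∑ b, w a b ^ 2 - 2 * ∑ b, w a b * w a (b * g) := by
    rw [Finset.mul_sum, ← Finset.sum_add_distrib, ← Finset.sum_sub_distrib]
    exact Finset.sum_congr rfl fun b _ => by ring
  have h3 : ∑ b, w a b * (w a (b * g) - w a b) = ∑ b, w a b * w a (b * g) - ∑ b, w a b ^ 2 := by
    rw [← Finset.sum_sub_distrib]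
    exact Finset.sum_congr rfl fun b _ => by ring
  rw [h2, h3, h]
  ring

lemma sum_diss (w : A → G → ℝ) (hw : ∀ a, ∑ b, w a b = 0) :
    ∑ g, diss w g = 2 * Fintype.card G * sq w := by
  simp only [diss, sq, Finset.mul_sum]
  rw [Finset.sum_comm]
  refine Finset.sum_congr rfl fun a _ => ?_
  rw [Finset.sum_comm]
  have h1 : ∀ b, ∑ g, (w a (b * g) - w a b) ^ 2 =
      ∑ c, w a c ^ 2 + Fintype.card G * w a b ^ 2 := by
    intro b
    have hb := Equiv.sum_comp (Equiv.mulLeft b) (fun c => (w a c - w a b) ^ 2)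
    simp only [Equiv.coe_mulLeft] at hb
    rw [hb]
    have : ∀ c, (w a c - w a b) ^ 2 = w a c ^ 2 - 2 * w a b * w a c + w a b ^ 2 :=
      fun c => by ring
    simp only [this, Finset.sum_add_distrib, Finset.sum_sub_distrib, ← Finset.mul_sum, hw,
      Finset.sum_const, Finset.card_univ, nsmul_eq_mul]
    ring
  simp only [h1, Finset.sum_add_distrib, Finset.sum_const, Finset.card_univ, nsmul_eq_mul,
    ← Finset.mul_sum]
  ring

/-- The squared deviation of the class counts from equidistribution. -/
def dsq (κ : Fin n → A) (x : Config G n) : ℝ := sq (dev κ x)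

/-- The squared deviation of the empirical counts from equidistribution. -/
def esq (x : Config G n) : ℝ := dsq (fun _ => ()) x

lemma dsq_nonneg (κ : Fin n → A) (x : Config G n) : 0 ≤ dsq κ x := sq_nonneg' _

lemma esq_nonneg (x : Config G n) : 0 ≤ esq x := dsq_nonneg _ x

lemma csz_unit : csz (fun _ : Fin n => ()) () = n := by simp [csz]

lemma nu_eq (x : Config G n) (g : G) :
    nu x g = cnt (fun _ => ()) x () g + cnt (fun _ => ()) x () g⁻¹ := by
  simp only [nu, cnt, ← Finset.sum_add_distrib, Fintype.sum_bool, src, true_and, if_true]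
  refine Finset.sum_congr rfl fun j _ => ?_
  by_cases h : x j = g⁻¹
  · simp [h]
  · have h' : (x j)⁻¹ ≠ g := fun e => h (by rw [← e, inv_inv])
    simp [h, h']

lemma nu_lower (x : Config G n) (g : G) :
    2 * n / Fintype.card G - 2 * Real.sqrt (esq x) ≤ nu x g := by
  have h : ∀ g, n / Fintype.card G - Real.sqrt (esq x) ≤ cnt (fun _ => ()) x () g := by
    intro g
    have h1 := (abs_le.mp (abs_le_sqrt_sq (dev (fun _ => ()) x) () g)).1
    rw [dev, csz_unit] at h1
    rw [esq, dsq]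
    linarith
  have h1 := h g
  have h2 := h g⁻¹
  rw [nu_eq]
  have : 2 * (n : ℝ) / Fintype.card G = n / Fintype.card G + n / Fintype.card G := by ring
  linarith

lemma csz_nonneg (κ : Fin n → A) (a : A) : 0 ≤ csz κ a :=
  Finset.sum_nonneg fun i _ => by split_ifs <;> norm_num

lemma csz_le (κ : Fin n → A) (a : A) : csz κ a ≤ n := by
  have : csz κ a ≤ ∑ i : Fin n, (1 : ℝ) :=
    Finset.sum_le_sum fun i _ => by split_ifs <;> norm_num
  simpa using this

lemma cnt_nonneg (κ : Fin n → A) (x : Config G n) (a : A) (b : G) : 0 ≤ cnt κ x a b :=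
  Finset.sum_nonneg fun i _ => by split_ifs <;> norm_num

lemma cnt_le (κ : Fin n → A) (x : Config G n) (a : A) (b : G) : cnt κ x a b ≤ csz κ a :=
  Finset.sum_le_sum fun i _ => by
    by_cases h : κ i = a <;> simp only [h, true_and, false_and, if_true, if_false]
    · split_ifs <;> norm_num
    · exact le_refl _

lemma abs_dev_le (κ : Fin n → A) (x : Config G n) (a : A) (b : G) : |dev κ x a b| ≤ n := by
  have h1 := cnt_nonneg κ x a b
  have h2 := (cnt_le κ x a b).trans (csz_le κ a)
  have h3 := csz_nonneg κ a
  have h4 : csz κ a / Fintype.card G ≤ n :=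
    (div_le_self h3 one_le_card).trans (csz_le κ a)
  have h5 : 0 ≤ csz κ a / Fintype.card G := by positivity
  rw [dev, abs_le]
  constructor <;> linarith

lemma dsq_mulAt_le (κ : Fin n → A) (x : Config G n) (i : Fin n) (h : G) :
    dsq κ (mulAt x i h) ≤
      dsq κ x + 2 * (dev κ x (κ i) (x i * h) - dev κ x (κ i) (x i)) + 4 := by
  rw [dsq, dsq, dev_mulAt, sq_add, ip_bumpDiff]
  linarith [sq_bumpDiff_le κ x i h]

/-- Drift of the squared deviation. -/
lemma avgOp_dsq_le (hn : 2 ≤ n) (κ : Fin n → A) (x : Config G n) :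
    avgOp (dsq κ) x ≤ dsq κ x - (∑ g, nu x g * diss (dev κ x) g) / Fintype.card (Move n) + 12 := by
  have hM := card_move_pos hn
  have hn' : (2 : ℝ) ≤ n := by exact_mod_cast hn
  rw [avgOp_apply, div_le_iff₀ hM]
  set w := dev κ x with hw
  have h1 : ∑ m : Move n, dsq κ (applyMove G x m) ≤
      ∑ m : Move n, ((dsq κ x + 4) + 2 *
        (w (κ m.1.1.1) (x m.1.1.1 * src x m.1.1.2 m.2) - w (κ m.1.1.1) (x m.1.1.1))) :=
    Finset.sum_le_sum fun m _ => by
      rw [applyMove_eq]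
      linarith [dsq_mulAt_le κ x m.1.1.1 (src x m.1.1.2 m.2)]
  refine h1.trans ?_
  rw [Finset.sum_add_distrib, ← Finset.mul_sum, Finset.sum_const, Finset.card_univ, nsmul_eq_mul,
    sum_move_src x (fun i h => w (κ i) (x i * h) - w (κ i) (x i))]
  have h2 : ∑ g, nu x g * ∑ i, (w (κ i) (x i * g) - w (κ i) (x i)) =
      - (∑ g, nu x g * diss w g) / 2 := by
    simp only [sum_cnt_shift, ← hw, ip_shift_self]
    rw [neg_div, Finset.sum_div, ← Finset.sum_neg_distrib]
    exact Finset.sum_congr rfl fun g _ => by ring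
  have h3 : -(4 * (n : ℝ) ^ 2) ≤
      ∑ i, ∑ e, (w (κ i) (x i * src x i e) - w (κ i) (x i)) := by
    have : ∑ i : Fin n, ∑ e : Bool, (-(2 * (n : ℝ))) ≤
        ∑ i, ∑ e, (w (κ i) (x i * src x i e) - w (κ i) (x i)) :=
      Finset.sum_le_sum fun i _ => Finset.sum_le_sum fun e _ => by
        have h1 := (abs_le.mp (abs_dev_le κ x (κ i) (x i * src x i e))).1
        have h2 := (abs_le.mp (abs_dev_le κ x (κ i) (x i))).2
        rw [← hw] at h1 h2
        linarith
    simp only [Finset.sum_const, Finset.card_univ, nsmul_eq_mul, Fintype.card_fin,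
      Fintype.card_bool] at this
    push_cast at this
    linarith
  rw [h2]
  have h4 : (dsq κ x - (∑ g, nu x g * diss w g) / Fintype.card (Move n) + 12) *
      Fintype.card (Move n) = dsq κ x * Fintype.card (Move n) - (∑ g, nu x g * diss w g)
        + 12 * Fintype.card (Move n) := by
    field_simp
  rw [h4]
  have h5 : 8 * (n : ℝ) ^ 2 ≤ 8 * Fintype.card (Move n) := by
    rw [card_move]
    nlinarith
  linarith

lemma nu_diss_lower {x : Config G n} {L : ℝ} (hL : ∀ g, L ≤ nu x g) (w : A → G → ℝ)
    (hw : ∀ a, ∑ b, w a b = 0) :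
    L * (2 * Fintype.card G * sq w) ≤ ∑ g, nu x g * diss w g := by
  rw [← sum_diss w hw, Finset.mul_sum]
  exact Finset.sum_le_sum fun g _ => mul_le_mul_of_nonneg_right (hL g) (diss_nonneg w g)

lemma avgOp_dsq_le_add (hn : 2 ≤ n) (κ : Fin n → A) (x : Config G n) :
    avgOp (dsq κ) x ≤ dsq κ x + 12 := by
  have h := avgOp_dsq_le hn κ x
  have : 0 ≤ (∑ g, nu x g * diss (dev κ x) g) / Fintype.card (Move n) :=
    div_nonneg (Finset.sum_nonneg fun g _ => mul_nonneg (nu_nonneg x g) (diss_nonneg _ g))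
      (card_move_pos hn).le
  linarith

lemma avgOp_dsq_le_of_esq (hn : 2 ≤ n) (κ : Fin n → A) (x : Config G n)
    (hx : Fintype.card G * Real.sqrt (esq x) ≤ n) :
    avgOp (dsq κ) x ≤
      dsq κ x * (1 - 2 * (1 - Fintype.card G * Real.sqrt (esq x) / n) / n) + 12 := by
  have h := avgOp_dsq_le hn κ x
  have h1 := nu_diss_lower (nu_lower x) (dev κ x) (sum_dev κ x)
  have hq := card_pos' (G := G)
  have hn' : (2 : ℝ) ≤ n := by exact_mod_cast hn
  set q : ℝ := (Fintype.card G : ℝ) with hqd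
  set s := Real.sqrt (esq x) with hs
  have hV := dsq_nonneg κ x
  have h2 : dsq κ x * (2 * (1 - q * s / n) / n) ≤
      (∑ g, nu x g * diss (dev κ x) g) / Fintype.card (Move n) := by
    rw [le_div_iff₀ (card_move_pos hn), card_move]
    refine le_trans ?_ h1
    have e1 : (2 * (n : ℝ) / q - 2 * s) * (2 * q * sq (dev κ x)) =
        dsq κ x * (4 * (n - q * s)) := by
      rw [dsq]
      field_simp
      ring
    have e2 : dsq κ x * (2 * (1 - q * s / n) / n) * (2 * n * (n - 1)) =
        dsq κ x * (4 * (n - q * s)) * ((n - 1) / n) := by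
      field_simp
      ring
    rw [e1, e2]
    have e3 : ((n : ℝ) - 1) / n ≤ 1 := by
      rw [div_le_one (by linarith)]
      linarith
    have e4 : 0 ≤ dsq κ x * (4 * (n - q * s)) := mul_nonneg hV (by linarith)
    nlinarith
  linarith

/-- The Hamming distance. -/
def ham (x y : Config G n) : ℝ := ∑ i, if x i = y i then 0 else 1

lemma ham_nonneg (x y : Config G n) : 0 ≤ ham x y :=
  Finset.sum_nonneg fun i _ => by split_ifs <;> norm_num

/-- The difference of the class counts of two configurations. -/
def cdiff (κ : Fin n → A) (x y : Config G n) : A → G → ℝ := cnt κ x - cnt κ y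

lemma sum_cdiff (κ : Fin n → A) (x y : Config G n) (a : A) : ∑ b, cdiff κ x y a b = 0 := by
  simp only [cdiff, Pi.sub_apply, Finset.sum_sub_distrib, sum_cnt, sub_self]

lemma cdiff_eq_dev (κ : Fin n → A) (x y : Config G n) : cdiff κ x y = dev κ x - dev κ y := by
  funext a b
  simp only [cdiff, dev, Pi.sub_apply]
  ring

lemma abs_cdiff_le (κ : Fin n → A) (x y : Config G n) (a : A) (b : G) : |cdiff κ x y a b| ≤ n := by
  have h1 := cnt_nonneg κ x a b
  have h2 := (cnt_le κ x a b).trans (csz_le κ a)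
  have h3 := cnt_nonneg κ y a b
  have h4 := (cnt_le κ y a b).trans (csz_le κ a)
  simp only [cdiff, Pi.sub_apply, abs_le]
  constructor <;> linarith

lemma cdiff_mulAt (κ : Fin n → A) (x y : Config G n) (i : Fin n) (h h' : G) :
    cdiff κ (mulAt x i h) (mulAt y i h') =
      cdiff κ x y + (bumpDiff κ x i h - bumpDiff κ y i h') := by
  simp only [cdiff, cnt_mulAt]
  abel

/-- The increment of a matrix in the direction `g`. -/
def shiftDiff (w : A → G → ℝ) (g : G) : A → G → ℝ := fun a b => w a (b * g) - w a b

lemma sq_shiftDiff_le (w : A → G → ℝ) (g : G) : sq (shiftDiff w g) ≤ 4 * sq w := by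
  have h := sq_sub_le (fun a b => w a (b * g)) w
  have h2 : sq (fun a b => w a (b * g)) = sq w := by
    simp only [sq]
    exact Finset.sum_congr rfl fun a _ => sum_shift (fun b => w a b ^ 2) g
  rw [h2] at h
  calc sq (shiftDiff w g) = sq ((fun a b => w a (b * g)) - w) := rfl
    _ ≤ 4 * sq w := by linarith

lemma abs_ip_le (w u : A → G → ℝ) : |ip w u| ≤ Real.sqrt (sq w) * Real.sqrt (sq u) := by
  rw [abs_le]
  have h1 := ip_le w u
  have h2 := ip_le w (-u)
  have h3 : ip w (-u) = - ip w u := by simp [ip]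
  have h4 : sq (-u) = sq u := by simp [sq]
  rw [h3, h4] at h2
  constructor <;> linarith

lemma sum_abs_nu_sub_le (x y : Config G n) : ∑ g, |nu x g - nu y g| ≤ 4 * ham x y := by
  have h1 : ∀ g, |nu x g - nu y g| ≤
      ∑ j, ∑ e, |(if src x j e = g then (1 : ℝ) else 0) - if src y j e = g then 1 else 0| := by
    intro g
    simp only [nu, ← Finset.sum_sub_distrib]
    refine (Finset.abs_sum_le_sum_abs _ _).trans (Finset.sum_le_sum fun j _ => ?_)
    exact Finset.abs_sum_le_sum_abs _ _
  refine (Finset.sum_le_sum fun g _ => h1 g).trans ?_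
  rw [Finset.sum_comm, ham, Finset.mul_sum]
  refine Finset.sum_le_sum fun j _ => ?_
  rw [Finset.sum_comm]
  by_cases hj : x j = y j
  · have : ∀ e, src x j e = src y j e := fun e => by simp [src, hj]
    simp [this, hj]
  · have h2 : ∀ e, ∑ g, |(if src x j e = g then (1 : ℝ) else 0) -
        if src y j e = g then 1 else 0| ≤ 2 := by
      intro e
      calc _ ≤ ∑ g, ((if src x j e = g then (1 : ℝ) else 0) +
            if src y j e = g then 1 else 0) := Finset.sum_le_sum fun g _ => by
              split_ifs <;> norm_num
        _ = 2 := by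
          rw [Finset.sum_add_distrib]
          simp
          norm_num
    refine (Finset.sum_le_sum fun e _ => h2 e).trans ?_
    simp [hj]
    norm_num

/-- Contraction of the synchronous coupling. -/
lemma sum_sq_cdiff_le (κ : Fin n → A) (x y : Config G n) :
    ∑ m : Move n, sq (cdiff κ (applyMove G x m) (applyMove G y m)) ≤
      Fintype.card (Move n) * sq (cdiff κ x y)
        - (4 * n - 4 * Fintype.card G * Real.sqrt (esq x)) * sq (cdiff κ x y)
        + 16 * ham x y * Real.sqrt (dsq κ y) * Real.sqrt (sq (cdiff κ x y))
        + 80 * n * ham x y := by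
  set d := cdiff κ x y with hd
  set Φ : Fin n → G → G → ℝ := fun i b h => d (κ i) (b * h) - d (κ i) b with hΦ
  have hΦn : ∀ i b h, |Φ i b h| ≤ 2 * n := by
    intro i b h
    have h1 := abs_le.mp (abs_cdiff_le κ x y (κ i) (b * h))
    have h2 := abs_le.mp (abs_cdiff_le κ x y (κ i) b)
    rw [← hd] at h1 h2
    simp only [hΦ, abs_le]
    constructor <;> linarith [h1.1, h1.2, h2.1, h2.2]
  have hstep : ∀ m : Move n, sq (cdiff κ (applyMove G x m) (applyMove G y m)) ≤
      sq d + (2 * (Φ m.1.1.1 (x m.1.1.1) (src x m.1.1.2 m.2) -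
        Φ m.1.1.1 (y m.1.1.1) (src y m.1.1.2 m.2)) +
      16 * ((if x m.1.1.1 = y m.1.1.1 then 0 else 1) +
        (if x m.1.1.2 = y m.1.1.2 then 0 else 1))) := by
    intro m
    rw [applyMove_eq, applyMove_eq, cdiff_mulAt, sq_add, ip_sub, ip_bumpDiff, ip_bumpDiff]
    have hs : sq (bumpDiff κ x m.1.1.1 (src x m.1.1.2 m.2) -
        bumpDiff κ y m.1.1.1 (src y m.1.1.2 m.2)) ≤
        16 * ((if x m.1.1.1 = y m.1.1.1 then 0 else 1) +
        (if x m.1.1.2 = y m.1.1.2 then 0 else 1)) := by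
      have h16 := sq_sub_le (bumpDiff κ x m.1.1.1 (src x m.1.1.2 m.2))
        (bumpDiff κ y m.1.1.1 (src y m.1.1.2 m.2))
      have h4 := sq_bumpDiff_le κ x m.1.1.1 (src x m.1.1.2 m.2)
      have h4' := sq_bumpDiff_le κ y m.1.1.1 (src y m.1.1.2 m.2)
      by_cases h1 : x m.1.1.1 = y m.1.1.1
      · by_cases h2 : x m.1.1.2 = y m.1.1.2
        · simp [bumpDiff, src, h1, h2, sq]
        · simp only [h1, h2, if_true, if_false]
          linarith
      · simp only [h1, if_false]
        split_ifs <;> linarith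
    simp only [hΦ, ← hd]
    linarith
  refine (Finset.sum_le_sum fun m _ => hstep m).trans ?_
  rw [Finset.sum_add_distrib, Finset.sum_add_distrib, ← Finset.mul_sum, ← Finset.mul_sum,
    Finset.sum_sub_distrib, Finset.sum_const, Finset.card_univ, nsmul_eq_mul]
  have hD : ∑ m : Move n, ((if x m.1.1.1 = y m.1.1.1 then (0 : ℝ) else 1) +
        (if x m.1.1.2 = y m.1.1.2 then 0 else 1)) ≤ 4 * n * ham x y := by
    rw [sum_move_pair (fun i j _ => (if x i = y i then (0 : ℝ) else 1) +
        (if x j = y j then 0 else 1))]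
    have h0 : 0 ≤ ∑ i, ∑ _e : Bool, ((if x i = y i then (0 : ℝ) else 1) +
        (if x i = y i then 0 else 1)) := Finset.sum_nonneg fun i _ =>
          Finset.sum_nonneg fun e _ => by split_ifs <;> norm_num
    have h1 : ∑ i, ∑ j, ∑ _e : Bool, ((if x i = y i then (0 : ℝ) else 1) +
        (if x j = y j then 0 else 1)) = 4 * n * ham x y := by
      simp only [Finset.sum_const, Finset.card_univ, Fintype.card_bool, nsmul_eq_mul,
        ← Finset.mul_sum, Finset.sum_add_distrib, Fintype.card_fin]
      simp only [ham]
      push_cast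
      ring
    linarith
  rw [sum_move_src x (fun i h => Φ i (x i) h), sum_move_src y (fun i h => Φ i (y i) h)]
  have hcorr : -(8 * n * ham x y) ≤ ∑ i, ∑ e, Φ i (x i) (src x i e) -
      ∑ i, ∑ e, Φ i (y i) (src y i e) := by
    simp only [← Finset.sum_sub_distrib]
    rw [ham, Finset.mul_sum, ← Finset.sum_neg_distrib]
    refine Finset.sum_le_sum fun i _ => ?_
    by_cases hi : x i = y i
    · simp [src, hi]
    · simp only [hi, if_false, Fintype.sum_bool]
      have a1 := (abs_le.mp (hΦn i (x i) (src x i true))).1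
      have a2 := (abs_le.mp (hΦn i (x i) (src x i false))).1
      have a3 := (abs_le.mp (hΦn i (y i) (src y i true))).2
      have a4 := (abs_le.mp (hΦn i (y i) (src y i false))).2
      linarith
  have hx : ∀ g, ∑ i, Φ i (x i) g = ip (dev κ x) (shiftDiff d g) := fun g =>
    sum_cnt_shift κ x d g
  have hy : ∀ g, ∑ i, Φ i (y i) g = ip (dev κ y) (shiftDiff d g) := fun g =>
    sum_cnt_shift κ y d g
  have hxy : ∀ g, ip (dev κ x) (shiftDiff d g) =
      ip (dev κ y) (shiftDiff d g) - diss d g / 2 := by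
    intro g
    have h1 := ip_shift_self d g
    have h2 : ip d (shiftDiff d g) = - diss d g / 2 := h1
    have h3 : ip d (shiftDiff d g) =
        ip (dev κ x) (shiftDiff d g) - ip (dev κ y) (shiftDiff d g) := by
      conv_lhs => rw [hd, cdiff_eq_dev, ← cdiff_eq_dev, ← hd]
      simp only [ip, ← Finset.sum_sub_distrib]
      refine Finset.sum_congr rfl fun a _ => Finset.sum_congr rfl fun b _ => ?_
      rw [← sub_mul]
      congr 1
      rw [hd, cdiff_eq_dev]
      rfl
    linarith
  have hmain : ∑ g, nu x g * ∑ i, Φ i (x i) g - ∑ g, nu y g * ∑ i, Φ i (y i) g =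
      ∑ g, (nu x g - nu y g) * ip (dev κ y) (shiftDiff d g) - (∑ g, nu x g * diss d g) / 2 := by
    simp only [hx, hy, hxy]
    rw [Finset.sum_div, ← Finset.sum_sub_distrib, ← Finset.sum_sub_distrib]
    exact Finset.sum_congr rfl fun g _ => by ring
  have hdrift := nu_diss_lower (nu_lower x) d (sum_cdiff κ x y)
  have hcross : ∑ g, (nu x g - nu y g) * ip (dev κ y) (shiftDiff d g) ≤
      4 * ham x y * (Real.sqrt (dsq κ y) * (2 * Real.sqrt (sq d))) := by
    have hb : ∀ g, |ip (dev κ y) (shiftDiff d g)| ≤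
        Real.sqrt (dsq κ y) * (2 * Real.sqrt (sq d)) := by
      intro g
      refine (abs_ip_le _ _).trans (mul_le_mul_of_nonneg_left ?_ (Real.sqrt_nonneg _))
      refine (Real.sqrt_le_sqrt (sq_shiftDiff_le d g)).trans_eq ?_
      rw [Real.sqrt_mul (by norm_num), show (4 : ℝ) = 2 ^ 2 by norm_num,
        Real.sqrt_sq (by norm_num)]
    calc _ ≤ ∑ g, |nu x g - nu y g| * (Real.sqrt (dsq κ y) * (2 * Real.sqrt (sq d))) :=
          Finset.sum_le_sum fun g _ => (le_abs_self _).trans (by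
            rw [abs_mul]
            exact mul_le_mul_of_nonneg_left (hb g) (abs_nonneg _))
      _ ≤ _ := by
        rw [← Finset.sum_mul]
        exact mul_le_mul_of_nonneg_right (sum_abs_nu_sub_le x y) (by positivity)
  have hq := card_pos' (G := G)
  have he : (2 * (n : ℝ) / Fintype.card G - 2 * Real.sqrt (esq x)) *
      (2 * Fintype.card G * sq d) =
      (4 * n - 4 * Fintype.card G * Real.sqrt (esq x)) * sq d := by
    field_simp
    ring
  rw [he] at hdrift
  linarith

lemma le_of_sq_cdiff (hn : 2 ≤ n) (κ : Fin n → A) (x y : Config G n) {K r : ℝ} (hr : 0 < r)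
    (hK : 0 ≤ K) (hh : ham x y ≤ K * Real.sqrt (sq (cdiff κ x y)))
    (hx : Fintype.card G * Real.sqrt (esq x) ≤ n) :
    (∑ m : Move n, sq (cdiff κ (applyMove G x m) (applyMove G y m))) / Fintype.card (Move n) ≤
      sq (cdiff κ x y) * (1 - (2 - ((2 * Fintype.card G * Real.sqrt (esq x)
        + 16 * K * Real.sqrt (dsq κ y)) / n + 1 / r ^ 2)) / n) + 1600 * K ^ 2 * r ^ 2 / n := by
  have hM := card_move_pos hn
  have hn' : (2 : ℝ) ≤ n := by exact_mod_cast hn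
  have h := sum_sq_cdiff_le κ x y
  rw [div_le_iff₀ hM]
  refine h.trans ?_
  have hD0 := sq_nonneg' (cdiff κ x y)
  set S := sq (cdiff κ x y) with hS
  set s := Real.sqrt S with hs
  set e := Real.sqrt (esq x) with he
  set v := Real.sqrt (dsq κ y) with hv
  set q : ℝ := (Fintype.card G : ℝ) with hq
  have hs0 : 0 ≤ s := Real.sqrt_nonneg _
  have he0 : 0 ≤ e := Real.sqrt_nonneg _
  have hv0 : 0 ≤ v := Real.sqrt_nonneg _
  have hss : s ^ 2 = S := Real.sq_sqrt hD0
  have hq0 : 0 < q := card_pos'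
  have h1 : 16 * ham x y * v * s ≤ 16 * K * v * S := by
    have : ham x y * (v * s) ≤ K * s * (v * s) :=
      mul_le_mul_of_nonneg_right hh (by positivity)
    rw [← hss]
    linarith
  have h2 : 80 * n * ham x y ≤ n * (S / r ^ 2 + 1600 * K ^ 2 * r ^ 2) := by
    have h3 : 80 * (K * s) ≤ S / r ^ 2 + 1600 * K ^ 2 * r ^ 2 := by
      have : 0 ≤ (s / r - 40 * K * r) ^ 2 := sq_nonneg _
      have e1 : (s / r - 40 * K * r) ^ 2 = S / r ^ 2 - 80 * (K * s) + 1600 * K ^ 2 * r ^ 2 := by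
        rw [← hss]
        field_simp
        ring
      linarith
    have h4 : 80 * ham x y ≤ S / r ^ 2 + 1600 * K ^ 2 * r ^ 2 := by linarith
    calc 80 * (n : ℝ) * ham x y = n * (80 * ham x y) := by ring
      _ ≤ _ := mul_le_mul_of_nonneg_left h4 (by linarith)
  have h5 : (n : ℝ) ≤ 2 * (n - 1) := by linarith
  have hM' : (Fintype.card (Move n) : ℝ) = 2 * n * (n - 1) := card_move
  have hA : 0 ≤ 4 * (n - q * e) * S := by
    have : 0 ≤ n - q * e := by linarith
    positivity
  have e1 : (S * (1 - (2 - ((2 * q * e + 16 * K * v) / n + 1 / r ^ 2)) / n)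
      + 1600 * K ^ 2 * r ^ 2 / n) * Fintype.card (Move n) =
      Fintype.card (Move n) * S - 4 * (n - q * e) * S * ((n - 1) / n)
      + 16 * K * v * S * (2 * (n - 1) / n) + (S / r ^ 2 + 1600 * K ^ 2 * r ^ 2) * (2 * (n - 1)) := by
    rw [hM']
    field_simp
    ring
  rw [e1]
  have h6 : ((n : ℝ) - 1) / n ≤ 1 := by rw [div_le_one (by linarith)]; linarith
  have h7 : 1 ≤ 2 * ((n : ℝ) - 1) / n := by rw [le_div_iff₀ (by linarith)]; linarith
  have h8 : 4 * (n - q * e) * S * ((n - 1) / n) ≤ 4 * (n - q * e) * S :=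
    mul_le_of_le_one_right hA h6
  have h9 : 16 * K * v * S ≤ 16 * K * v * S * (2 * (n - 1) / n) :=
    le_mul_of_one_le_right (by positivity) h7
  have h10 : n * (S / r ^ 2 + 1600 * K ^ 2 * r ^ 2) ≤
      (S / r ^ 2 + 1600 * K ^ 2 * r ^ 2) * (2 * (n - 1)) := by
    have : 0 ≤ S / r ^ 2 + 1600 * K ^ 2 * r ^ 2 := by positivity
    nlinarith
  linarith

/-- The permutations of the sites preserving the classes. -/
def stab (κ : Fin n → A) : Finset (Equiv.Perm (Fin n)) :=
  Finset.univ.filter fun τ => ∀ i, κ (τ i) = κ i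

lemma mem_stab {κ : Fin n → A} {τ : Equiv.Perm (Fin n)} : τ ∈ stab κ ↔ ∀ i, κ (τ i) = κ i := by
  simp [stab]

lemma one_mem_stab (κ : Fin n → A) : (1 : Equiv.Perm (Fin n)) ∈ stab κ := by simp [mem_stab]

lemma cnt_comp {κ : Fin n → A} {τ : Equiv.Perm (Fin n)} (hτ : τ ∈ stab κ) (y : Config G n) :
    cnt κ (y ∘ τ) = cnt κ y := by
  funext a b
  rw [mem_stab] at hτ
  have h := Equiv.sum_comp τ (fun i => if κ i = a ∧ y i = b then (1 : ℝ) else 0)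
  simp only [hτ] at h
  exact h

lemma ham_eq_sum (κ : Fin n → A) (x y : Config G n) :
    ham x y = ∑ a, ∑ b, ∑ i, if κ i = a ∧ x i = b ∧ y i ≠ b then 1 else 0 := by
  have h : ∀ i, (∑ a, ∑ b, if κ i = a ∧ x i = b ∧ y i ≠ b then (1 : ℝ) else 0) =
      if x i = y i then 0 else 1 := by
    intro i
    rw [Finset.sum_eq_single (κ i) (fun a _ ha => by simp [Ne.symm ha]) (by simp),
      Finset.sum_eq_single (x i) (fun b _ hb => by simp [Ne.symm hb]) (by simp)]
    by_cases h : x i = y i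
    · simp [h]
    · simp [h, Ne.symm h]
  simp only [ham, ← h]
  rw [Finset.sum_comm]
  exact Finset.sum_congr rfl fun a _ => Finset.sum_comm

lemma ham_swap {x y : Config G n} {i j : Fin n} (h1 : x i = y j) (h2 : y i ≠ x i)
    (h3 : x j ≠ y j) : ham x (y ∘ Equiv.swap i j) ≤ ham x y - 1 := by
  have hij : j ≠ i := fun h => h2 (by rw [h] at h1; exact h1.symm)
  have : ham x (y ∘ Equiv.swap i j) + 1 ≤ ham x y := by
    have e1 : (1 : ℝ) = ∑ k, if k = i then 1 else 0 := by simp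
    rw [e1, ham, ham, ← Finset.sum_add_distrib]
    refine Finset.sum_le_sum fun k _ => ?_
    by_cases hki : k = i
    · subst hki
      simp [h1, h1 ▸ Ne.symm h2]
    · by_cases hkj : k = j
      · subst hkj
        simp only [h3, hki, if_false]
        split_ifs <;> norm_num
      · simp [Equiv.swap_apply_of_ne_of_ne hki hkj, hki]
  linarith

lemma exists_stab_ham_le (κ : Fin n → A) (x y : Config G n) :
    ∃ τ ∈ stab κ, ham x (y ∘ τ) ≤ ∑ a, ∑ b, |cdiff κ x y a b| := by
  obtain ⟨τ, hτ, hmin⟩ := Finset.exists_min_image (stab κ) (fun τ => ham x (y ∘ τ))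
    ⟨1, one_mem_stab κ⟩
  refine ⟨τ, hτ, ?_⟩
  set y' := y ∘ τ with hy'
  have hc : cdiff κ x y = cdiff κ x y' := by rw [cdiff, cdiff, hy', cnt_comp hτ]
  rw [hc, ham_eq_sum κ]
  refine Finset.sum_le_sum fun a _ => Finset.sum_le_sum fun b _ => ?_
  have hd : cdiff κ x y' a b = (∑ i, if κ i = a ∧ x i = b ∧ y' i ≠ b then (1 : ℝ) else 0) -
      ∑ i, if κ i = a ∧ y' i = b ∧ x i ≠ b then 1 else 0 := by
    simp only [cdiff, cnt, Pi.sub_apply, ← Finset.sum_sub_distrib]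
    refine Finset.sum_congr rfl fun i _ => ?_
    by_cases h1 : κ i = a <;> by_cases h2 : x i = b <;> by_cases h3 : y' i = b <;>
      simp [h1, h2, h3]
  have hnot : ¬ ((∃ i, κ i = a ∧ x i = b ∧ y' i ≠ b) ∧ ∃ j, κ j = a ∧ y' j = b ∧ x j ≠ b) := by
    rintro ⟨⟨i, hi1, hi2, hi3⟩, j, hj1, hj2, hj3⟩
    have h1 := ham_swap (x := x) (y := y') (i := i) (j := j) (by rw [hi2, hj2])
      (by rw [hi2]; exact hi3) (by rw [hj2]; exact hj3)
    have hs : τ * Equiv.swap i j ∈ stab κ := by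
      rw [mem_stab] at hτ ⊢
      intro k
      rw [Equiv.Perm.mul_apply, hτ]
      by_cases hki : k = i
      · rw [hki, Equiv.swap_apply_left, hi1, hj1]
      · by_cases hkj : k = j
        · rw [hkj, Equiv.swap_apply_right, hi1, hj1]
        · rw [Equiv.swap_apply_of_ne_of_ne hki hkj]
    have h2 := hmin _ hs
    have h3 : y ∘ (τ * Equiv.swap i j) = y' ∘ Equiv.swap i j := rfl
    rw [h3] at h2
    linarith
  by_cases h1 : ∃ i, κ i = a ∧ x i = b ∧ y' i ≠ b
  · have h2 : ∀ j, ¬ (κ j = a ∧ y' j = b ∧ x j ≠ b) := fun j hj => hnot ⟨h1, j, hj⟩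
    have h3 : (∑ i, if κ i = a ∧ y' i = b ∧ x i ≠ b then (1 : ℝ) else 0) = 0 :=
      Finset.sum_eq_zero fun i _ => if_neg (h2 i)
    rw [hd, h3, sub_zero]
    exact le_abs_self _
  · push Not at h1
    have h3 : (∑ i, if κ i = a ∧ x i = b ∧ y' i ≠ b then (1 : ℝ) else 0) = 0 :=
      Finset.sum_eq_zero fun i _ => if_neg fun h => h.2.2 (h1 i h.1 h.2.1)
    rw [h3]
    exact abs_nonneg _

lemma sum_abs_le (w : A → G → ℝ) :
    ∑ a, ∑ b, |w a b| ≤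
      Real.sqrt (Fintype.card A * Fintype.card G) * Real.sqrt (sq w) := by
  have h := ip_le (fun _ _ => 1) (fun a b => |w a b|)
  simpa [ip, sq] using h

lemma applyMove_comp (τ : Equiv.Perm (Fin n)) (x : Config G n) (i : Fin n) (h : G) :
    mulAt (x ∘ τ) i h = mulAt x (τ i) h ∘ τ := by
  funext k
  by_cases hk : k = i
  · subst hk
    simp [mulAt_self]
  · rw [mulAt_ne _ _ hk, Function.comp, Function.comp, mulAt_ne _ _ (by simpa using hk)]

lemma sum_move_comp (τ : Equiv.Perm (Fin n)) (F : Fin n → Fin n → Bool → ℝ) :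
    ∑ m : Move n, F (τ m.1.1.1) (τ m.1.1.2) m.2 = ∑ m : Move n, F m.1.1.1 m.1.1.2 m.2 := by
  rw [sum_move_pair (fun i j e => F (τ i) (τ j) e), sum_move_pair]
  congr 1
  · rw [← Equiv.sum_comp τ (fun i => ∑ j, ∑ e, F i j e)]
    exact Finset.sum_congr rfl fun i _ => Equiv.sum_comp τ (fun j => ∑ e, F (τ i) j e)
  · exact Equiv.sum_comp τ (fun i => ∑ e, F i i e)

lemma avgOp_comp (τ : Equiv.Perm (Fin n)) (f : Config G n → ℝ) (x : Config G n) :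
    avgOp (fun z => f (z ∘ τ)) x = avgOp f (x ∘ τ) := by
  rw [avgOp_apply, avgOp_apply]
  congr 1
  simp only [applyMove_eq, applyMove_comp]
  exact (sum_move_comp τ (fun i j e => f (mulAt x i (src x j e) ∘ τ))).symm

lemma avgOp_pow_comp (τ : Equiv.Perm (Fin n)) (k : ℕ) (f : Config G n → ℝ) (x : Config G n) :
    (avgOp ^ k) (fun z => f (z ∘ τ)) x = (avgOp ^ k) f (x ∘ τ) := by
  induction k generalizing x with
  | zero => rfl
  | succ k ih =>
    rw [pow_succ', Module.End.mul_apply, Module.End.mul_apply, ← avgOp_comp]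
    exact congrFun (congrArg avgOp (funext ih)) x

/-- Invariance under the permutations preserving the classes. -/
def StabInv (κ : Fin n → A) (f : Config G n → ℝ) : Prop := ∀ τ ∈ stab κ, ∀ x, f (x ∘ τ) = f x

lemma StabInv.avgOp_pow {κ : Fin n → A} {f : Config G n → ℝ} (hf : StabInv κ f) (k : ℕ) :
    StabInv κ ((avgOp ^ k) f) := by
  intro τ hτ x
  rw [← avgOp_pow_comp]
  exact congrFun (congrArg (avgOp ^ k) (funext (hf τ hτ))) x

/-- The average over the permutations preserving the classes. -/
def symm (κ : Fin n → A) (f : Config G n → ℝ) (x : Config G n) : ℝ :=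
  (∑ τ ∈ stab κ, f (x ∘ τ)) / (stab κ).card

lemma stab_card_pos (κ : Fin n → A) : (0 : ℝ) < (stab κ).card := by
  exact_mod_cast Finset.card_pos.mpr ⟨1, one_mem_stab κ⟩

lemma symm_stabInv (κ : Fin n → A) (f : Config G n → ℝ) : StabInv κ (symm κ f) := by
  intro τ hτ x
  rw [mem_stab] at hτ
  rw [symm, symm]
  congr 1
  refine Finset.sum_bij' (fun ρ _ => τ * ρ) (fun ρ _ => τ⁻¹ * ρ) ?_ ?_ ?_ ?_ ?_
  · intro ρ hρ
    rw [mem_stab] at hρ ⊢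
    intro i
    rw [Equiv.Perm.mul_apply, hτ, hρ]
  · intro ρ hρ
    rw [mem_stab] at hρ ⊢
    intro i
    rw [← hτ]
    simp [hρ]
  · intro ρ _
    simp
  · intro ρ _
    simp
  · intro ρ _
    rfl

lemma symm_mem {κ : Fin n → A} {f : Config G n → ℝ} (h0 : ∀ x, 0 ≤ f x) (h1 : ∀ x, f x ≤ 1)
    (x : Config G n) : 0 ≤ symm κ f x ∧ symm κ f x ≤ 1 := by
  have hc := stab_card_pos κ
  constructor
  · exact div_nonneg (Finset.sum_nonneg fun τ _ => h0 _) hc.le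
  · rw [symm, div_le_one hc]
    refine (Finset.sum_le_sum fun τ _ => h1 _).trans ?_
    simp

lemma avgOp_pow_symm_self (κ : Config G n) (f : Config G n → ℝ) (k : ℕ) :
    (avgOp ^ k) (symm κ f) κ = (avgOp ^ k) f κ := by
  have h : symm κ f = ((stab κ).card : ℝ)⁻¹ • ∑ τ ∈ stab κ, fun z : Config G n => f (z ∘ τ) := by
    funext x
    simp [symm, div_eq_inv_mul]
  have hc := stab_card_pos κ
  rw [h, map_smul, map_sum, Pi.smul_apply, Finset.sum_apply]
  have : ∀ τ ∈ stab κ, (avgOp ^ k) (fun z : Config G n => f (z ∘ τ)) κ = (avgOp ^ k) f κ := by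
    intro τ hτ
    rw [avgOp_pow_comp]
    exact congrArg ((avgOp ^ k) f) (funext (mem_stab.mp hτ))
  rw [Finset.sum_congr rfl this, Finset.sum_const, nsmul_eq_mul, smul_eq_mul]
  field_simp

/-- The average over all configurations. -/
def unif (f : Config G n → ℝ) : ℝ := (∑ x, f x) / Fintype.card (Config G n)

lemma unif_symm (κ : Fin n → A) (f : Config G n → ℝ) : unif (symm κ f) = unif f := by
  have hc := stab_card_pos κ
  rw [unif, unif]
  congr 1
  simp only [symm]
  rw [← Finset.sum_div, Finset.sum_comm]
  have : ∀ τ ∈ stab κ, ∑ x : Config G n, f (x ∘ τ) = ∑ x, f x := fun τ _ =>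
    Equiv.sum_comp (Equiv.arrowCongr τ.symm (Equiv.refl G)) f
  rw [Finset.sum_congr rfl this, Finset.sum_const, nsmul_eq_mul]
  field_simp

/-- The squared variation of `f` under perturbations of the entry at `i`. -/
def siteGrad (f : Config G n → ℝ) (x : Config G n) (i : Fin n) : ℝ :=
  ∑ h, (f (mulAt x i h) - f x) ^ 2

/-- The squared gradient of `f`. -/
def grad (f : Config G n → ℝ) (x : Config G n) : ℝ := ∑ i, siteGrad f x i

lemma siteGrad_nonneg (f : Config G n → ℝ) (x : Config G n) (i : Fin n) : 0 ≤ siteGrad f x i :=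
  Finset.sum_nonneg fun _ _ => sq_nonneg _

lemma grad_nonneg (f : Config G n → ℝ) (x : Config G n) : 0 ≤ grad f x :=
  Finset.sum_nonneg fun _ _ => siteGrad_nonneg f x _

lemma le_siteGrad (f : Config G n → ℝ) (x : Config G n) (i : Fin n) (h : G) :
    (f (mulAt x i h) - f x) ^ 2 ≤ siteGrad f x i :=
  Finset.single_le_sum (f := fun h => (f (mulAt x i h) - f x) ^ 2) (fun _ _ => sq_nonneg _)
    (Finset.mem_univ h)

lemma grad_le {f : Config G n → ℝ} (h0 : ∀ x, 0 ≤ f x) (h1 : ∀ x, f x ≤ 1) (x : Config G n) :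
    grad f x ≤ n * Fintype.card G := by
  have : ∀ i h, (f (mulAt x i h) - f x) ^ 2 ≤ 1 := by
    intro i h
    rw [sq_le_one_iff_abs_le_one, abs_le]
    constructor <;> linarith [h0 x, h1 x, h0 (mulAt x i h), h1 (mulAt x i h)]
  calc grad f x ≤ ∑ i : Fin n, ∑ h : G, (1 : ℝ) :=
        Finset.sum_le_sum fun i _ => Finset.sum_le_sum fun h _ => this i h
    _ = _ := by simp

lemma sum_move_src_lower {x : Config G n} (hn : 4 * Fintype.card G ≤ n)
    (hx : Real.sqrt (esq x) ≤ n / (4 * Fintype.card G)) (Φ : Fin n → G → ℝ)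
    (hΦ : ∀ i g, 0 ≤ Φ i g) :
    n / Fintype.card G * ∑ i, ∑ g, Φ i g ≤
      ∑ m : Move n, Φ m.1.1.1 (src x m.1.1.2 m.2) := by
  rw [sum_move_src]
  have hq := card_pos' (G := G)
  have hnR : 4 * (Fintype.card G : ℝ) ≤ n := by exact_mod_cast hn
  have h1 : ∑ i, ∑ e, Φ i (src x i e) ≤ 2 * ∑ i, ∑ g, Φ i g := by
    rw [Finset.mul_sum]
    refine Finset.sum_le_sum fun i _ => ?_
    have : ∀ e, Φ i (src x i e) ≤ ∑ g, Φ i g := fun e =>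
      Finset.single_le_sum (f := fun g => Φ i g) (fun g _ => hΦ i g) (Finset.mem_univ _)
    rw [Fintype.sum_bool]
    linarith [this true, this false]
  have h2 : (n / Fintype.card G + 2) * ∑ i, ∑ g, Φ i g ≤ ∑ g, nu x g * ∑ i, Φ i g := by
    rw [Finset.sum_comm, Finset.mul_sum]
    refine Finset.sum_le_sum fun g _ => mul_le_mul_of_nonneg_right ?_
      (Finset.sum_nonneg fun i _ => hΦ i g)
    refine le_trans ?_ (nu_lower x g)
    have e1 : 2 * Real.sqrt (esq x) ≤ n / (2 * Fintype.card G) := by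
      have : (n : ℝ) / (2 * Fintype.card G) = 2 * (n / (4 * Fintype.card G)) := by
        field_simp
        ring
      linarith
    have e2 : 2 ≤ (n : ℝ) / (2 * Fintype.card G) := by
      rw [le_div_iff₀ (by positivity)]
      linarith
    have e3 : 2 * (n : ℝ) / Fintype.card G =
        n / Fintype.card G + 2 * (n / (2 * Fintype.card G)) := by
      field_simp
      ring
    linarith
  linarith

lemma grad_le_variance {x : Config G n} (h2n : 2 ≤ n) (hn : 4 * Fintype.card G ≤ n)
    (hx : Real.sqrt (esq x) ≤ n / (4 * Fintype.card G)) (f : Config G n → ℝ) :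
    grad f x ≤ 4 * Fintype.card G * (1 + Fintype.card G) * n *
      (avgOp (fun z => f z ^ 2) x - avgOp f x ^ 2) := by
  set c := avgOp f x with hc
  have hM := card_move_pos h2n
  have hn' : (2 : ℝ) ≤ n := by exact_mod_cast h2n
  have hq := card_pos' (G := G)
  have hvar : ∑ m : Move n, (f (applyMove G x m) - c) ^ 2 =
      Fintype.card (Move n) * (avgOp (fun z => f z ^ 2) x - c ^ 2) := by
    have h1 : ∑ m : Move n, f (applyMove G x m) = Fintype.card (Move n) * c := by
      rw [hc, avgOp_apply]
      field_simp
    have h2 : ∑ m : Move n, f (applyMove G x m) ^ 2 =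
        Fintype.card (Move n) * avgOp (fun z => f z ^ 2) x := by
      rw [avgOp_apply]
      field_simp
    have h3 : ∀ m : Move n, (f (applyMove G x m) - c) ^ 2 =
        f (applyMove G x m) ^ 2 - 2 * c * f (applyMove G x m) + c ^ 2 := fun m => by ring
    simp only [h3, Finset.sum_add_distrib, Finset.sum_sub_distrib, ← Finset.mul_sum, h1, h2,
      Finset.sum_const, Finset.card_univ, nsmul_eq_mul]
    ring
  have hlow := sum_move_src_lower hn hx (fun i g => (f (mulAt x i g) - c) ^ 2)
    (fun _ _ => sq_nonneg _)
  have hv2 : ∑ m : Move n, (f (mulAt x m.1.1.1 (src x m.1.1.2 m.2)) - c) ^ 2 =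
      Fintype.card (Move n) * (avgOp (fun z => f z ^ 2) x - c ^ 2) := hvar
  rw [hv2] at hlow
  set S := ∑ i, ∑ g, (f (mulAt x i g) - c) ^ 2 with hS
  set W := avgOp (fun z => f z ^ 2) x - c ^ 2 with hW
  have hS1 : n * (f x - c) ^ 2 ≤ S := by
    calc n * (f x - c) ^ 2 = ∑ i : Fin n, (f (mulAt x i 1) - c) ^ 2 := by simp [mulAt_one]
      _ ≤ S := Finset.sum_le_sum fun i _ =>
        Finset.single_le_sum (f := fun g => (f (mulAt x i g) - c) ^ 2)
          (fun _ _ => sq_nonneg _) (Finset.mem_univ 1)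
  have hgr : grad f x ≤ 2 * S + 2 * Fintype.card G * (n * (f x - c) ^ 2) := by
    calc grad f x ≤ ∑ i : Fin n, ∑ g : G, (2 * (f (mulAt x i g) - c) ^ 2 + 2 * (f x - c) ^ 2) :=
          Finset.sum_le_sum fun i _ => Finset.sum_le_sum fun g _ => by
            nlinarith [sq_nonneg (f (mulAt x i g) - c + (f x - c))]
      _ = _ := by
        simp only [Finset.sum_add_distrib, ← Finset.mul_sum, Finset.sum_const, Finset.card_univ,
          nsmul_eq_mul, Fintype.card_fin, hS]
        ring
  have hS0 : 0 ≤ S := le_trans (by positivity) hS1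
  have hS2 : S ≤ 2 * Fintype.card G * n * W := by
    have hM2 : (Fintype.card (Move n) : ℝ) ≤ 2 * n ^ 2 := by rw [card_move]; nlinarith
    have hW0 : 0 ≤ W := by
      have : 0 ≤ Fintype.card (Move n) * W := le_trans (by positivity) hlow
      exact nonneg_of_mul_nonneg_right this hM
    have h1 : (n : ℝ) / Fintype.card G * S ≤ 2 * n ^ 2 * W :=
      hlow.trans (mul_le_mul_of_nonneg_right hM2 hW0)
    rw [div_mul_eq_mul_div, div_le_iff₀ hq] at h1
    have h2 : (n : ℝ) * S ≤ n * (2 * Fintype.card G * n * W) := by linarith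
    exact le_of_mul_le_mul_left h2 (by linarith)
  have h3 : 2 * (Fintype.card G : ℝ) * (n * (f x - c) ^ 2) ≤ 2 * Fintype.card G * S :=
    mul_le_mul_of_nonneg_left hS1 (by positivity)
  calc grad f x ≤ 2 * (1 + Fintype.card G) * S := by linarith
    _ ≤ 2 * (1 + Fintype.card G) * (2 * Fintype.card G * n * W) :=
      mul_le_mul_of_nonneg_left hS2 (by positivity)
    _ = _ := by ring

lemma sq_avgOp_sub_le (hn : 2 ≤ n) (f : Config G n → ℝ) (x y : Config G n) :
    (avgOp f x - avgOp f y) ^ 2 * Fintype.card (Move n) ≤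
      ∑ m : Move n, (f (applyMove G x m) - f (applyMove G y m)) ^ 2 := by
  have hM := card_move_pos hn
  have h := sq_sum_le_card_mul_sum_sq (s := (Finset.univ : Finset (Move n)))
    (f := fun m => f (applyMove G x m) - f (applyMove G y m))
  rw [Finset.sum_sub_distrib, Finset.card_univ] at h
  have h2 : avgOp f x - avgOp f y =
      (∑ m : Move n, f (applyMove G x m) - ∑ m : Move n, f (applyMove G y m)) /
        Fintype.card (Move n) := by rw [avgOp_apply, avgOp_apply, sub_div]
  rw [h2, div_pow, div_mul_eq_mul_div, div_le_iff₀ (by positivity)]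
  nlinarith

lemma src_mulAt_ne (x : Config G n) {i j : Fin n} (h : G) (e : Bool) (hij : j ≠ i) :
    src (mulAt x i h) j e = src x j e := by
  simp [src, mulAt_ne x h hij]

lemma mulAt_mulAt_same (x : Config G n) (i : Fin n) (g h : G) :
    mulAt (mulAt x i g) i h = mulAt x i (g * h) := by
  simp [mulAt, mul_assoc]

lemma mulAt_comm (x : Config G n) {i j : Fin n} (hij : i ≠ j) (g h : G) :
    mulAt (mulAt x i g) j h = mulAt (mulAt x j h) i g := by
  funext k
  by_cases hi : k = i
  · subst hi
    simp [mulAt_ne _ _ hij, mulAt_self]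
  · by_cases hj : k = j
    · subst hj
      simp [mulAt_ne _ _ hi, mulAt_self]
    · simp [mulAt_ne _ _ hi, mulAt_ne _ _ hj]

/-- A perturbation away from the source commutes with the move up to conjugation. -/
lemma sum_grad_of_ne (f : Config G n → ℝ) (x : Config G n) (i₀ : Fin n) {i j : Fin n}
    (hj : j ≠ i₀) (e : Bool) :
    ∑ h, (f (mulAt (mulAt x i₀ h) i (src (mulAt x i₀ h) j e)) - f (mulAt x i (src x j e))) ^ 2 =
      siteGrad f (mulAt x i (src x j e)) i₀ := by
  simp only [src_mulAt_ne x _ e hj]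
  set s := src x j e
  by_cases hi : i = i₀
  · subst hi
    have h1 := Equiv.sum_comp (MulAut.conj s⁻¹).toEquiv
      (fun h => (f (mulAt (mulAt x i s) i h) - f (mulAt x i s)) ^ 2)
    rw [siteGrad, ← h1]
    refine Finset.sum_congr rfl fun h _ => ?_
    rw [mulAt_mulAt_same, mulAt_mulAt_same]
    simp [mul_assoc]
  · rw [siteGrad]
    refine Finset.sum_congr rfl fun h _ => ?_
    rw [mulAt_comm x (Ne.symm hi)]

lemma sum_grad_self (f : Config G n → ℝ) (x : Config G n) (i j : Fin n) (e : Bool) :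
    ∑ h, (f (mulAt (mulAt x j h) i (src (mulAt x j h) j e)) - f (mulAt x i (src x j e))) ^ 2 ≤
      3 * (∑ h, siteGrad f (mulAt x j h) i + siteGrad f x j + Fintype.card G * siteGrad f x i) := by
  have h1 : ∀ h, (f (mulAt (mulAt x j h) i (src (mulAt x j h) j e)) -
      f (mulAt x i (src x j e))) ^ 2 ≤
      3 * (siteGrad f (mulAt x j h) i + (f (mulAt x j h) - f x) ^ 2 + siteGrad f x i) := by
    intro h
    have a1 := le_siteGrad f (mulAt x j h) i (src (mulAt x j h) j e)
    have a2 := le_siteGrad f x i (src x j e)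
    set A := f (mulAt (mulAt x j h) i (src (mulAt x j h) j e))
    set B := f (mulAt x i (src x j e))
    set C := f (mulAt x j h)
    nlinarith [sq_nonneg (A - C - (C - f x)), sq_nonneg (A - C + (B - f x)),
      sq_nonneg (C - f x + (B - f x))]
  refine (Finset.sum_le_sum fun h _ => h1 h).trans_eq ?_
  rw [← Finset.mul_sum, Finset.sum_add_distrib, Finset.sum_add_distrib, Finset.sum_const,
    Finset.card_univ, nsmul_eq_mul]
  rfl

lemma sum_triple (a : Fin n → Fin n → ℝ) (b : Fin n → ℝ) (c : ℝ) :
    ∑ i, ∑ j, ∑ _e : Bool, (a i j + b j + c * b i) =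
      2 * ∑ i, ∑ j, a i j + 2 * n * (1 + c) * ∑ i, b i := by
  simp only [Finset.sum_const, Finset.card_univ, Fintype.card_bool, nsmul_eq_mul,
    ← Finset.mul_sum, Finset.sum_add_distrib, Fintype.card_fin]
  push_cast
  ring

lemma grad_avgOp_le {x : Config G n} (h2n : 2 ≤ n) (hn : 4 * Fintype.card G ≤ n)
    (hx : Real.sqrt (esq x) ≤ n / (4 * Fintype.card G)) (f : Config G n → ℝ) :
    grad (avgOp f) x ≤
      (1 + 6 * Fintype.card G * (2 + Fintype.card G) / n) * avgOp (grad f) x := by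
  have hM := card_move_pos h2n
  have hn' : (2 : ℝ) ≤ n := by exact_mod_cast h2n
  have hq := card_pos' (G := G)
  have h1 : grad (avgOp f) x * Fintype.card (Move n) ≤
      ∑ m : Move n, ∑ i₀, ∑ h, (f (applyMove G (mulAt x i₀ h) m) - f (applyMove G x m)) ^ 2 := by
    rw [grad, Finset.sum_mul, Finset.sum_comm]
    refine Finset.sum_le_sum fun i _ => ?_
    rw [siteGrad, Finset.sum_mul, Finset.sum_comm]
    exact Finset.sum_le_sum fun h _ => sq_avgOp_sub_le h2n f _ _
  have h2 : ∀ m : Move n,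
      ∑ i₀, ∑ h, (f (applyMove G (mulAt x i₀ h) m) - f (applyMove G x m)) ^ 2 ≤
      grad f (applyMove G x m) + 3 * (∑ h, siteGrad f (mulAt x m.1.1.2 h) m.1.1.1 +
        siteGrad f x m.1.1.2 + Fintype.card G * siteGrad f x m.1.1.1) := by
    intro m
    rw [← Finset.add_sum_erase _ _ (Finset.mem_univ m.1.1.2), add_comm]
    refine add_le_add ?_ (sum_grad_self f x m.1.1.1 m.1.1.2 m.2)
    calc _ = ∑ i₀ ∈ Finset.univ.erase m.1.1.2, siteGrad f (applyMove G x m) i₀ :=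
          Finset.sum_congr rfl fun i₀ hi₀ =>
            sum_grad_of_ne f x i₀ (Finset.ne_of_mem_erase hi₀).symm m.2
      _ ≤ _ := Finset.sum_le_sum_of_subset_of_nonneg (Finset.subset_univ _)
          fun i _ _ => siteGrad_nonneg _ _ _
  have h3 : ∑ m : Move n, (∑ h, siteGrad f (mulAt x m.1.1.2 h) m.1.1.1 +
        siteGrad f x m.1.1.2 + Fintype.card G * siteGrad f x m.1.1.1) ≤
      2 * ∑ j, ∑ h, grad f (mulAt x j h) + 2 * n * (1 + Fintype.card G) * grad f x := by
    rw [sum_move_pair (fun i j _ => ∑ h, siteGrad f (mulAt x j h) i +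
        siteGrad f x j + Fintype.card G * siteGrad f x i)]
    have h0 : 0 ≤ ∑ i : Fin n, ∑ _e : Bool, (∑ h, siteGrad f (mulAt x i h) i +
        siteGrad f x i + Fintype.card G * siteGrad f x i) :=
      Finset.sum_nonneg fun i _ => Finset.sum_nonneg fun e _ =>
        add_nonneg (add_nonneg (Finset.sum_nonneg fun h _ => siteGrad_nonneg _ _ _)
          (siteGrad_nonneg f x i)) (mul_nonneg hq.le (siteGrad_nonneg f x i))
    have e1 : ∑ i, ∑ j, ∑ _e : Bool, (∑ h, siteGrad f (mulAt x j h) i +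
        siteGrad f x j + Fintype.card G * siteGrad f x i) =
        2 * ∑ j, ∑ h, grad f (mulAt x j h) + 2 * n * (1 + Fintype.card G) * grad f x := by
      rw [sum_triple (fun i j => ∑ h, siteGrad f (mulAt x j h) i) (siteGrad f x)]
      have e2 : ∑ i, ∑ j, ∑ h, siteGrad f (mulAt x j h) i = ∑ j, ∑ h, grad f (mulAt x j h) := by
        rw [Finset.sum_comm]
        refine Finset.sum_congr rfl fun j _ => ?_
        rw [Finset.sum_comm]
        rfl
      rw [e2]
      rfl
    linarith
  set T := ∑ j, ∑ h, grad f (mulAt x j h) with hT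
  have h4 : n * grad f x ≤ T := by
    calc n * grad f x = ∑ j : Fin n, grad f (mulAt x j 1) := by simp [mulAt_one]
      _ ≤ T := Finset.sum_le_sum fun j _ =>
        Finset.single_le_sum (f := fun h => grad f (mulAt x j h))
          (fun _ _ => grad_nonneg _ _) (Finset.mem_univ 1)
  have h5 := sum_move_src_lower hn hx (fun i g => grad f (mulAt x i g))
    (fun _ _ => grad_nonneg _ _)
  have h6 : ∑ m : Move n, grad f (mulAt x m.1.1.1 (src x m.1.1.2 m.2)) =
      Fintype.card (Move n) * avgOp (grad f) x := by
    rw [avgOp_apply]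
    field_simp
    rfl
  have h6' : ∑ m : Move n, grad f (applyMove G x m) =
      Fintype.card (Move n) * avgOp (grad f) x := h6
  rw [h6] at h5
  have h7 : grad (avgOp f) x * Fintype.card (Move n) ≤ Fintype.card (Move n) * avgOp (grad f) x +
      3 * (2 * T + 2 * n * (1 + Fintype.card G) * grad f x) := by
    refine h1.trans ((Finset.sum_le_sum fun m _ => h2 m).trans ?_)
    rw [Finset.sum_add_distrib, ← Finset.mul_sum, h6']
    linarith
  have h8 : T ≤ Fintype.card G / n * (Fintype.card (Move n) * avgOp (grad f) x) := by
    rw [div_mul_eq_mul_div, le_div_iff₀ (by linarith)]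
    rw [div_mul_eq_mul_div, div_le_iff₀ hq] at h5
    linarith
  have h9 : 3 * (2 * T + 2 * n * (1 + Fintype.card G) * grad f x) ≤
      6 * (2 + Fintype.card G) * T := by
    have : (1 + (Fintype.card G : ℝ)) * (n * grad f x) ≤ (1 + Fintype.card G) * T :=
      mul_le_mul_of_nonneg_left h4 (by positivity)
    linarith
  have h10 : 6 * (2 + (Fintype.card G : ℝ)) * T ≤ 6 * (2 + Fintype.card G) *
      (Fintype.card G / n * (Fintype.card (Move n) * avgOp (grad f) x)) :=
    mul_le_mul_of_nonneg_left h8 (by positivity)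
  refine le_of_mul_le_mul_right ?_ hM
  refine (h7.trans (add_le_add le_rfl (h9.trans h10))).trans_eq ?_
  field_simp

lemma abs_dsq_mulAt_sub_le (κ : Fin n → A) (x : Config G n) (i : Fin n) (h : G) :
    |dsq κ (mulAt x i h) - dsq κ x| ≤ 4 * Real.sqrt (dsq κ x) + 4 := by
  have h1 := abs_ip_le (dev κ x) (bumpDiff κ x i h)
  have h2 := sq_bumpDiff_le κ x i h
  have h3 := sq_nonneg' (bumpDiff κ x i h)
  have h4 : Real.sqrt (sq (bumpDiff κ x i h)) ≤ 2 := by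
    rw [show (2 : ℝ) = Real.sqrt 4 by
      rw [show (4 : ℝ) = 2 ^ 2 by norm_num, Real.sqrt_sq (by norm_num)]]
    exact Real.sqrt_le_sqrt h2
  have h5 : Real.sqrt (sq (dev κ x)) * Real.sqrt (sq (bumpDiff κ x i h)) ≤
      Real.sqrt (sq (dev κ x)) * 2 := mul_le_mul_of_nonneg_left h4 (Real.sqrt_nonneg _)
  have h6 := abs_le.mp (h1.trans h5)
  rw [dsq, dsq, dev_mulAt, sq_add, abs_le]
  constructor <;> linarith [h6.1, h6.2]

lemma sqrt_dsq_mulAt_le (κ : Fin n → A) (x : Config G n) (i : Fin n) (h : G) :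
    Real.sqrt (dsq κ (mulAt x i h)) ≤ Real.sqrt (dsq κ x) + 2 := by
  have h1 := (abs_le.mp (abs_dsq_mulAt_sub_le κ x i h)).2
  have h2 := Real.sq_sqrt (dsq_nonneg κ x)
  have h3 := Real.sqrt_nonneg (dsq κ x)
  exact Real.sqrt_le_iff.mpr ⟨by linarith, by nlinarith⟩

lemma avgOp_const_mul_add (c : ℝ) (f g : Config G n → ℝ) (k : ℕ) (x : Config G n) :
    (avgOp ^ k) (fun z => c * f z + g z) x = c * (avgOp ^ k) f x + (avgOp ^ k) g x := by
  have : (fun z => c * f z + g z) = c • f + g := rfl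
  rw [this, map_add, map_smul]
  rfl

lemma avgOp_le_of_le {f : Config G n → ℝ} {x : Config G n} (hn : 2 ≤ n) {a b : ℝ}
    {g : Config G n → ℝ} (h : ∀ m, f (applyMove G x m) ≤ a * g (applyMove G x m) + b) :
    avgOp f x ≤ a * avgOp g x + b := by
  have hM := card_move_pos hn
  rw [avgOp_apply, avgOp_apply, div_le_iff₀ hM]
  refine (Finset.sum_le_sum fun m _ => h m).trans_eq ?_
  rw [Finset.sum_add_distrib, ← Finset.mul_sum, Finset.sum_const, Finset.card_univ, nsmul_eq_mul]
  field_simp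

/-- A potential that is at least one where the empirical counts are far from equidistribution. -/
def pot (x : Config G n) : ℝ := (16 * (Fintype.card G : ℝ) ^ 2 * (esq x + n) / n ^ 2) ^ 4

lemma pot_nonneg (x : Config G n) : 0 ≤ pot x := by
  have := esq_nonneg x
  unfold pot
  positivity

lemma avgOp_pot_le (hn : 64 ≤ n) (x : Config G n) :
    avgOp pot x ≤ (1 + 752 / n) * pot x := by
  have h2n : 2 ≤ n := by omega
  have hn' : (64 : ℝ) ≤ n := by exact_mod_cast hn
  set E : ℝ := esq x + n with hE
  have he0 := esq_nonneg x
  have hEn : (n : ℝ) ≤ E := by linarith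
  set c : ℝ := (16 * (Fintype.card G : ℝ) ^ 2 / n ^ 2) ^ 4 with hc
  have hc0 : 0 ≤ c := by positivity
  have hpot : ∀ z : Config G n, pot z = c * (esq z + n) ^ 4 := fun z => by
    rw [pot, hc]
    ring
  have hmove : ∀ m : Move n, pot (applyMove G x m) ≤
      (4 * c * E ^ 3) * esq (applyMove G x m) +
        (c * E ^ 4 + 704 * c * E ^ 3 - 4 * c * E ^ 3 * esq x) := by
    intro m
    have h1 := abs_dsq_mulAt_sub_le (fun _ => ()) x m.1.1.1 (src x m.1.1.2 m.2)
    rw [← applyMove_eq] at h1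
    change |esq (applyMove G x m) - esq x| ≤ 4 * Real.sqrt (esq x) + 4 at h1
    set D := esq (applyMove G x m) - esq x with hD
    have h2 : 4 * Real.sqrt (esq x) + 4 ≤ 8 * Real.sqrt E := by
      have a1 : Real.sqrt (esq x) ≤ Real.sqrt E := Real.sqrt_le_sqrt (by linarith)
      have a2 : 1 ≤ Real.sqrt E := Real.one_le_sqrt.mpr (by linarith)
      linarith
    have h3 : D ^ 2 ≤ 64 * E := by
      have : |D| ^ 2 ≤ (8 * Real.sqrt E) ^ 2 :=
        pow_le_pow_left₀ (abs_nonneg _) (h1.trans h2) 2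
      rw [sq_abs, mul_pow, Real.sq_sqrt (by linarith)] at this
      linarith
    have h4 : |D| ≤ E := by
      refine abs_le_of_sq_le_sq ?_ (by linarith)
      nlinarith
    have h5 : (E + D) ^ 4 ≤ E ^ 4 + 4 * E ^ 3 * D + 704 * E ^ 3 := by
      have b1 := (abs_le.mp h4).1
      have b2 := (abs_le.mp h4).2
      have b3 : D ^ 2 * (6 * E ^ 2 + 4 * E * D + D ^ 2) ≤ 64 * E * (11 * E ^ 2) := by
        have b4 : D ^ 2 ≤ E ^ 2 := by nlinarith
        have b5 : 6 * E ^ 2 + 4 * E * D + D ^ 2 ≤ 11 * E ^ 2 := by nlinarith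
        have b6 : 0 ≤ 11 * E ^ 2 := by positivity
        exact mul_le_mul h3 b5 (by nlinarith [sq_nonneg (2 * E + D)]) (by linarith)
      nlinarith
    rw [hpot]
    have h6 : esq (applyMove G x m) + n = E + D := by rw [hD, hE]; ring
    rw [h6]
    have h7 := mul_le_mul_of_nonneg_left h5 hc0
    have h8 : esq (applyMove G x m) = esq x + D := by rw [hD]; ring
    rw [h8]
    linarith
  have h1 := avgOp_le_of_le h2n hmove
  have h2 : avgOp esq x ≤ esq x + 12 := avgOp_dsq_le_add h2n _ x
  have h3 : 4 * c * E ^ 3 * avgOp esq x ≤ 4 * c * E ^ 3 * (esq x + 12) :=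
    mul_le_mul_of_nonneg_left h2 (by positivity)
  have h4 : avgOp pot x ≤ c * E ^ 4 + 752 * (c * E ^ 3) := by linarith
  rw [hpot, ← hE]
  have h5 : c * E ^ 3 ≤ c * E ^ 4 / n := by
    rw [le_div_iff₀ (by linarith)]
    have : c * E ^ 3 * n ≤ c * E ^ 3 * E := mul_le_mul_of_nonneg_left hEn (by positivity)
    linarith
  have h6 : (1 + 752 / (n : ℝ)) * (c * E ^ 4) = c * E ^ 4 + 752 * (c * E ^ 4 / n) := by ring
  linarith

lemma one_le_pot (hn : 0 < n) {x : Config G n}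
    (hx : n / (4 * Fintype.card G) < Real.sqrt (esq x)) : 1 ≤ pot x := by
  have hq := card_pos' (G := G)
  have hn' : (0 : ℝ) < n := by exact_mod_cast hn
  have h1 : ((n : ℝ) / (4 * Fintype.card G)) ^ 2 ≤ esq x := by
    rw [← Real.sq_sqrt (esq_nonneg x)]
    exact pow_le_pow_left₀ (by positivity) hx.le 2
  refine one_le_pow₀ ?_
  rw [le_div_iff₀ (by positivity)]
  rw [div_pow, div_le_iff₀ (by positivity)] at h1
  nlinarith [sq_nonneg (Fintype.card G : ℝ)]

variable (G) in
/-- The exponential rate in the gradient estimates. -/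
def rate : ℝ := 6 * (Fintype.card G : ℝ) * (2 + Fintype.card G) + 752

lemma rate_pos : 0 < rate G := by
  have := card_pos' (G := G)
  unfold rate
  positivity

variable {f : Config G n → ℝ}

lemma avgOp_pow_mem (hn : 2 ≤ n) (h0 : ∀ x, 0 ≤ f x) (h1 : ∀ x, f x ≤ 1) (k : ℕ) :
    (∀ x, 0 ≤ (avgOp ^ k) f x) ∧ ∀ x, (avgOp ^ k) f x ≤ 1 :=
  ⟨avgOp_pow_nonneg h0 k, avgOp_pow_le hn h1 k⟩

lemma avgOp_pow_pot_le (hn : 64 ≤ n) (k : ℕ) (x : Config G n) :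
    (avgOp ^ k) pot x ≤ (1 + rate G / n) ^ k * pot x := by
  have hn' : (64 : ℝ) ≤ n := by exact_mod_cast hn
  have hr := rate_pos (G := G)
  induction k generalizing x with
  | zero => simp
  | succ k ih =>
    rw [pow_succ, Module.End.mul_apply]
    have h1 : avgOp (pot (G := G) (n := n)) ≤ fun z => (1 + rate G / n) * pot z + 0 := fun z => by
      refine (avgOp_pot_le hn z).trans ?_
      simp only [add_zero]
      refine mul_le_mul_of_nonneg_right ?_ (pot_nonneg z)
      have : (752 : ℝ) ≤ rate G := by
        have := card_pos' (G := G)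
        have : 0 ≤ 6 * (Fintype.card G : ℝ) * (2 + Fintype.card G) := by positivity
        unfold rate
        linarith
      gcongr
    refine (avgOp_pow_mono h1 k x).trans ?_
    rw [avgOp_const_mul_add (1 + rate G / n) pot (fun _ => 0), avgOp_pow_const (by omega),
      add_zero, pow_succ, mul_comm _ (1 + rate G / n), mul_assoc]
    exact mul_le_mul_of_nonneg_left (ih x) (by positivity)

lemma grad_avgOp_le_pot (hn : 64 ≤ n) (hnG : 4 * Fintype.card G ≤ n)
    (h0 : ∀ x, 0 ≤ f x) (h1 : ∀ x, f x ≤ 1) (x : Config G n) :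
    grad (avgOp f) x ≤ (1 + rate G / n) * avgOp (grad f) x + n * Fintype.card G * pot x := by
  have hn' : (64 : ℝ) ≤ n := by exact_mod_cast hn
  have hq := card_pos' (G := G)
  have hr := rate_pos (G := G)
  have hg : 0 ≤ avgOp (grad f) x := avgOp_pow_nonneg (grad_nonneg f) 1 x
  have hp := pot_nonneg x
  rcases le_or_gt (Real.sqrt (esq x)) (n / (4 * Fintype.card G)) with hx | hx
  · refine (grad_avgOp_le (by omega) hnG hx f).trans ?_
    have h2 : (1 + 6 * (Fintype.card G : ℝ) * (2 + Fintype.card G) / n) ≤ 1 + rate G / n := by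
      unfold rate
      gcongr
      linarith
    have h3 := mul_le_mul_of_nonneg_right h2 hg
    have : 0 ≤ n * Fintype.card G * pot x := by positivity
    linarith
  · have h2 := one_le_pot (by omega) hx
    have hm := avgOp_pow_mem (by omega) h0 h1 1
    rw [pow_one] at hm
    have h3 := grad_le hm.1 hm.2 x
    have h4 : n * (Fintype.card G : ℝ) ≤ n * Fintype.card G * pot x :=
      le_mul_of_one_le_right (by positivity) h2
    have : 0 ≤ (1 + rate G / n) * avgOp (grad f) x := by positivity
    linarith

lemma grad_le_variance_pot (hn : 64 ≤ n) (hnG : 4 * Fintype.card G ≤ n)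
    (h0 : ∀ x, 0 ≤ f x) (h1 : ∀ x, f x ≤ 1) (x : Config G n) :
    grad f x ≤ 4 * Fintype.card G * (1 + Fintype.card G) * n *
      (avgOp (fun z => f z ^ 2) x - avgOp f x ^ 2) + n * Fintype.card G * pot x := by
  have hn' : (64 : ℝ) ≤ n := by exact_mod_cast hn
  have hq := card_pos' (G := G)
  have hp := pot_nonneg x
  rcases le_or_gt (Real.sqrt (esq x)) (n / (4 * Fintype.card G)) with hx | hx
  · have : 0 ≤ n * Fintype.card G * pot x := by positivity
    linarith [grad_le_variance (by omega) hnG hx f]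
  · have h2 := one_le_pot (by omega) hx
    have h4 : n * (Fintype.card G : ℝ) ≤ n * Fintype.card G * pot x :=
      le_mul_of_one_le_right (by positivity) h2
    have h5 : 0 ≤ avgOp (fun z => f z ^ 2) x - avgOp f x ^ 2 := by
      have hM := card_move_pos (n := n) (by omega)
      have h6 := sq_sum_le_card_mul_sum_sq (s := (Finset.univ : Finset (Move n)))
        (f := fun m => f (applyMove G x m))
      rw [Finset.card_univ] at h6
      rw [avgOp_apply, avgOp_apply, div_pow, sub_nonneg, div_le_div_iff₀ (by positivity) hM]
      nlinarith
    have h7 := mul_nonneg (a := 4 * Fintype.card G * (1 + Fintype.card G) * (n : ℝ))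
      (by positivity) h5
    linarith [grad_le h0 h1 x]

lemma grad_avgOp_pow_le (hn : 64 ≤ n) (hnG : 4 * Fintype.card G ≤ n)
    (h0 : ∀ x, 0 ≤ f x) (h1 : ∀ x, f x ≤ 1) (s : ℕ) (x : Config G n) :
    grad ((avgOp ^ s) f) x ≤ (1 + rate G / n) ^ (2 * s) *
      ((avgOp ^ s) (grad f) x + s * (n * Fintype.card G) * pot x) := by
  have hn' : (64 : ℝ) ≤ n := by exact_mod_cast hn
  have hr := rate_pos (G := G)
  have hq := card_pos' (G := G)
  set ρ := 1 + rate G / n with hρ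
  have hρ1 : 1 ≤ ρ := by
    have : 0 ≤ rate G / n := by positivity
    linarith
  induction s generalizing x with
  | zero => simp
  | succ s ih =>
    have hm := avgOp_pow_mem (by omega) h0 h1 s
    have h2 := grad_avgOp_le_pot hn hnG hm.1 hm.2 x
    have h3 : avgOp (grad ((avgOp ^ s) f)) x ≤ ρ ^ (2 * s) *
        ((avgOp ^ (s + 1)) (grad f) x + s * (n * Fintype.card G) * avgOp pot x) := by
      refine (avgOp_mono (g := fun x => ρ ^ (2 * s) * (avgOp ^ s) (grad f) x +
        ρ ^ (2 * s) * (s * (n * Fintype.card G)) * pot x) (fun z => by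
          refine (ih z).trans_eq ?_
          ring) x).trans_eq ?_
      have e1 := avgOp_const_mul_add (ρ ^ (2 * s)) ((avgOp ^ s) (grad f))
        (fun x => ρ ^ (2 * s) * (s * (n * Fintype.card G)) * pot x + 0) 1 x
      have e2 := avgOp_const_mul_add (ρ ^ (2 * s) * (s * (n * Fintype.card G))) (pot (G := G))
        (fun _ => 0) 1 x
      rw [avgOp_pow_const (by omega)] at e2
      rw [e2] at e1
      simp only [pow_one, add_zero] at e1
      rw [e1, pow_succ' avgOp, Module.End.mul_apply]
      ring
    have h4 : avgOp pot x ≤ ρ * pot x := by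
      have := avgOp_pow_pot_le hn 1 x
      rwa [pow_one, pow_one] at this
    have hp := pot_nonneg x
    have hP : 0 ≤ (avgOp ^ (s + 1)) (grad f) x := avgOp_pow_nonneg (grad_nonneg f) _ x
    rw [pow_succ' avgOp, Module.End.mul_apply] at hP ⊢
    rw [pow_succ' avgOp, Module.End.mul_apply] at h3
    set X := avgOp ((avgOp ^ s) (grad f)) x
    set N : ℝ := n * Fintype.card G with hN
    have hN0 : 0 ≤ N := by positivity
    calc grad (avgOp ((avgOp ^ s) f)) x
        ≤ ρ * (ρ ^ (2 * s) * (X + s * N * avgOp pot x)) + N * pot x :=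
          h2.trans (by gcongr)
      _ ≤ ρ * (ρ ^ (2 * s) * (X + s * N * (ρ * pot x))) + N * pot x := by gcongr
      _ = ρ ^ (2 * s + 1) * X + ρ ^ (2 * s + 2) * (s * N * pot x) + 1 * (N * pot x) := by ring
      _ ≤ ρ ^ (2 * s + 2) * X + ρ ^ (2 * s + 2) * (s * N * pot x) +
          ρ ^ (2 * s + 2) * (N * pot x) := by
        have b1 : ρ ^ (2 * s + 1) * X ≤ ρ ^ (2 * s + 2) * X :=
          mul_le_mul_of_nonneg_right (pow_le_pow_right₀ hρ1 (by omega)) hP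
        have b2 : 1 * (N * pot x) ≤ ρ ^ (2 * s + 2) * (N * pot x) :=
          mul_le_mul_of_nonneg_right (one_le_pow₀ hρ1) (mul_nonneg hN0 hp)
        linarith
      _ = ρ ^ (2 * (s + 1)) * (X + ((s + 1 : ℕ) : ℝ) * N * pot x) := by
        push_cast
        ring

lemma mul_grad_avgOp_pow_le (hn : 64 ≤ n) (hnG : 4 * Fintype.card G ≤ n)
    (h0 : ∀ x, 0 ≤ f x) (h1 : ∀ x, f x ≤ 1) (t : ℕ) (x : Config G n) :
    t * grad ((avgOp ^ (t - 1)) f) x ≤ (1 + rate G / n) ^ (2 * t) *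
      (4 * Fintype.card G * (1 + Fintype.card G) * n +
        t * (n * Fintype.card G * ((1 + rate G / n) ^ t * pot x)) +
        t * (t * (n * Fintype.card G) * pot x)) := by
  have hn' : (64 : ℝ) ≤ n := by exact_mod_cast hn
  have hr := rate_pos (G := G)
  have hq := card_pos' (G := G)
  set ρ := 1 + rate G / n with hρ
  have hρ1 : 1 ≤ ρ := by
    have : 0 ≤ rate G / n := by positivity
    linarith
  have hp := pot_nonneg x
  set C : ℝ := 4 * Fintype.card G * (1 + Fintype.card G) * n with hC
  have hC0 : 0 ≤ C := by positivity
  set N : ℝ := n * Fintype.card G with hN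
  have hN0 : 0 ≤ N := by positivity
  set a : ℕ → ℝ := fun s => (avgOp ^ s) (fun z => (avgOp ^ (t - s)) f z ^ 2) x with ha
  have hstep : ∀ s ∈ Finset.range t, grad ((avgOp ^ (t - 1)) f) x ≤
      ρ ^ (2 * t) * (C * (a (s + 1) - a s) + N * (ρ ^ t * pot x) + t * N * pot x) := by
    intro s hs
    rw [Finset.mem_range] at hs
    have hm := avgOp_pow_mem (by omega) h0 h1 (t - 1 - s)
    have h2 := grad_avgOp_pow_le hn hnG hm.1 hm.2 s x
    rw [← avgOp_pow_add_apply, show s + (t - 1 - s) = t - 1 by omega] at h2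
    have h3 : (avgOp ^ s) (grad ((avgOp ^ (t - 1 - s)) f)) x ≤
        C * (a (s + 1) - a s) + N * (ρ ^ t * pot x) := by
      set g := (avgOp ^ (t - 1 - s)) f with hg
      have hPg : avgOp g = (avgOp ^ (t - s)) f := by
        rw [hg, ← Module.End.mul_apply, ← pow_succ', show t - 1 - s + 1 = t - s by omega]
      have h4 : grad g ≤ fun z => C * avgOp (fun z => g z ^ 2) z +
          ((-C) * (avgOp g z ^ 2) + (N * pot z + 0)) := fun z => by
        refine (grad_le_variance_pot hn hnG hm.1 hm.2 z).trans_eq ?_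
        ring
      refine (avgOp_pow_mono h4 s x).trans ?_
      rw [avgOp_const_mul_add C (avgOp fun z => g z ^ 2)
          (fun z => (-C) * (avgOp g z ^ 2) + (N * pot z + 0)),
        avgOp_const_mul_add (-C) (fun z => avgOp g z ^ 2) (fun z => N * pot z + 0),
        avgOp_const_mul_add N pot (fun _ => 0), avgOp_pow_const (by omega), hPg]
      have e1 : (avgOp ^ s) (avgOp fun z => g z ^ 2) x = a (s + 1) := by
        rw [ha]
        simp only
        rw [pow_succ, Module.End.mul_apply, show t - (s + 1) = t - 1 - s by omega]
      rw [e1]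
      have h5 : (avgOp ^ s) pot x ≤ ρ ^ t * pot x := by
        refine (avgOp_pow_pot_le hn s x).trans ?_
        gcongr
      have h6 := mul_le_mul_of_nonneg_left h5 hN0
      have e2 : (avgOp ^ s) (fun z => (avgOp ^ (t - s)) f z ^ 2) x = a s := rfl
      rw [e2]
      linarith
    have h4 : 0 ≤ (avgOp ^ s) (grad ((avgOp ^ (t - 1 - s)) f)) x :=
      avgOp_pow_nonneg (grad_nonneg _) s x
    refine h2.trans ?_
    calc _ ≤ ρ ^ (2 * t) * ((avgOp ^ s) (grad ((avgOp ^ (t - 1 - s)) f)) x + s * N * pot x) := by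
          gcongr
      _ ≤ _ := by
          refine mul_le_mul_of_nonneg_left (add_le_add h3 ?_) (by positivity)
          gcongr
  have h := Finset.sum_le_sum hstep
  rw [Finset.sum_const, Finset.card_range, nsmul_eq_mul, ← Finset.mul_sum,
    Finset.sum_add_distrib, Finset.sum_add_distrib, ← Finset.mul_sum, Finset.sum_range_sub,
    Finset.sum_const, Finset.sum_const, Finset.card_range, nsmul_eq_mul, nsmul_eq_mul] at h
  refine h.trans (mul_le_mul_of_nonneg_left ?_ (by positivity))
  have h5 : a t - a 0 ≤ 1 := by
    have hm := avgOp_pow_mem (by omega) h0 h1 (t - t)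
    have h6 : a t ≤ 1 := avgOp_pow_le (by omega) (fun z => by
      have := hm.1 z
      have := hm.2 z
      nlinarith) t x
    have h7 : 0 ≤ a 0 := sq_nonneg _
    linarith
  have h8 : C * (a t - a 0) ≤ C := mul_le_of_le_one_right hC0 h5
  linarith

lemma exists_grad_le : ∃ C : ℝ, 1 ≤ C ∧ ∀ n : ℕ, 64 ≤ n → 4 * Fintype.card G ≤ n →
    ∀ f : Config G n → ℝ, (∀ x, 0 ≤ f x) → (∀ x, f x ≤ 1) → ∀ x,
      grad ((avgOp ^ (n - 1)) f) x ≤ C * (1 + (esq x + n) ^ 4 / n ^ 6) := by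
  have hr := rate_pos (G := G)
  have hq := card_pos' (G := G)
  have hq1 := one_le_card (G := G)
  set q : ℝ := (Fintype.card G : ℝ) with hqd
  refine ⟨Real.exp (3 * rate G) * (4 * q * (1 + q) + 2 * q * (16 * q ^ 2) ^ 4), ?_, ?_⟩
  · have h1 : 1 ≤ Real.exp (3 * rate G) := Real.one_le_exp (by positivity)
    have h2 : 1 ≤ 4 * q * (1 + q) := by nlinarith
    have h3 : 0 ≤ 2 * q * (16 * q ^ 2) ^ 4 := by positivity
    nlinarith
  · intro n hn hnG f h0 h1 x
    have hn' : (64 : ℝ) ≤ n := by exact_mod_cast hn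
    have h := mul_grad_avgOp_pow_le hn hnG h0 h1 n x
    rw [← hqd] at h
    have he0 := esq_nonneg x
    have hp := pot_nonneg x
    have hexp : (1 + rate G / n) ^ n ≤ Real.exp (rate G) := by
      have h2 : 1 + rate G / n ≤ Real.exp (rate G / n) := by
        linarith [Real.add_one_le_exp (rate G / n)]
      calc (1 + rate G / n) ^ n ≤ Real.exp (rate G / n) ^ n :=
            pow_le_pow_left₀ (by positivity) h2 n
        _ = Real.exp (rate G) := by
            rw [← Real.exp_nat_mul]
            congr 1
            field_simp
    have hR1 : 1 ≤ Real.exp (rate G) := Real.one_le_exp hr.le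
    set R := Real.exp (rate G) with hR
    have hR3 : Real.exp (3 * rate G) = R ^ 3 := by
      rw [hR, ← Real.exp_nat_mul]
      norm_num
    rw [hR3]
    rw [mul_comm 2 n, pow_mul] at h
    have hρ0 : 0 ≤ (1 + rate G / (n : ℝ)) ^ n := by positivity
    set ρn := (1 + rate G / (n : ℝ)) ^ n with hρn
    have h3 : n * grad ((avgOp ^ (n - 1)) f) x ≤ n * (R ^ 3 * (4 * q * (1 + q) +
        2 * (n ^ 2 * q * pot x))) := by
      refine h.trans ?_
      calc ρn ^ 2 * (4 * q * (1 + q) * n + n * (n * q * (ρn * pot x)) + n * (n * (n * q) * pot x))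
          ≤ R ^ 2 * (4 * q * (1 + q) * n + n * (n * q * (R * pot x)) +
            n * (n * (n * q) * pot x)) := by gcongr
        _ = n * (R ^ 2 * (1 * (4 * q * (1 + q)) + R * (n * 1 * q * pot x)
            + 1 * (n ^ 2 * q * pot x))) := by ring
        _ ≤ n * (R ^ 2 * (R * (4 * q * (1 + q)) + R * (n * n * q * pot x)
            + R * (n ^ 2 * q * pot x))) := by
          gcongr
          linarith
        _ = _ := by ring
    have h4 := le_of_mul_le_mul_left h3 (by linarith)
    refine h4.trans ?_
    rw [mul_assoc (R ^ 3)]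
    refine mul_le_mul_of_nonneg_left ?_ (by positivity)
    have h5 : (n : ℝ) ^ 2 * pot x = (16 * q ^ 2) ^ 4 * ((esq x + n) ^ 4 / n ^ 6) := by
      rw [pot, ← hqd]
      field_simp
    have h6 : 0 ≤ (esq x + n) ^ 4 / (n : ℝ) ^ 6 := by positivity
    set Y := (esq x + n) ^ 4 / (n : ℝ) ^ 6
    have h7 : 0 ≤ 4 * q * (1 + q) * Y := by positivity
    have h8 : 0 ≤ 2 * q * (16 * q ^ 2) ^ 4 := by positivity
    have h9 : 2 * ((n : ℝ) ^ 2 * q * pot x) = 2 * q * (16 * q ^ 2) ^ 4 * Y := by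
      calc _ = 2 * q * ((n : ℝ) ^ 2 * pot x) := by ring
        _ = _ := by rw [h5]; ring
    rw [h9]
    linarith

lemma esq_le_dsq (κ : Fin n → A) (x : Config G n) : esq x ≤ Fintype.card A * dsq κ x := by
  have h1 : ∀ b : G, dev (fun _ : Fin n => ()) x () b = ∑ a, dev κ x a b := by
    intro b
    simp only [dev, Finset.sum_sub_distrib, ← Finset.sum_div]
    congr 1
    · simp only [cnt]
      rw [Finset.sum_comm]
      refine Finset.sum_congr rfl fun i _ => ?_
      simp [ite_and]
    · congr 1
      simp only [csz]
      rw [Finset.sum_comm]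
      refine Finset.sum_congr rfl fun i _ => ?_
      simp
  simp only [esq, dsq, sq, Finset.univ_unique, PUnit.default_eq_unit, Finset.sum_singleton]
  rw [Finset.sum_comm, Finset.mul_sum]
  refine Finset.sum_le_sum fun b _ => ?_
  rw [h1 b]
  exact sq_sum_le_card_mul_sum_sq

lemma dsq_comp {κ : Fin n → A} {τ : Equiv.Perm (Fin n)} (hτ : τ ∈ stab κ) (y : Config G n) :
    dsq κ (y ∘ τ) = dsq κ y := by
  have : dev κ (y ∘ τ) = dev κ y := by
    funext a b
    rw [dev, dev, cnt_comp hτ]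
  rw [dsq, dsq, this]

lemma cdiff_comp {κ : Fin n → A} {τ : Equiv.Perm (Fin n)} (hτ : τ ∈ stab κ) (x y : Config G n) :
    cdiff κ x (y ∘ τ) = cdiff κ x y := by
  rw [cdiff, cdiff, cnt_comp hτ]

lemma StabInv.mulAt_eq {κ : Fin n → A} {g : Config G n → ℝ} (hg : StabInv κ g) (z : Config G n)
    {i j : Fin n} (hκ : κ j = κ i) (hz : z j = z i) (h : G) : g (mulAt z j h) = g (mulAt z i h) := by
  have hs : Equiv.swap i j ∈ stab κ := by
    rw [mem_stab]
    intro k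
    rcases eq_or_ne k i with rfl | h1
    · rw [Equiv.swap_apply_left, hκ]
    · rcases eq_or_ne k j with rfl | h2
      · rw [Equiv.swap_apply_right, hκ]
      · rw [Equiv.swap_apply_of_ne_of_ne h1 h2]
  have hzs : z ∘ Equiv.swap i j = z := by
    funext k
    rcases eq_or_ne k i with rfl | h1
    · simp [hz]
    · rcases eq_or_ne k j with rfl | h2
      · simp [hz]
      · simp [Equiv.swap_apply_of_ne_of_ne h1 h2]
  have h3 := applyMove_comp (Equiv.swap i j) z i h
  rw [hzs, Equiv.swap_apply_left] at h3
  rw [h3, hg _ hs]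

lemma StabInv.cnt_mul_sq_le_grad {κ : Fin n → A} {g : Config G n → ℝ} (hg : StabInv κ g)
    (z : Config G n) (i : Fin n) (h : G) :
    cnt κ z (κ i) (z i) * (g (mulAt z i h) - g z) ^ 2 ≤ grad g z := by
  rw [cnt, Finset.sum_mul, grad]
  refine Finset.sum_le_sum fun j _ => ?_
  split_ifs with hj
  · rw [one_mul, ← hg.mulAt_eq z hj.1 hj.2 h]
    exact le_siteGrad g z j h
  · rw [zero_mul]
    exact siteGrad_nonneg _ _ _

lemma ham_mulAt {x y : Config G n} {i : Fin n} (hi : x i ≠ y i) :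
    ham x (mulAt y i ((y i)⁻¹ * x i)) = ham x y - 1 := by
  rw [eq_sub_iff_add_eq, ham, ham, ← Finset.add_sum_erase _ _ (Finset.mem_univ i),
    ← Finset.add_sum_erase _ (fun k => if x k = y k then (0 : ℝ) else 1) (Finset.mem_univ i)]
  rw [mulAt_self, if_pos (by group), if_neg hi, zero_add, add_comm]
  congr 1
  refine Finset.sum_congr rfl fun k hk => ?_
  rw [mulAt_ne _ _ (Finset.ne_of_mem_erase hk)]

lemma eq_of_ham_eq_zero {x y : Config G n} (h : ham x y = 0) : x = y := by
  funext i
  by_contra hi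
  have := (Finset.sum_eq_zero_iff_of_nonneg (fun j _ => by split_ifs <;> norm_num)).mp h i
    (Finset.mem_univ i)
  rw [if_neg hi] at this
  exact one_ne_zero this

lemma ham_nat (x y : Config G n) : ∃ k : ℕ, ham x y = k :=
  ⟨(Finset.univ.filter fun i => ¬ x i = y i).card, by
    rw [ham, Finset.card_filter]; push_cast
    refine Finset.sum_congr rfl fun i _ => ?_
    split_ifs <;> simp⟩

lemma abs_sub_le_ham_mul (κ : Fin n → A) (g : Config G n → ℝ) {R L : ℝ}
    (hL : ∀ z, Real.sqrt (dsq κ z) ≤ R → ∀ i h, |g (mulAt z i h) - g z| ≤ L)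
    (x y : Config G n) (hy : Real.sqrt (dsq κ y) + 2 * ham x y ≤ R) :
    |g x - g y| ≤ ham x y * L := by
  obtain ⟨k, hk⟩ := ham_nat x y
  induction k generalizing y with
  | zero =>
    have hxy : x = y := eq_of_ham_eq_zero (by simpa using hk)
    rw [hk, hxy]
    simp
  | succ k ih =>
    have hne : ∃ i, x i ≠ y i := by
      by_contra! hcon
      simp only [ham, hcon, if_true, Finset.sum_const_zero] at hk
      have : (0 : ℝ) < ((k + 1 : ℕ) : ℝ) := by positivity
      linarith
    obtain ⟨i, hi⟩ := hne
    have h1 := ham_mulAt hi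
    set y' := mulAt y i ((y i)⁻¹ * x i)
    have h2 := sqrt_dsq_mulAt_le κ y i ((y i)⁻¹ * x i)
    have h3 := ih y' (by rw [h1]; linarith) (by rw [h1, hk]; push_cast; ring)
    have h4 := hL y (by linarith [ham_nonneg x y]) i ((y i)⁻¹ * x i)
    rw [h1] at h3
    calc |g x - g y| ≤ |g x - g y'| + |g y' - g y| := abs_sub_le _ _ _
      _ ≤ (ham x y - 1) * L + L := add_le_add h3 h4
      _ = ham x y * L := by ring

variable (G) in
/-- After `n - 1` steps the averages of a bounded function invariant under the permutations
preserving a balanced labelling are Lipschitz with constant `O(n ^ (-1 / 2))`. -/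
lemma exists_lipschitz : ∃ C : ℝ, 1 ≤ C ∧ ∃ R : ℝ, ∀ (n : ℕ) (r : ℝ), R ≤ r → r ^ 4 = n →
    ∀ κ : Fin n → G, (∀ a, n / (2 * Fintype.card G) ≤ csz κ a) →
    ∀ f : Config G n → ℝ, (∀ x, 0 ≤ f x) → (∀ x, f x ≤ 1) → StabInv κ f →
    ∀ x y, dsq κ y ≤ r ^ 6 →
      |(avgOp ^ (n - 1)) f x - (avgOp ^ (n - 1)) f y| ≤ C * ham x y / r ^ 2 := by
  obtain ⟨C, hC1, hC⟩ := exists_grad_le (G := G)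
  set q : ℝ := (Fintype.card G : ℝ) with hq
  have hq1 : 1 ≤ q := one_le_card
  set D : ℝ := C * (1 + (9 * q + 1) ^ 4) * (4 * q ^ 2) with hD
  have hD0 : 0 ≤ D := by positivity
  refine ⟨1 + Real.sqrt D, by linarith [Real.sqrt_nonneg D], 12 * q ^ 2, ?_⟩
  intro n r hr hrn κ hκ f h0 h1 hf x y hy
  have hq2 : 1 ≤ q ^ 2 := one_le_pow₀ hq1
  have hr12 : 12 ≤ r := by nlinarith
  have hr0 : 0 < r := by linarith
  have hr3 : (12 : ℝ) ^ 3 ≤ r ^ 3 := pow_le_pow_left₀ (by norm_num) hr12 3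
  have hn4 : 4 * q ≤ n := by
    rw [← hrn]
    have : q ≤ q ^ 2 := by nlinarith
    nlinarith
  have hn64 : (64 : ℝ) ≤ n := by rw [← hrn]; nlinarith
  have hnn : 64 ≤ n := by exact_mod_cast hn64
  have hnG : 4 * Fintype.card G ≤ n := by rw [hq] at hn4; exact_mod_cast hn4
  obtain ⟨hg0, hg1⟩ := avgOp_pow_mem (by omega) h0 h1 (n - 1)
  have hg := hf.avgOp_pow (n - 1)
  have hgr := hC n hnn hnG f h0 h1
  set g := (avgOp ^ (n - 1)) f with hgdef
  clear_value g
  have hloc : ∀ z, Real.sqrt (dsq κ z) ≤ 3 * r ^ 3 → ∀ i h,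
      |g (mulAt z i h) - g z| ≤ Real.sqrt D / r ^ 2 := by
    intro z hz i h
    have hdev := abs_le_sqrt_sq (dev κ z) (κ i) (z i)
    have hcz := hκ (κ i)
    have hdz : dsq κ z ≤ 9 * r ^ 6 := by
      have := (Real.sqrt_le_left (by positivity)).mp hz
      calc dsq κ z ≤ (3 * r ^ 3) ^ 2 := this
        _ = _ := by ring
    have hez : esq z ≤ 9 * q * r ^ 6 := by
      have := esq_le_dsq κ z
      have h2 : q * dsq κ z ≤ q * (9 * r ^ 6) := mul_le_mul_of_nonneg_left hdz (by linarith)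
      linarith
    have hcnt : r ^ 4 / (4 * q ^ 2) ≤ cnt κ z (κ i) (z i) := by
      have h2 : cnt κ z (κ i) (z i) = dev κ z (κ i) (z i) + csz κ (κ i) / q := by
        rw [dev]; ring
      have h3 : r ^ 4 / (2 * q ^ 2) ≤ csz κ (κ i) / q := by
        rw [le_div_iff₀ (by linarith)]
        refine le_trans (le_of_eq ?_) hcz
        rw [← hrn]
        field_simp
      have h4 : 3 * r ^ 3 ≤ r ^ 4 / (4 * q ^ 2) := by
        rw [le_div_iff₀ (by positivity)]
        calc 3 * r ^ 3 * (4 * q ^ 2) = r ^ 3 * (12 * q ^ 2) := by ring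
          _ ≤ r ^ 3 * r := by gcongr
          _ = r ^ 4 := by ring
      have h5 : r ^ 4 / (2 * q ^ 2) = 2 * (r ^ 4 / (4 * q ^ 2)) := by field_simp; ring
      have h6 : |dev κ z (κ i) (z i)| ≤ 3 * r ^ 3 := hdev.trans hz
      have := neg_le_of_abs_le h6
      linarith
    have hgz : grad g z ≤ C * (1 + (9 * q + 1) ^ 4) := by
      refine (hgr z).trans ?_
      refine mul_le_mul_of_nonneg_left ?_ (by linarith)
      have h2 : esq z + n ≤ (9 * q + 1) * r ^ 6 := by
        rw [← hrn]
        have : r ^ 4 ≤ r ^ 6 := pow_le_pow_right₀ (by linarith) (by norm_num)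
        linarith
      have h3 : (esq z + n) ^ 4 ≤ ((9 * q + 1) * r ^ 6) ^ 4 :=
        pow_le_pow_left₀ (add_nonneg (esq_nonneg z) (by positivity)) h2 4
      have h4 : (esq z + n) ^ 4 / (n : ℝ) ^ 6 ≤ (9 * q + 1) ^ 4 := by
        rw [div_le_iff₀ (by positivity)]
        refine h3.trans (le_of_eq ?_)
        rw [← hrn]; ring
      linarith
    have hmain := hg.cnt_mul_sq_le_grad z i h
    have h2 : r ^ 4 / (4 * q ^ 2) * (g (mulAt z i h) - g z) ^ 2 ≤ C * (1 + (9 * q + 1) ^ 4) :=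
      (mul_le_mul_of_nonneg_right hcnt (sq_nonneg _)).trans (hmain.trans hgz)
    have h3 : (g (mulAt z i h) - g z) ^ 2 ≤ (Real.sqrt D / r ^ 2) ^ 2 := by
      rw [div_pow, Real.sq_sqrt hD0, le_div_iff₀ (by positivity), hD]
      calc (g (mulAt z i h) - g z) ^ 2 * (r ^ 2) ^ 2
          = (r ^ 4 / (4 * q ^ 2) * (g (mulAt z i h) - g z) ^ 2) * (4 * q ^ 2) := by
            field_simp
        _ ≤ _ := mul_le_mul_of_nonneg_right h2 (by positivity)
    exact abs_le_of_sq_le_sq h3 (by positivity)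
  have hham := ham_nonneg x y
  rcases le_or_gt (ham x y) (r ^ 2) with hle | hgt
  · have hsq : Real.sqrt (dsq κ y) ≤ r ^ 3 := by
      rw [Real.sqrt_le_left (by positivity)]
      calc dsq κ y ≤ r ^ 6 := hy
        _ = (r ^ 3) ^ 2 := by ring
    have := abs_sub_le_ham_mul κ g hloc x y (by nlinarith [sq_nonneg r])
    refine this.trans ?_
    rw [mul_div_assoc', mul_comm]
    gcongr
    linarith
  · have h2 : |g x - g y| ≤ 1 := by
      rw [abs_le]
      constructor <;> linarith [hg0 x, hg1 x, hg0 y, hg1 y]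
    refine h2.trans ?_
    rw [le_div_iff₀ (by positivity), one_mul]
    nlinarith [Real.sqrt_nonneg D]

variable (G) in
lemma exists_lipschitz_cdiff : ∃ C : ℝ, 1 ≤ C ∧ ∃ R : ℝ, ∀ (n : ℕ) (r : ℝ), R ≤ r → r ^ 4 = n →
    ∀ κ : Fin n → G, (∀ a, n / (2 * Fintype.card G) ≤ csz κ a) →
    ∀ f : Config G n → ℝ, (∀ x, 0 ≤ f x) → (∀ x, f x ≤ 1) → StabInv κ f →
    ∀ x y, dsq κ y ≤ r ^ 6 →
      |(avgOp ^ (n - 1)) f x - (avgOp ^ (n - 1)) f y| ≤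
        C * Real.sqrt (sq (cdiff κ x y)) / r ^ 2 := by
  obtain ⟨C, hC1, R, hC⟩ := exists_lipschitz G
  have hq1 : (1 : ℝ) ≤ Fintype.card G := one_le_card
  refine ⟨C * Fintype.card G, by nlinarith, R, ?_⟩
  intro n r hr hrn κ hκ f h0 h1 hf x y hy
  obtain ⟨τ, hτ, hle⟩ := exists_stab_ham_le κ x y
  have h2 := hC n r hr hrn κ hκ f h0 h1 hf x (y ∘ τ) (by rwa [dsq_comp hτ])
  rw [hf.avgOp_pow (n - 1) τ hτ y] at h2
  refine h2.trans ?_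
  have h3 := hle.trans (sum_abs_le _)
  rw [Real.sqrt_mul_self (by positivity)] at h3
  rw [mul_assoc C]
  have : 0 ≤ r ^ 2 := sq_nonneg r
  gcongr

lemma abs_avgOp_sub_le (f : Config G n → ℝ) (x y : Config G n) :
    |avgOp f x - avgOp f y| ≤
      (∑ m : Move n, |f (applyMove G x m) - f (applyMove G y m)|) / Fintype.card (Move n) := by
  rw [avgOp_apply, avgOp_apply, ← sub_div, abs_div, ← Finset.sum_sub_distrib]
  rw [abs_of_nonneg (by positivity : (0 : ℝ) ≤ Fintype.card (Move n))]
  gcongr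
  exact Finset.abs_sum_le_sum_abs _ _

variable (G) in
/-- The threshold on the global energy at `t` steps after the start. -/
def thr (n : ℕ) (r : ℝ) (t : ℕ) : ℝ :=
  (n / (4 * Fintype.card G)) ^ 2 * (1 - 1 / n) ^ t + r ^ 6

variable (G) in
/-- The loss in the contraction rate at `t` steps after the start. -/
def loss (n : ℕ) (r : ℝ) (t : ℕ) : ℝ :=
  1 / 2 * (1 - 1 / (2 * n)) ^ t + 19 * Fintype.card G / r

lemma sqrt_thr_le (hn : 2 ≤ n) {r : ℝ} (hr : 0 < r) (t : ℕ) :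
    Real.sqrt (thr G n r t) ≤ n / (4 * Fintype.card G) * (1 - 1 / (2 * n)) ^ t + r ^ 3 := by
  have hn' : (2 : ℝ) ≤ n := by exact_mod_cast hn
  have h1 : (1 : ℝ) / (2 * n) ≤ 1 := by
    rw [div_le_one (by positivity)]; linarith
  have h2 : (0 : ℝ) ≤ 1 - 1 / (2 * n) := by linarith
  have h3 : (0 : ℝ) ≤ n / (4 * Fintype.card G) * (1 - 1 / (2 * n)) ^ t := by positivity
  rw [Real.sqrt_le_left (by positivity), thr]
  have h4 : (1 - 1 / n : ℝ) ^ t ≤ ((1 - 1 / (2 * n)) ^ t) ^ 2 := by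
    rw [← pow_mul, mul_comm t, pow_mul]
    apply pow_le_pow_left₀
    · rw [sub_nonneg, div_le_one (by positivity)]; linarith
    · have : (1 - 1 / (2 * n) : ℝ) ^ 2 = 1 - 1 / n + (1 / (2 * n)) ^ 2 := by field_simp; ring
      rw [this]
      nlinarith [sq_nonneg (1 / (2 * n) : ℝ)]
  have h5 : (n / (4 * Fintype.card G) : ℝ) ^ 2 * (1 - 1 / n) ^ t ≤
      (n / (4 * Fintype.card G) * (1 - 1 / (2 * n)) ^ t) ^ 2 := by
    rw [mul_pow]; gcongr
  have h6 : 0 ≤ r ^ 3 := by positivity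
  nlinarith [mul_nonneg h3 h6]

set_option maxHeartbeats 2000000 in
lemma abs_pow_sub_le (hn : 2 ≤ n) {r : ℝ} (hrn : r ^ 4 = n) (hr : 6 * (Fintype.card G : ℝ) ^ 2 ≤ r)
    (κ : Fin n → G) {g : Config G n → ℝ} (h0 : ∀ x, 0 ≤ g x) (h1 : ∀ x, g x ≤ 1)
    (hg : StabInv κ g) {a b : ℝ} (ha : 0 ≤ a) (hb : 0 ≤ b)
    (hstart : ∀ x y, |g x - g y| ≤ a * sq (cdiff κ x y) + b + dsq κ y / r ^ 6) (T k : ℕ)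
    (hk : k ≤ T) (x y : Config G n) :
    |(avgOp ^ k) g x - (avgOp ^ k) g y| ≤
      a * Real.exp ((-2 * k + ∑ j ∈ Finset.range k, loss G n r (T - 1 - j)) / n) *
          sq (cdiff κ x y)
        + (b + ∑ l ∈ Finset.range k,
            a * Real.exp ((-2 * l + ∑ j ∈ Finset.range l, loss G n r (T - 1 - j)) / n) *
              (1600 * (Fintype.card G : ℝ) ^ 2 * r ^ 2 / n))
        + esq x / thr G n r (T - k) + dsq κ y / r ^ 6 + 24 * k / r ^ 6 := by
  have hq1 : (1 : ℝ) ≤ Fintype.card G := one_le_card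
  have hn' : (2 : ℝ) ≤ n := by exact_mod_cast hn
  have hr6 : 6 ≤ r := by nlinarith
  have hr0 : 0 < r := by linarith
  have h1n : (0 : ℝ) ≤ 1 - 1 / n := by
    rw [sub_nonneg, div_le_one (by positivity)]; linarith
  have hthr : ∀ t, r ^ 6 ≤ thr G n r t := fun t => le_add_of_nonneg_left (by positivity)
  have hthr0 : ∀ t, 0 < thr G n r t := fun t => lt_of_lt_of_le (by positivity) (hthr t)
  induction k generalizing x y with
  | zero =>
    have h3 : 0 ≤ esq x / thr G n r T := div_nonneg (esq_nonneg _) (hthr0 _).le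
    simpa using (hstart x y).trans (by linarith)
  | succ k ih =>
    set a' := a * Real.exp ((-2 * k + ∑ j ∈ Finset.range k, loss G n r (T - 1 - j)) / n) with ha'
    set b' := b + ∑ l ∈ Finset.range k,
            a * Real.exp ((-2 * l + ∑ j ∈ Finset.range l, loss G n r (T - 1 - j)) / n) *
              (1600 * (Fintype.card G : ℝ) ^ 2 * r ^ 2 / n) with hb'
    have ha0 : 0 ≤ a' := by positivity
    have hb0 : 0 ≤ b' := by positivity
    have hs0 : ∀ x y : Config G n, 0 ≤ sq (cdiff κ x y) := fun x y => sq_nonneg' _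
    obtain ⟨t, ht⟩ : ∃ t, T - (k + 1) = t := ⟨_, rfl⟩
    have ht1 : T - k = t + 1 := by omega
    have ht2 : T - 1 - k = t := by omega
    have hexp : a * Real.exp ((-2 * (k + 1 : ℕ) +
        ∑ j ∈ Finset.range (k + 1), loss G n r (T - 1 - j)) / n) =
        a' * Real.exp (-(2 - loss G n r t) / n) := by
      rw [Finset.sum_range_succ, ht2, ha', mul_assoc, ← Real.exp_add]
      congr 2
      push_cast
      ring
    rw [hexp, Finset.sum_range_succ, ← ha', ← add_assoc b, ← hb', ht]
    rw [ht1] at ih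
    clear_value a' b'
    clear ha' hb' hexp
    have hcast : ((k + 1 : ℕ) : ℝ) = k + 1 := by push_cast; ring
    rw [hcast]
    have hm := avgOp_pow_mem hn h0 h1 (k + 1)
    have htriv : |(avgOp ^ (k + 1)) g x - (avgOp ^ (k + 1)) g y| ≤ 1 := by
      rw [abs_le]
      constructor <;> linarith [hm.1 x, hm.2 x, hm.1 y, hm.2 y]
    have hpos1 : 0 ≤ a' * Real.exp (-(2 - loss G n r t) / n) * sq (cdiff κ x y) :=
      mul_nonneg (by positivity) (hs0 _ _)
    have hpos2 : 0 ≤ a' * (1600 * (Fintype.card G : ℝ) ^ 2 * r ^ 2 / n) := by positivity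
    have hpos3 : 0 ≤ esq x / thr G n r t := div_nonneg (esq_nonneg _) (hthr0 _).le
    have hpos4 : 0 ≤ dsq κ y / r ^ 6 := div_nonneg (dsq_nonneg _ _) (by positivity)
    have hpos5 : 0 ≤ 24 * ((k : ℝ) + 1) / r ^ 6 := by positivity
    rcases lt_or_ge (thr G n r t) (esq x) with hx | hx
    · have : 1 ≤ esq x / thr G n r t := by rw [one_le_div (hthr0 t)]; exact hx.le
      linarith
    rcases lt_or_ge (r ^ 6) (dsq κ y) with hy | hy
    · have : 1 ≤ dsq κ y / r ^ 6 := by rw [one_le_div (by positivity)]; exact hy.le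
      linarith
    obtain ⟨τ, hτ, hle⟩ := exists_stab_ham_le κ x y
    have hham := hle.trans (sum_abs_le _)
    rw [Real.sqrt_mul_self (by positivity), ← cdiff_comp hτ] at hham
    rw [← dsq_comp hτ] at hy hpos4 ⊢
    rw [← cdiff_comp hτ, ← hg.avgOp_pow (k + 1) τ hτ y]
    generalize y ∘ τ = y at hham hy hpos4 ⊢
    have hsx : Real.sqrt (esq x) ≤
        n / (4 * Fintype.card G) * (1 - 1 / (2 * n)) ^ t + r ^ 3 :=
      (Real.sqrt_le_sqrt hx).trans (sqrt_thr_le hn hr0 t)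
    have hsy : Real.sqrt (dsq κ y) ≤ r ^ 3 := by
      rw [Real.sqrt_le_left (by positivity)]
      exact hy.trans (le_of_eq (by ring))
    have hp : (1 - 1 / (2 * n) : ℝ) ^ t ≤ 1 := by
      apply pow_le_one₀
      · rw [sub_nonneg, div_le_one (by positivity)]; linarith
      · have : (0 : ℝ) ≤ 1 / (2 * n) := by positivity
        linarith
    have hq2 : (Fintype.card G : ℝ) ≤ (Fintype.card G : ℝ) ^ 2 := by nlinarith
    have hqr : (Fintype.card G : ℝ) * r ^ 3 ≤ n / 4 := by
      rw [← hrn]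
      nlinarith [pow_pos hr0 3]
    have hqx : Fintype.card G * Real.sqrt (esq x) ≤ n / 2 := by
      calc Fintype.card G * Real.sqrt (esq x)
          ≤ Fintype.card G * (n / (4 * Fintype.card G) * 1 + r ^ 3) := by
            gcongr
            exact hsx.trans (by gcongr)
        _ = n / 4 + Fintype.card G * r ^ 3 := by field_simp
        _ ≤ n / 2 := by linarith
    have hmain := le_of_sq_cdiff hn κ x y hr0 (by positivity) hham (by linarith)
    have hEx : avgOp esq x ≤ esq x * (1 - 1 / n) + 12 := by
      have := avgOp_dsq_le_of_esq hn (fun _ : Fin n => ()) x (by linarith)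
      refine this.trans ?_
      have h2 : Fintype.card G * Real.sqrt (esq x) / n ≤ 1 / 2 := by
        rw [div_le_iff₀ (by positivity)]; linarith
      have h3 : 1 / (n : ℝ) ≤ 2 * (1 - Fintype.card G * Real.sqrt (esq x) / n) / n := by
        gcongr; linarith
      have := esq_nonneg x
      change esq x * _ + 12 ≤ _
      nlinarith
    have hDy := avgOp_dsq_le_add hn κ y
    have hloss : (2 * Fintype.card G * Real.sqrt (esq x)
        + 16 * Fintype.card G * Real.sqrt (dsq κ y)) / n + 1 / r ^ 2 ≤ loss G n r t := by
      have h2 : 2 * Fintype.card G * Real.sqrt (esq x) + 16 * Fintype.card G * Real.sqrt (dsq κ y) ≤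
          n / 2 * (1 - 1 / (2 * n)) ^ t + 18 * Fintype.card G * r ^ 3 := by
        calc 2 * Fintype.card G * Real.sqrt (esq x) + 16 * Fintype.card G * Real.sqrt (dsq κ y)
            ≤ 2 * Fintype.card G * (n / (4 * Fintype.card G) * (1 - 1 / (2 * n)) ^ t + r ^ 3)
              + 16 * Fintype.card G * r ^ 3 := by gcongr
          _ = _ := by field_simp; ring
      have h3 : 1 / r ^ 2 ≤ Fintype.card G / r := by
        rw [div_le_div_iff₀ (by positivity) hr0]
        nlinarith
      have h4 : (n / 2 * (1 - 1 / (2 * n)) ^ t + 18 * Fintype.card G * r ^ 3) / (n : ℝ) =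
          1 / 2 * (1 - 1 / (2 * n)) ^ t + 18 * Fintype.card G / r := by
        rw [add_div]
        congr 1
        · field_simp
        · rw [← hrn]; field_simp
      calc _ ≤ (n / 2 * (1 - 1 / (2 * n)) ^ t + 18 * Fintype.card G * r ^ 3) / (n : ℝ)
            + Fintype.card G / r := by gcongr
        _ = loss G n r t := by rw [h4, loss]; ring
    have hfac : sq (cdiff κ x y) * (1 - (2 - ((2 * Fintype.card G * Real.sqrt (esq x)
        + 16 * Fintype.card G * Real.sqrt (dsq κ y)) / n + 1 / r ^ 2)) / n) ≤
        Real.exp (-(2 - loss G n r t) / n) * sq (cdiff κ x y) := by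
      rw [mul_comm]
      refine mul_le_mul_of_nonneg_right ?_ (hs0 _ _)
      have h2 := Real.add_one_le_exp (-(2 - loss G n r t) / n)
      have h3 : (2 - loss G n r t) / n ≤ (2 - ((2 * Fintype.card G * Real.sqrt (esq x)
        + 16 * Fintype.card G * Real.sqrt (dsq κ y)) / n + 1 / r ^ 2)) / n := by gcongr
      rw [neg_div] at h2 ⊢
      linarith
    have hM := card_move_pos hn
    have hsum : |(avgOp ^ (k + 1)) g x - (avgOp ^ (k + 1)) g y| ≤
        a' * ((∑ m : Move n, sq (cdiff κ (applyMove G x m) (applyMove G y m))) /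
          Fintype.card (Move n)) + b' + avgOp esq x / thr G n r (t + 1)
          + avgOp (dsq κ) y / r ^ 6 + 24 * k / r ^ 6 := by
      rw [pow_succ']
      refine (abs_avgOp_sub_le _ x y).trans ?_
      rw [div_le_iff₀ hM]
      refine (Finset.sum_le_sum fun m _ => ih (by omega) (applyMove G x m)
        (applyMove G y m)).trans (le_of_eq ?_)
      simp only [Finset.sum_add_distrib, ← Finset.mul_sum, ← Finset.sum_div, Finset.sum_const,
        Finset.card_univ, nsmul_eq_mul, avgOp_apply]
      field_simp
    refine hsum.trans ?_
    have h6 : a' * ((∑ m : Move n, sq (cdiff κ (applyMove G x m) (applyMove G y m))) /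
          Fintype.card (Move n)) ≤ a' * Real.exp (-(2 - loss G n r t) / n) * sq (cdiff κ x y)
          + a' * (1600 * (Fintype.card G : ℝ) ^ 2 * r ^ 2 / n) := by
      rw [mul_assoc a', ← mul_add]
      gcongr
      linarith
    have h7 : avgOp esq x / thr G n r (t + 1) ≤ esq x / thr G n r t + 12 / r ^ 6 := by
      calc avgOp esq x / thr G n r (t + 1)
          ≤ (esq x * (1 - 1 / n) + 12) / thr G n r (t + 1) :=
            div_le_div_of_nonneg_right hEx (hthr0 _).le
        _ = esq x * (1 - 1 / n) / thr G n r (t + 1) + 12 / thr G n r (t + 1) := add_div _ _ _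
        _ ≤ esq x / thr G n r t + 12 / r ^ 6 := by
          have h9 : (1 - 1 / n) * thr G n r t ≤ thr G n r (t + 1) := by
            rw [thr, thr, pow_succ (1 - 1 / (n : ℝ)) t]
            have h11 : (0 : ℝ) ≤ 1 / n * r ^ 6 := by positivity
            generalize (1 - 1 / n : ℝ) ^ t = p
            generalize (n / (4 * Fintype.card G) : ℝ) ^ 2 = c
            generalize (1 / n : ℝ) = ρ at h11 ⊢
            linarith
          gcongr ?_ + ?_
          · rw [div_le_div_iff₀ (hthr0 _) (hthr0 _), mul_assoc]
            exact mul_le_mul_of_nonneg_left h9 (esq_nonneg x)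
          · have := hthr (t + 1)
            gcongr
    have h8 : avgOp (dsq κ) y / r ^ 6 ≤ dsq κ y / r ^ 6 + 12 / r ^ 6 := by
      rw [← add_div]; gcongr
    have h10 : 24 * ((k : ℝ) + 1) / r ^ 6 = 24 * k / r ^ 6 + 12 / r ^ 6 + 12 / r ^ 6 := by ring
    rw [h10]
    linarith

lemma geom_sum_le {p : ℝ} (hp0 : 0 ≤ p) {c : ℝ} (hc : 0 < c) (hp : p ≤ 1 - 1 / c) (T : ℕ) :
    ∑ t ∈ Finset.range T, p ^ t ≤ c := by
  have h1 := geom_sum_mul_neg p T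
  have h2 : 0 ≤ ∑ t ∈ Finset.range T, p ^ t := Finset.sum_nonneg fun _ _ => pow_nonneg hp0 _
  have h3 : (∑ t ∈ Finset.range T, p ^ t) * (1 / c) ≤ 1 := by
    have := mul_le_mul_of_nonneg_left (by linarith : 1 / c ≤ 1 - p) h2
    linarith [pow_nonneg hp0 T]
  rwa [mul_one_div, div_le_one hc] at h3

lemma sum_loss_le (hn : 2 ≤ n) {r : ℝ} (hr : 0 < r) {T k : ℕ} (hk : k ≤ T)
    (hT : 19 * Fintype.card G * T ≤ n * r) :
    ∑ j ∈ Finset.range k, loss G n r (T - 1 - j) ≤ 2 * n := by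
  have hn' : (2 : ℝ) ≤ n := by exact_mod_cast hn
  have hp : (0 : ℝ) ≤ 1 - 1 / (2 * n) := by
    rw [sub_nonneg, div_le_one (by positivity)]; linarith
  calc ∑ j ∈ Finset.range k, loss G n r (T - 1 - j)
      ≤ ∑ j ∈ Finset.range T, loss G n r (T - 1 - j) := by
        refine Finset.sum_le_sum_of_subset_of_nonneg
          (Finset.range_subset_range.mpr hk) fun j _ _ => ?_
        rw [loss]; positivity
    _ = ∑ t ∈ Finset.range T, loss G n r t := Finset.sum_range_reflect _ _
    _ ≤ 2 * n := by
        simp only [loss, Finset.sum_add_distrib, ← Finset.mul_sum, Finset.sum_const,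
          Finset.card_range, nsmul_eq_mul]
        have h1 := geom_sum_le hp (by positivity : (0 : ℝ) < 2 * n) le_rfl T
        have h2 : (T : ℝ) * (19 * Fintype.card G / r) ≤ n := by
          rw [mul_div_assoc', div_le_iff₀ hr]; linarith
        linarith

lemma sum_exp_le (hn : 2 ≤ n) (T : ℕ) :
    ∑ l ∈ Finset.range T, Real.exp (-2 * l / n) ≤ n := by
  have hn' : (2 : ℝ) ≤ n := by exact_mod_cast hn
  have h1 : ∀ l : ℕ, Real.exp (-2 * l / n) = Real.exp (-(2 / n)) ^ l := by
    intro l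
    rw [← Real.exp_nat_mul]
    congr 1; ring
  simp only [h1]
  refine geom_sum_le (Real.exp_pos _).le (by linarith) ?_ T
  rw [Real.exp_neg]
  have h2 := Real.add_one_le_exp (2 / (n : ℝ))
  have h3 : (0 : ℝ) < 2 / n + 1 := by positivity
  refine (inv_anti₀ h3 h2).trans ?_
  have h4 : (2 / n + 1 : ℝ)⁻¹ = n / (n + 2) := by field_simp; ring
  have h5 : (1 - 1 / n : ℝ) = (n - 1) / n := by field_simp
  rw [h4, h5, div_le_div_iff₀ (by linarith) (by linarith)]
  nlinarith

/-- Multiplying the entry at `i` on the right is a bijection. -/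
def mulAtEquiv (i : Fin n) (h : G) : Config G n ≃ Config G n where
  toFun x := mulAt x i h
  invFun x := mulAt x i h⁻¹
  left_inv x := by simp only [mulAt_mulAt_same, mul_inv_cancel, mulAt_one]
  right_inv x := by simp only [mulAt_mulAt_same, inv_mul_cancel, mulAt_one]

lemma sum_eq_sum_mulAt (F : Config G n → ℝ) (i : Fin n) :
    Fintype.card G * ∑ x, F x = ∑ x, ∑ h, F (mulAt x i h) := by
  rw [Finset.sum_comm]
  have : ∀ h : G, ∑ x, F (mulAt x i h) = ∑ x, F x := fun h =>
    (mulAtEquiv i h).sum_comp F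
  simp [this]

lemma sum_sq_sum_le (φ : Fin n → G → ℝ) (h0 : ∀ i, ∑ c, φ i c = 0) (h1 : ∀ i c, φ i c ^ 2 ≤ 1) :
    ∑ x : Config G n, (∑ i, φ i (x i)) ^ 2 ≤ n * Fintype.card (Config G n) := by
  have hq : (0 : ℝ) < Fintype.card G := card_pos'
  have hcross : ∀ i j, i ≠ j → ∑ x : Config G n, φ i (x i) * φ j (x j) = 0 := by
    intro i j hij
    have h2 := sum_eq_sum_mulAt (fun x : Config G n => φ i (x i) * φ j (x j)) i
    have h3 : ∀ x : Config G n, ∑ h, φ i (mulAt x i h i) * φ j (mulAt x i h j) = 0 := by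
      intro x
      have : ∀ h, φ i (mulAt x i h i) * φ j (mulAt x i h j) = φ i (x i * h) * φ j (x j) := by
        intro h; rw [mulAt_self, mulAt_ne x h hij.symm]
      simp only [this, ← Finset.sum_mul]
      have h4 : ∑ h, φ i (x i * h) = ∑ c, φ i c := Equiv.sum_comp (Equiv.mulLeft (x i)) (φ i)
      rw [h4, h0, zero_mul]
    simp only [h3, Finset.sum_const_zero] at h2
    exact (mul_eq_zero.mp h2).resolve_left hq.ne'
  have hexp : ∑ x : Config G n, (∑ i, φ i (x i)) ^ 2 =
      ∑ i, ∑ x : Config G n, φ i (x i) ^ 2 := by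
    have h5 : ∀ x : Config G n, (∑ i, φ i (x i)) ^ 2 = ∑ i, ∑ j, φ i (x i) * φ j (x j) := by
      intro x; rw [pow_two, Finset.sum_mul_sum]
    simp only [h5]
    rw [Finset.sum_comm]
    refine Finset.sum_congr rfl fun i _ => ?_
    rw [Finset.sum_comm]
    rw [Finset.sum_eq_single i (fun j _ hj => hcross i j hj.symm) (by simp)]
    simp only [pow_two]
  rw [hexp]
  calc ∑ i, ∑ x : Config G n, φ i (x i) ^ 2 ≤ ∑ _i : Fin n, ∑ _x : Config G n, (1 : ℝ) :=
        Finset.sum_le_sum fun i _ => Finset.sum_le_sum fun x _ => h1 _ _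
    _ = _ := by simp

lemma config_card_pos : (0 : ℝ) < Fintype.card (Config G n) := by
  exact_mod_cast Fintype.card_pos

lemma unif_dsq_le (κ : Fin n → A) :
    unif (dsq (G := G) κ) ≤ Fintype.card A * Fintype.card G * n := by
  have hq1 : (1 : ℝ) ≤ Fintype.card G := one_le_card
  have hab : ∀ a b, ∑ x : Config G n, dev κ x a b ^ 2 ≤ n * Fintype.card (Config G n) := by
    intro a b
    obtain ⟨φ, hφ⟩ : ∃ φ : Fin n → G → ℝ, ∀ i c, φ i c = (if κ i = a then (1 : ℝ) else 0) *
      ((if c = b then 1 else 0) - 1 / Fintype.card G) := ⟨_, fun _ _ => rfl⟩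
    have hdev : ∀ x : Config G n, dev κ x a b = ∑ i, φ i (x i) := by
      intro x
      rw [dev, cnt, csz, Finset.sum_div, ← Finset.sum_sub_distrib]
      refine Finset.sum_congr rfl fun i _ => ?_
      rw [hφ]
      by_cases h : κ i = a <;> simp [h]
    rw [Finset.sum_congr rfl fun x _ => by rw [hdev x]]
    refine sum_sq_sum_le φ (fun i => ?_) (fun i c => ?_)
    · simp only [hφ]
      rw [← Finset.mul_sum, Finset.sum_sub_distrib]
      simp
    · have h1 : (1 : ℝ) / Fintype.card G ≤ 1 := by rw [div_le_one (by linarith)]; exact hq1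
      have h2 : (0 : ℝ) ≤ 1 / Fintype.card G := by positivity
      rw [sq_le_one_iff_abs_le_one, abs_le, hφ]
      split_ifs <;> constructor <;> linarith
  rw [unif, div_le_iff₀ config_card_pos]
  simp only [dsq, sq]
  rw [Finset.sum_comm]
  rw [Finset.sum_congr rfl fun a _ => Finset.sum_comm]
  calc ∑ a, ∑ b, ∑ x : Config G n, dev κ x a b ^ 2
      ≤ ∑ _a : A, ∑ _b : G, (n * Fintype.card (Config G n) : ℝ) :=
        Finset.sum_le_sum fun a _ => Finset.sum_le_sum fun b _ => hab a b
    _ = _ := by simp; ring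

lemma applyMove_injective (m : Move n) :
    Function.Injective fun x : Config G n => applyMove G x m := by
  intro x y hxy
  have hxy' : ∀ k, applyMove G x m k = applyMove G y m k := fun k => congrFun hxy k
  have hne : ∀ k, k ≠ m.1.1.1 → x k = y k := by
    intro k hk
    have := hxy' k
    rwa [applyMove_eq, applyMove_eq, mulAt_ne _ _ hk, mulAt_ne _ _ hk] at this
  funext k
  by_cases hk : k = m.1.1.1
  · have h1 := hxy' m.1.1.1
    have h2 : src x m.1.1.2 m.2 = src y m.1.1.2 m.2 := by
      rw [src, src, hne _ m.1.2.symm]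
    rw [applyMove_eq, applyMove_eq, mulAt_self, mulAt_self, h2] at h1
    rw [hk]
    exact mul_right_cancel h1
  · exact hne k hk

lemma unif_avgOp (hn : 2 ≤ n) (f : Config G n → ℝ) : unif (avgOp f) = unif f := by
  have hM := card_move_pos hn
  rw [unif, unif]
  congr 1
  simp only [avgOp_apply, ← Finset.sum_div]
  rw [Finset.sum_comm, div_eq_iff hM.ne']
  have : ∀ m : Move n, ∑ x, f (applyMove G x m) = ∑ x, f x := fun m =>
    (Finite.injective_iff_bijective.mp (applyMove_injective m)).sum_comp f
  simp [this, mul_comm]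

lemma unif_avgOp_pow (hn : 2 ≤ n) (f : Config G n → ℝ) (k : ℕ) : unif ((avgOp ^ k) f) = unif f := by
  induction k with
  | zero => rfl
  | succ k ih =>
    rw [pow_succ', Module.End.mul_apply, unif_avgOp hn, ih]

lemma abs_sub_unif_le {h φ : Config G n → ℝ} {x : Config G n} {c : ℝ}
    (hle : ∀ y, |h x - h y| ≤ c + φ y) : |h x - unif h| ≤ c + unif φ := by
  have hc := config_card_pos (G := G) (n := n)
  have h1 : h x - unif h = (∑ y, (h x - h y)) / Fintype.card (Config G n) := by
    rw [Finset.sum_sub_distrib, sub_div, unif]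
    simp only [Finset.sum_const, Finset.card_univ, nsmul_eq_mul]
    rw [mul_div_cancel_left₀ _ hc.ne']
  have h2 : c + unif φ = (∑ y, (c + φ y)) / Fintype.card (Config G n) := by
    rw [Finset.sum_add_distrib, add_div, unif]
    simp only [Finset.sum_const, Finset.card_univ, nsmul_eq_mul]
    rw [mul_div_cancel_left₀ _ hc.ne']
  rw [h1, h2, abs_div, abs_of_pos hc]
  gcongr
  exact (Finset.abs_sum_le_sum_abs _ _).trans (Finset.sum_le_sum fun y _ => hle y)

lemma unif_mem {f : Config G n → ℝ} (h0 : ∀ x, 0 ≤ f x) (h1 : ∀ x, f x ≤ 1) :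
    0 ≤ unif f ∧ unif f ≤ 1 := by
  have hc := config_card_pos (G := G) (n := n)
  refine ⟨div_nonneg (Finset.sum_nonneg fun x _ => h0 x) hc.le, ?_⟩
  rw [unif, div_le_one hc]
  calc ∑ x, f x ≤ ∑ _x : Config G n, (1 : ℝ) := Finset.sum_le_sum fun x _ => h1 x
    _ = _ := by simp

lemma csz_self_lower {x : Config G n} (hx : Real.sqrt (esq x) ≤ n / (4 * Fintype.card G)) (a : G) :
    n / (2 * Fintype.card G) ≤ csz x a := by
  have hq1 : (1 : ℝ) ≤ Fintype.card G := one_le_card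
  have h1 : csz x a = dev (fun _ => ()) x () a + n / Fintype.card G := by
    rw [dev, csz_unit, csz, cnt]; simp
  have h2 := abs_le_sqrt_sq (dev (fun _ => ()) x) () a
  have h3 := neg_le_of_abs_le (h2.trans hx)
  have h4 : (n / Fintype.card G : ℝ) = n / (4 * Fintype.card G) + n / (2 * Fintype.card G)
      + n / (4 * Fintype.card G) := by field_simp; ring
  have h5 : (0 : ℝ) ≤ n / (4 * Fintype.card G) := by positivity
  linarith

set_option maxHeartbeats 1000000 in
variable (G) in
/-- Starting close to equidistribution, `T + n - 1` steps bring the chain close to uniform. -/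
lemma exists_abs_sub_unif_le : ∃ C : ℝ, 1 ≤ C ∧ ∃ R : ℝ, ∀ (n : ℕ) (r : ℝ), R ≤ r → r ^ 4 = n →
    ∀ T : ℕ, 19 * Fintype.card G * T ≤ n * r → ∀ η : ℝ, 0 < η →
    ∀ f : Config G n → ℝ, (∀ x, 0 ≤ f x) → (∀ x, f x ≤ 1) → ∀ x,
      |(avgOp ^ (T + (n - 1))) f x - unif f| ≤
        C * (Real.exp (-2 * T / n) * n / η + η + 1 / (η * r ^ 2) + 1 / r)
          + 16 * Fintype.card G ^ 2 * esq x / n ^ 2 := by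
  obtain ⟨C₀, hC1, R₀, hC⟩ := exists_lipschitz_cdiff G
  obtain ⟨q, hq⟩ : ∃ q : ℝ, q = Fintype.card G := ⟨_, rfl⟩
  have hq1 : 1 ≤ q := hq ▸ one_le_card
  obtain ⟨e, he⟩ : ∃ e : ℝ, e = Real.exp 2 := ⟨_, rfl⟩
  have he1 : 1 ≤ e := by rw [he]; exact Real.one_le_exp (by norm_num)
  refine ⟨1600 * e * C₀ * q ^ 2 + 24 + q ^ 2, ?_, max R₀ (6 * q ^ 2), ?_⟩
  · have : 0 ≤ 1600 * e * C₀ * q ^ 2 := by positivity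
    nlinarith
  intro n r hr hrn T hT η hη f h0 h1 x
  have hrR := (le_max_left _ _).trans hr
  have hr6 := (le_max_right _ _).trans hr
  have hq2 : 1 ≤ q ^ 2 := one_le_pow₀ hq1
  have hr0 : 6 ≤ r := by linarith
  have hrpos : 0 < r := by linarith
  have hn2 : (2 : ℝ) ≤ n := by
    rw [← hrn]
    calc (2 : ℝ) ≤ 6 ^ 4 := by norm_num
      _ ≤ r ^ 4 := pow_le_pow_left₀ (by norm_num) hr0 4
  have hn : 2 ≤ n := by exact_mod_cast hn2
  have hnpos : (0 : ℝ) < n := by linarith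
  have hm := avgOp_pow_mem hn h0 h1 (T + (n - 1))
  have hu := unif_mem h0 h1
  have hpart : 0 ≤ (1600 * e * C₀ * q ^ 2 + 24 + q ^ 2) *
      (Real.exp (-2 * T / n) * n / η + η + 1 / (η * r ^ 2) + 1 / r) := by positivity
  rcases lt_or_ge (n / (4 * q)) (Real.sqrt (esq x)) with hx | hx
  · have h2 : |(avgOp ^ (T + (n - 1))) f x - unif f| ≤ 1 := by
      rw [abs_le]
      constructor <;> linarith [hm.1 x, hm.2 x, hu.1, hu.2]
    have h3 : 1 ≤ 16 * q ^ 2 * esq x / n ^ 2 := by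
      have h4 := (Real.lt_sqrt (by positivity)).mp hx
      rw [div_pow, div_lt_iff₀ (by positivity)] at h4
      rw [one_le_div (by positivity)]
      linarith
    rw [← hq]
    linarith
  rw [hq] at hx
  have hκ := csz_self_lower hx
  have hs := symm_stabInv x f
  have hsm := symm_mem (κ := x) h0 h1
  have hlip := hC n r hrR hrn x hκ (symm x f) (fun z => (hsm z).1) (fun z => (hsm z).2) hs
  have hgm := avgOp_pow_mem hn (fun z => (hsm z).1) (fun z => (hsm z).2) (n - 1)
  have hgs := hs.avgOp_pow (n - 1)
  have hU : unif ((avgOp ^ T) ((avgOp ^ (n - 1)) (symm x f))) = unif f := by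
    rw [unif_avgOp_pow hn, unif_avgOp_pow hn, unif_symm]
  have hself := avgOp_pow_symm_self x f (T + (n - 1))
  rw [avgOp_pow_add_apply] at hself
  rw [← hself, ← hU]
  generalize (avgOp ^ (n - 1)) (symm x f) = g at hlip hgm hgs
  have hstart : ∀ y z, |g y - g z| ≤ C₀ / (η * n) * sq (cdiff x y z) + C₀ * η
      + dsq x z / r ^ 6 := by
    intro y z
    have hs0 : 0 ≤ sq (cdiff x y z) := sq_nonneg' _
    have hd0 : 0 ≤ dsq x z := dsq_nonneg _ _
    rcases le_or_gt (dsq x z) (r ^ 6) with hz | hz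
    · refine (hlip y z hz).trans ?_
      have h3 : 0 ≤ dsq x z / r ^ 6 := by positivity
      have h4 : Real.sqrt (sq (cdiff x y z)) / r ^ 2 ≤ sq (cdiff x y z) / (η * n) + η := by
        have h5 : sq (cdiff x y z) / (η * n) + η =
            (sq (cdiff x y z) + η ^ 2 * n) / (η * n) := by field_simp
        rw [h5, div_le_div_iff₀ (by positivity) (by positivity), ← hrn]
        have h6 := Real.sq_sqrt hs0
        generalize Real.sqrt (sq (cdiff x y z)) = s at h6
        rw [← h6]
        have h7 : 0 ≤ s ^ 2 + (η * r ^ 2) ^ 2 - s * (η * r ^ 2) := by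
          nlinarith [sq_nonneg (s - η * r ^ 2), sq_nonneg s, sq_nonneg (η * r ^ 2)]
        nlinarith [mul_nonneg h7 (sq_nonneg r)]
      have h8 := mul_le_mul_of_nonneg_left h4 (by linarith : 0 ≤ C₀)
      rw [mul_add] at h8
      have h9 : C₀ / (η * n) * sq (cdiff x y z) = C₀ * (sq (cdiff x y z) / (η * n)) := by ring
      rw [mul_div_assoc, h9]
      linarith
    · have h2 : |g y - g z| ≤ 1 := by
        rw [abs_le]
        constructor <;> linarith [hgm.1 y, hgm.2 y, hgm.1 z, hgm.2 z]
      have h3 : 1 ≤ dsq x z / r ^ 6 := by rw [one_le_div (by positivity)]; exact hz.le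
      have h4 : 0 ≤ C₀ / (η * n) * sq (cdiff x y z) := by positivity
      have h5 : 0 ≤ C₀ * η := by positivity
      linarith
  have hback := fun y => abs_pow_sub_le hn hrn (hq ▸ hr6) x hgm.1 hgm.2 hgs (by positivity)
    (by positivity) hstart T T le_rfl x y
  have hexp : ∀ k ≤ T, Real.exp ((-2 * k + ∑ j ∈ Finset.range k, loss G n r (T - 1 - j)) / n) ≤
      e * Real.exp (-2 * k / n) := by
    intro k hk
    rw [he, ← Real.exp_add]
    apply Real.exp_le_exp.mpr
    have := sum_loss_le hn hrpos hk hT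
    rw [add_div, add_comm]
    gcongr
    rw [div_le_iff₀ hnpos]
    exact this
  have hB : ∑ l ∈ Finset.range T, C₀ / (η * n) * Real.exp ((-2 * l +
      ∑ j ∈ Finset.range l, loss G n r (T - 1 - j)) / n) *
        (1600 * (Fintype.card G : ℝ) ^ 2 * r ^ 2 / n) ≤ 1600 * e * C₀ * q ^ 2 * (1 / (η * r ^ 2)) := by
    calc _ ≤ ∑ l ∈ Finset.range T, C₀ / (η * n) * (e * Real.exp (-2 * l / n)) *
        (1600 * (Fintype.card G : ℝ) ^ 2 * r ^ 2 / n) := by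
          refine Finset.sum_le_sum fun l hl => ?_
          have := hexp l (Finset.mem_range.mp hl).le
          gcongr
      _ = C₀ / (η * n) * e * (1600 * q ^ 2 * r ^ 2 / n) *
          ∑ l ∈ Finset.range T, Real.exp (-2 * l / n) := by
          rw [Finset.mul_sum, hq]
          exact Finset.sum_congr rfl fun l _ => by ring
      _ ≤ C₀ / (η * n) * e * (1600 * q ^ 2 * r ^ 2 / n) * n := by
          have := sum_exp_le hn T
          gcongr
      _ = _ := by
          rw [← hrn]; field_simp
  have hA : ∀ y, C₀ / (η * n) * Real.exp ((-2 * T +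
      ∑ j ∈ Finset.range T, loss G n r (T - 1 - j)) / n) * sq (cdiff x x y) ≤
      1600 * e * C₀ * q ^ 2 * (Real.exp (-2 * T / n) * n / η) := by
    intro y
    have hsq : sq (cdiff x x y) ≤ q ^ 2 * n ^ 2 := by
      calc sq (cdiff x x y) ≤ ∑ _a : G, ∑ _b : G, (n : ℝ) ^ 2 :=
            Finset.sum_le_sum fun a _ => Finset.sum_le_sum fun b _ =>
              sq_le_sq' (neg_le_of_abs_le (abs_cdiff_le x x y a b))
                (le_of_abs_le (abs_cdiff_le x x y a b))
        _ = _ := by simp [hq]; ring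
    calc _ ≤ C₀ / (η * n) * (e * Real.exp (-2 * T / n)) * (q ^ 2 * n ^ 2) := by
          have := hexp T le_rfl
          have := sq_nonneg' (cdiff x x y)
          gcongr
      _ = 1 * (e * C₀ * q ^ 2 * (Real.exp (-2 * T / n) * n / η)) := by field_simp
      _ ≤ 1600 * (e * C₀ * q ^ 2 * (Real.exp (-2 * T / n) * n / η)) := by
          gcongr; norm_num
      _ = _ := by ring
  have hthr : esq x / thr G n r (T - T) ≤ 16 * q ^ 2 * esq x / n ^ 2 := by
    rw [Nat.sub_self]
    have h2 : (n / (4 * q)) ^ 2 ≤ thr G n r 0 := by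
      rw [thr, pow_zero, mul_one, hq]
      exact le_add_of_nonneg_right (by positivity)
    have h3 := esq_nonneg x
    calc esq x / thr G n r 0 ≤ esq x / (n / (4 * q)) ^ 2 := by gcongr
      _ = _ := by field_simp; ring
  have hTr : 24 * (T : ℝ) / r ^ 6 ≤ 24 * (1 / r) := by
    rw [mul_one_div, div_le_div_iff₀ (by positivity) hrpos]
    have h2 : (T : ℝ) ≤ n * r := by
      rw [← hq] at hT
      have : (0 : ℝ) ≤ T := Nat.cast_nonneg T
      nlinarith
    rw [← hrn] at h2
    calc 24 * (T : ℝ) * r ≤ 24 * (r ^ 4 * r) * r := by gcongr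
      _ = 24 * r ^ 6 := by ring
  have hall : ∀ y, |(avgOp ^ T) g x - (avgOp ^ T) g y| ≤
      (1600 * e * C₀ * q ^ 2 * (Real.exp (-2 * T / n) * n / η)
        + (C₀ * η + 1600 * e * C₀ * q ^ 2 * (1 / (η * r ^ 2)))
        + 16 * q ^ 2 * esq x / n ^ 2 + 24 * (1 / r)) + dsq x y / r ^ 6 := by
    intro y
    have := hback y
    have := hA y
    linarith
  have hfin := abs_sub_unif_le (φ := fun y => dsq x y / r ^ 6) hall
  refine hfin.trans ?_
  have hud : unif (fun y : Config G n => dsq x y / r ^ 6) ≤ q ^ 2 * (1 / r) := by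
    have h2 := unif_dsq_le (G := G) x
    have h3 : unif (fun y : Config G n => dsq x y / r ^ 6) = unif (dsq (G := G) x) / r ^ 6 := by
      rw [unif, unif, ← Finset.sum_div]; ring
    rw [h3]
    rw [← hq] at h2
    calc unif (dsq (G := G) x) / r ^ 6 ≤ q * q * n / r ^ 6 := by gcongr
      _ = q ^ 2 * (1 / r ^ 2) := by rw [← hrn]; field_simp
      _ ≤ q ^ 2 * (1 / r) := by
        gcongr
        nlinarith
  have hη2 : C₀ * η ≤ 1600 * e * C₀ * q ^ 2 * η := by
    have h2 : (1 : ℝ) ≤ 1600 * e * q ^ 2 := by nlinarith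
    have h3 : 0 ≤ C₀ * η := by positivity
    nlinarith
  rw [← hq]
  have hp1 : 0 ≤ (24 + q ^ 2) * (Real.exp (-2 * T / n) * n / η + η + 1 / (η * r ^ 2)) := by
    positivity
  have hp2 : 0 ≤ 1600 * e * C₀ * q ^ 2 * (1 / r) := by positivity
  linarith

lemma nNon_cast (H : Subgroup G) (x : Config G n) :
    (nNon G H x : ℝ) = ∑ i, if x i ∈ H then 0 else 1 := by
  rw [nNon, Finset.card_filter]
  push_cast
  exact Finset.sum_congr rfl fun i _ => by split_ifs <;> simp_all

lemma nNon_le (H : Subgroup G) (x : Config G n) : nNon G H x ≤ n := by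
  rw [nNon]
  exact (Finset.card_le_univ _).trans (by simp)

lemma nNon_mulAt (H : Subgroup G) (x : Config G n) (i : Fin n) (h : G) :
    (nNon G H (mulAt x i h) : ℝ) = nNon G H x + ((if x i * h ∈ H then 0 else 1)
      - if x i ∈ H then 0 else 1) := by
  rw [nNon_cast, nNon_cast, ← Finset.add_sum_erase _ _ (Finset.mem_univ i),
    ← Finset.add_sum_erase _ (fun k => if x k ∈ H then (0 : ℝ) else 1) (Finset.mem_univ i),
    mulAt_self]
  have : ∑ k ∈ Finset.univ.erase i, (if mulAt x i h k ∈ H then (0 : ℝ) else 1) =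
      ∑ k ∈ Finset.univ.erase i, if x k ∈ H then 0 else 1 :=
    Finset.sum_congr rfl fun k hk => by rw [mulAt_ne _ _ (Finset.ne_of_mem_erase hk)]
  rw [this]
  ring

lemma src_mem_iff (H : Subgroup G) (x : Config G n) (j : Fin n) (e : Bool) :
    src x j e ∈ H ↔ x j ∈ H := by
  cases e <;> simp [src]

lemma two_le_nNon {H : Subgroup G} {x : Config G n} {i j : Fin n} (hij : i ≠ j) (hi : x i ∉ H)
    (hj : x j ∉ H) : 2 ≤ nNon G H x := by
  rw [nNon]
  exact Finset.one_lt_card.mpr ⟨i, by simpa using hi, j, by simpa using hj, hij⟩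

/-- The drift of a decreasing function of the number of entries outside a subgroup. -/
lemma avgOp_nNon_le (hn : 2 ≤ n) (H : Subgroup G) {φ : ℕ → ℝ} (hφ : ∀ k, 1 ≤ k → φ (k + 1) ≤ φ k)
    (x : Config G n) :
    avgOp (fun z => φ (nNon G H z)) x ≤ φ (nNon G H x) +
      (nNon G H x * (n - nNon G H x) * (φ (nNon G H x + 1) - φ (nNon G H x))
        + nNon G H x * (nNon G H x - 1) * (φ (nNon G H x - 1) - φ (nNon G H x)))
        / (n * (n - 1)) := by
  have hM := card_move_pos hn
  have hn' : (2 : ℝ) ≤ n := by exact_mod_cast hn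
  obtain ⟨k, hk⟩ : ∃ k, nNon G H x = k := ⟨_, rfl⟩
  rw [hk]
  obtain ⟨v, hv⟩ : ∃ v : Fin n → ℝ, ∀ i, v i = if x i ∈ H then 0 else 1 := ⟨_, fun _ => rfl⟩
  have hvk : ∑ i, v i = k := by
    rw [← hk, nNon_cast]
    exact Finset.sum_congr rfl fun i _ => hv i
  have hvv : ∀ i, v i * v i = v i := by intro i; rw [hv]; split_ifs <;> norm_num
  have hterm : ∀ m : Move n, φ (nNon G H (applyMove G x m)) ≤
      (fun i j (_ : Bool) => φ k + v j * (1 - v i) * (φ (k + 1) - φ k)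
        + v j * v i * (φ (k - 1) - φ k)) m.1.1.1 m.1.1.2 m.2 := by
    rintro ⟨⟨⟨i, j⟩, hij⟩, e⟩
    have hN := nNon_mulAt H x i (src x j e)
    rw [applyMove_eq]
    dsimp only at hij ⊢
    have hs := src_mem_iff H x j e
    rw [hv i, hv j]
    by_cases hj : x j ∈ H
    · have h1 : x i * src x j e ∈ H ↔ x i ∈ H := H.mul_mem_cancel_right (hs.mpr hj)
      have h2 : nNon G H (mulAt x i (src x j e)) = k := by
        rw [← hk]
        have : (nNon G H (mulAt x i (src x j e)) : ℝ) = nNon G H x := by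
          rw [hN]; simp [h1]
        exact_mod_cast this
      simp [hj, h2]
    · by_cases hi : x i ∈ H
      · have h1 : x i * src x j e ∉ H := by
          rw [H.mul_mem_cancel_left hi, hs]; exact hj
        have h2 : nNon G H (mulAt x i (src x j e)) = k + 1 := by
          rw [← hk]
          have : (nNon G H (mulAt x i (src x j e)) : ℝ) = nNon G H x + 1 := by
            rw [hN]; simp [h1, hi]
          exact_mod_cast this
        simp [hj, hi, h2]
      · have hk2 : 2 ≤ k := hk ▸ two_le_nNon hij hi hj
        have hφk : φ k ≤ φ (k - 1) := by
          have := hφ (k - 1) (by omega)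
          rwa [Nat.sub_add_cancel (by omega)] at this
        by_cases h1 : x i * src x j e ∈ H
        · have h2 : nNon G H (mulAt x i (src x j e)) = k - 1 := by
            have : (nNon G H (mulAt x i (src x j e)) : ℝ) + 1 = k := by
              rw [hN, hk]; simp [h1, hi]
            have : nNon G H (mulAt x i (src x j e)) + 1 = k := by exact_mod_cast this
            omega
          simp [hj, hi, h2]
        · have h2 : nNon G H (mulAt x i (src x j e)) = k := by
            rw [← hk]
            have : (nNon G H (mulAt x i (src x j e)) : ℝ) = nNon G H x := by
              rw [hN]; simp [h1, hi]
            exact_mod_cast this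
          simp [hj, hi, h2, hφk]
  rw [avgOp_apply, div_le_iff₀ hM]
  refine (Finset.sum_le_sum fun m _ => hterm m).trans (le_of_eq ?_)
  rw [sum_move_pair (fun i j (_ : Bool) => φ k + v j * (1 - v i) * (φ (k + 1) - φ k)
        + v j * v i * (φ (k - 1) - φ k)), card_move]
  have e1 : ∀ i, ∑ j : Fin n, ∑ _e : Bool, (φ k + v j * (1 - v i) * (φ (k + 1) - φ k)
        + v j * v i * (φ (k - 1) - φ k)) = 2 * (n * φ k + k * (φ (k + 1) - φ k))
          + v i * (2 * k * ((φ (k - 1) - φ k) - (φ (k + 1) - φ k))) := by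
    intro i
    simp only [Finset.sum_const, Finset.card_univ, Fintype.card_bool, nsmul_eq_mul,
      ← Finset.mul_sum, Finset.sum_add_distrib, ← Finset.sum_mul, hvk, Fintype.card_fin]
    push_cast
    ring
  have e2 : ∑ i : Fin n, ∑ _e : Bool, (φ k + v i * (1 - v i) * (φ (k + 1) - φ k)
        + v i * v i * (φ (k - 1) - φ k)) = 2 * (n * φ k + k * (φ (k - 1) - φ k)) := by
    have e3 : ∀ i, φ k + v i * (1 - v i) * (φ (k + 1) - φ k)
        + v i * v i * (φ (k - 1) - φ k) = φ k + v i * (φ (k - 1) - φ k) := by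
      intro i
      linear_combination ((φ (k - 1) - φ k) - (φ (k + 1) - φ k)) * hvv i
    simp only [e3, Finset.sum_const, Finset.card_univ, Fintype.card_bool, nsmul_eq_mul,
      ← Finset.mul_sum, Finset.sum_add_distrib, ← Finset.sum_mul, hvk, Fintype.card_fin]
    push_cast
    ring
  simp only [e1, e2]
  simp only [Finset.sum_const, Finset.card_univ, nsmul_eq_mul,
      Finset.sum_add_distrib, ← Finset.sum_mul, hvk, Fintype.card_fin]
  have : (n : ℝ) - 1 ≠ 0 := by linarith
  have : (n : ℝ) ≠ 0 := by linarith
  field_simp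
  ring

lemma avgOp_pow_le_of_drift (hn : 2 ≤ n) {f : Config G n → ℝ} {ρ c : ℝ} (hρ : 0 ≤ ρ)
    (hf : ∀ x, avgOp f x ≤ ρ * f x + c) (k : ℕ) (x : Config G n) :
    (avgOp ^ k) f x ≤ ρ ^ k * f x + c * ∑ j ∈ Finset.range k, ρ ^ j := by
  induction k generalizing x with
  | zero => simp
  | succ k ih =>
    rw [pow_succ', Module.End.mul_apply]
    have h1 : avgOp ((avgOp ^ k) f) x ≤ ρ ^ k * avgOp f x + c * ∑ j ∈ Finset.range k, ρ ^ j :=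
      avgOp_le_of_le hn fun m => ih _
    have h2 := mul_le_mul_of_nonneg_left (hf x) (pow_nonneg hρ k)
    rw [Finset.sum_range_succ]
    refine h1.trans ?_
    calc _ ≤ ρ ^ k * (ρ * f x + c) + c * ∑ j ∈ Finset.range k, ρ ^ j := by linarith
      _ = _ := by ring

/-- A decreasing function of the number of entries outside a subgroup, comparable to the
inverse square root. -/
def invSqrt (k : ℕ) : ℝ := 1 / Real.sqrt (k - 3 / 4)

lemma invSqrt_zero : invSqrt 0 = 0 := by
  rw [invSqrt, Real.sqrt_eq_zero_of_nonpos (by norm_num), div_zero]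

lemma invSqrt_nonneg (k : ℕ) : 0 ≤ invSqrt k := by rw [invSqrt]; positivity

lemma invSqrt_succ_le {k : ℕ} (hk : 1 ≤ k) : invSqrt (k + 1) ≤ (1 - 1 / (2 * k)) * invSqrt k := by
  have hk' : (1 : ℝ) ≤ k := by exact_mod_cast hk
  have h1 : (0 : ℝ) < k - 3 / 4 := by linarith
  have h2 : (0 : ℝ) ≤ 1 - 1 / (2 * k) := by
    rw [sub_nonneg, div_le_one (by positivity)]; linarith
  rw [invSqrt, invSqrt, mul_one_div, div_le_div_iff₀ (by apply Real.sqrt_pos.mpr; push_cast; linarith)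
    (Real.sqrt_pos.mpr h1), one_mul]
  rw [Real.sqrt_le_left (by positivity), mul_pow, Real.sq_sqrt (by push_cast; linarith)]
  push_cast
  have h3 : (1 - 1 / (2 * k) : ℝ) ^ 2 * (k + 1 - 3 / 4) = k - 3 / 4 + 1 / (16 * k ^ 2) := by
    field_simp; ring
  rw [h3]
  have : (0 : ℝ) ≤ 1 / (16 * k ^ 2) := by positivity
  linarith

lemma invSqrt_antitone {k : ℕ} (hk : 1 ≤ k) : invSqrt (k + 1) ≤ invSqrt k := by
  refine (invSqrt_succ_le hk).trans ?_
  have h1 : (0 : ℝ) ≤ 1 / (2 * k) := by positivity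
  nlinarith [invSqrt_nonneg k]

lemma mul_invSqrt_le (k : ℕ) : k * invSqrt k ≤ 2 * Real.sqrt k := by
  rcases Nat.eq_zero_or_pos k with rfl | hk
  · simp
  have hk' : (1 : ℝ) ≤ k := by exact_mod_cast hk
  rw [invSqrt, mul_one_div, div_le_iff₀ (Real.sqrt_pos.mpr (by linarith)), mul_assoc,
    ← Real.sqrt_mul (by positivity)]
  have : (k : ℝ) / 2 ≤ Real.sqrt (k * (k - 3 / 4)) := by
    apply Real.le_sqrt_of_sq_le
    nlinarith
  linarith

lemma invSqrt_pred_sub_le {k : ℕ} (hk : 2 ≤ k) :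
    (k : ℝ) * (k - 1) * (invSqrt (k - 1) - invSqrt k) ≤ 4 * Real.sqrt k := by
  obtain ⟨l, rfl⟩ : ∃ l, k = l + 1 := ⟨k - 1, by omega⟩
  have hl : (1 : ℝ) ≤ l := by exact_mod_cast (by omega : 1 ≤ l)
  rw [Nat.add_sub_cancel]
  push_cast
  have ha : (0 : ℝ) < l + 1 - 3 / 4 := by linarith
  have hb : (0 : ℝ) < l - 3 / 4 := by linarith
  have h1 : (1 - 1 / (l + 1 - 3 / 4)) * invSqrt l ≤ invSqrt (l + 1) := by
    have hsa := Real.sqrt_pos.mpr ha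
    have hsb := Real.sqrt_pos.mpr hb
    have hsab : Real.sqrt (l - 3 / 4 : ℝ) ≤ Real.sqrt (l + 1 - 3 / 4) :=
      Real.sqrt_le_sqrt (by linarith)
    have h2 : (1 - 1 / (l + 1 - 3 / 4) : ℝ) = (l - 3 / 4) / (l + 1 - 3 / 4) := by
      rw [eq_div_iff ha.ne', sub_mul, div_mul_cancel₀ _ ha.ne']; ring
    rw [h2, invSqrt, invSqrt]
    push_cast
    rw [← Real.sq_sqrt ha.le, ← Real.sq_sqrt hb.le, Real.sqrt_sq hsa.le, Real.sqrt_sq hsb.le]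
    rw [mul_one_div, div_div, div_le_div_iff₀ (by positivity) hsa]
    generalize Real.sqrt (l - 3 / 4 : ℝ) = b at hsb hsab
    generalize Real.sqrt (l + 1 - 3 / 4 : ℝ) = a at hsa hsab
    have : 0 ≤ a * b * (a - b) := mul_nonneg (by positivity) (by linarith)
    nlinarith
  have h3 : invSqrt l - invSqrt (l + 1) ≤ invSqrt l / (l + 1 - 3 / 4) := by
    have : (1 - 1 / (l + 1 - 3 / 4)) * invSqrt l = invSqrt l - invSqrt l / (l + 1 - 3 / 4) := by
      ring
    linarith
  have h4 := mul_invSqrt_le l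
  have h5 : Real.sqrt l ≤ Real.sqrt (l + 1) := Real.sqrt_le_sqrt (by linarith)
  have h6 : (l + 1 : ℝ) / (l + 1 - 3 / 4) ≤ 2 := by
    rw [div_le_iff₀ ha]; linarith
  calc (l + 1 : ℝ) * (l + 1 - 1) * (invSqrt l - invSqrt (l + 1))
      ≤ (l + 1 : ℝ) * (l + 1 - 1) * (invSqrt l / (l + 1 - 3 / 4)) := by
        refine mul_le_mul_of_nonneg_left h3 (mul_nonneg (by linarith) (by linarith))
    _ = (l + 1 : ℝ) / (l + 1 - 3 / 4) * (l * invSqrt l) := by field_simp; ring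
    _ ≤ 2 * (2 * Real.sqrt (l + 1)) := by
        refine mul_le_mul h6 (h4.trans (by linarith)) ?_ (by norm_num)
        exact mul_nonneg (by linarith) (invSqrt_nonneg l)
    _ = _ := by ring

lemma avgOp_invSqrt_le (hn : 2 ≤ n) (H : Subgroup G) (x : Config G n) :
    avgOp (fun z => invSqrt (nNon G H z)) x ≤
      (1 - 1 / (2 * n)) * invSqrt (nNon G H x) + 10 * Real.sqrt n / n ^ 2 := by
  have hn' : (2 : ℝ) ≤ n := by exact_mod_cast hn
  refine (avgOp_nNon_le hn H (fun k => invSqrt_antitone) x).trans ?_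
  have hkn : (nNon G H x : ℝ) ≤ n := by exact_mod_cast nNon_le H x
  generalize nNon G H x = k at hkn
  have hsk : Real.sqrt k ≤ Real.sqrt n := Real.sqrt_le_sqrt hkn
  have hφ0 := invSqrt_nonneg k
  have h1 : (k : ℝ) * (invSqrt (k + 1) - invSqrt k) ≤ -(invSqrt k / 2) := by
    rcases Nat.eq_zero_or_pos k with rfl | hk
    · simp [invSqrt_zero]
    have hk' : (1 : ℝ) ≤ k := by exact_mod_cast hk
    have h2 := mul_le_mul_of_nonneg_left (invSqrt_succ_le hk) (by linarith : (0 : ℝ) ≤ k)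
    have h3 : (k : ℝ) * ((1 - 1 / (2 * k)) * invSqrt k) = k * invSqrt k - invSqrt k / 2 := by
      field_simp
    linarith
  have h2 : (k : ℝ) * (k - 1) * (invSqrt (k - 1) - invSqrt k) ≤ 4 * Real.sqrt n := by
    rcases lt_or_ge k 2 with hk | hk
    · have : (k : ℝ) * (k - 1) = 0 := by
        interval_cases k <;> simp
      rw [this, zero_mul]; positivity
    · exact (invSqrt_pred_sub_le hk).trans (by linarith)
  have h3 := mul_invSqrt_le k
  have h4 : (k : ℝ) * (n - k) * (invSqrt (k + 1) - invSqrt k) ≤ -(n - k) * (invSqrt k / 2) := by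
    have := mul_le_mul_of_nonneg_left h1 (by linarith : (0 : ℝ) ≤ n - k)
    linarith
  have h5 : -((n : ℝ) - k) * (invSqrt k / 2) ≤ -(n * invSqrt k / 2) + Real.sqrt n := by
    linarith
  have hpos : (0 : ℝ) < n * (n - 1) := mul_pos (by linarith) (by linarith)
  have hs : 0 ≤ Real.sqrt n := Real.sqrt_nonneg _
  have h6 : (k * (n - k) * (invSqrt (k + 1) - invSqrt k)
        + k * (k - 1) * (invSqrt (k - 1) - invSqrt k)) / (n * (n - 1)) ≤
      -(1 / (2 * n)) * invSqrt k + 10 * Real.sqrt n / n ^ 2 := by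
    rw [div_le_iff₀ hpos]
    have e : (-(1 / (2 * n)) * invSqrt k + 10 * Real.sqrt n / n ^ 2) * (n * (n - 1)) =
        -((n - 1) * invSqrt k / 2) + 10 * Real.sqrt n * ((n - 1) / n) := by
      field_simp
    have h7 : (1 / 2 : ℝ) ≤ (n - 1) / n := by
      rw [le_div_iff₀ (by linarith)]; linarith
    have h8 := mul_le_mul_of_nonneg_left h7 (by linarith : 0 ≤ 10 * Real.sqrt n)
    rw [e]
    linarith
  linarith

lemma one_sub_pow_le_exp {p : ℝ} (hp : p ≤ 1) (k : ℕ) : (1 - p) ^ k ≤ Real.exp (-p * k) := by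
  have h1 : 1 - p ≤ Real.exp (-p) := by linarith [Real.add_one_le_exp (-p)]
  calc (1 - p) ^ k ≤ Real.exp (-p) ^ k := pow_le_pow_left₀ (by linarith) h1 k
    _ = _ := by rw [← Real.exp_nat_mul]; ring_nf

lemma invSqrt_le_two (k : ℕ) : invSqrt k ≤ 2 := by
  rcases Nat.eq_zero_or_pos k with rfl | hk
  · rw [invSqrt_zero]; norm_num
  have hk' : (1 : ℝ) ≤ k := by exact_mod_cast hk
  have h1 : (1 / 2 : ℝ) ≤ Real.sqrt (k - 3 / 4) := by
    apply Real.le_sqrt_of_sq_le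
    linarith
  rw [invSqrt, div_le_iff₀ (by linarith)]
  linarith

lemma avgOp_pow_invSqrt_le (hn : 2 ≤ n) (H : Subgroup G) (σ : Config G n) {T : ℕ}
    (hT : n * Real.log n ≤ T) :
    (avgOp ^ T) (fun z => invSqrt (nNon G H z)) σ ≤ 22 / Real.sqrt n := by
  have hn' : (2 : ℝ) ≤ n := by exact_mod_cast hn
  have hp : (1 : ℝ) / (2 * n) ≤ 1 := by
    rw [div_le_one (by linarith)]; linarith
  have h1 := avgOp_pow_le_of_drift hn (sub_nonneg.mpr hp) (avgOp_invSqrt_le hn H) T σ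
  have h2 := geom_sum_le (sub_nonneg.mpr hp) (by linarith : (0 : ℝ) < 2 * n) le_rfl T
  have hs : 0 < Real.sqrt n := Real.sqrt_pos.mpr (by linarith)
  have hss : Real.sqrt n * Real.sqrt n = n := Real.mul_self_sqrt (by linarith)
  have h3 : (1 - 1 / (2 * n) : ℝ) ^ T ≤ 1 / Real.sqrt n := by
    refine (one_sub_pow_le_exp hp T).trans ?_
    rw [← Real.exp_log hs, one_div (Real.exp _), ← Real.exp_neg, Real.exp_le_exp,
      Real.log_sqrt (by linarith)]
    have : Real.log n / 2 ≤ 1 / (2 * n) * T := by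
      rw [div_mul_eq_mul_div, one_mul, le_div_iff₀ (by linarith)]
      linarith
    linarith
  have h4 := mul_le_mul h3 (invSqrt_le_two (nNon G H σ)) (invSqrt_nonneg _) (by positivity)
  have h5 := mul_le_mul_of_nonneg_left h2 (by positivity : (0 : ℝ) ≤ 10 * Real.sqrt n / n ^ 2)
  have h6 : 10 * Real.sqrt n / n ^ 2 * (2 * n) = 20 / Real.sqrt n := by
    rw [div_mul_eq_mul_div, div_eq_div_iff (by positivity) (by positivity)]
    linear_combination (20 * (n : ℝ)) * hss
  have h7 : 22 / Real.sqrt n = 1 / Real.sqrt n * 2 + 20 / Real.sqrt n := by ring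
  linarith

lemma avgOp_pow_nNon_eq_zero_le (hn : 2 ≤ n) (H : Subgroup G) (σ : Config G n) (T : ℕ) :
    (avgOp ^ T) (fun z => if nNon G H z = 0 then 1 else 0) σ ≤
      if nNon G H σ = 0 then 1 else 0 := by
  have hd : ∀ x : Config G n, avgOp (fun z => if nNon G H z = 0 then (1 : ℝ) else 0) x ≤
      1 * (if nNon G H x = 0 then 1 else 0) + 0 := by
    intro x
    have h := avgOp_nNon_le hn H (φ := fun k => if k = 0 then 1 else 0)
      (fun k hk => by simp [show k ≠ 0 by omega]) x
    refine h.trans (le_of_eq ?_)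
    rcases Nat.lt_or_ge (nNon G H x) 2 with hk | hk
    · generalize nNon G H x = k at hk
      interval_cases k <;> simp
    · simp [show nNon G H x ≠ 0 by omega, show nNon G H x - 1 ≠ 0 by omega]
  have := avgOp_pow_le_of_drift hn zero_le_one hd T σ
  simpa using this

lemma one_le_nNon {H : Subgroup G} (hH : H ≠ ⊤) {σ : Config G n} (hσ : σ ∈ gens G n) :
    nNon G H σ ≠ 0 := by
  intro h
  apply hH
  rw [eq_top_iff, ← show Subgroup.closure (Set.range σ) = ⊤ from hσ, Subgroup.closure_le]
  rintro _ ⟨i, rfl⟩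
  by_contra hi
  rw [nNon, Finset.card_eq_zero] at h
  have : i ∈ (Finset.univ.filter fun i => σ i ∉ H) := by simpa using hi
  rw [h] at this
  simp at this

lemma indicator_le_invSqrt (k : ℕ) {L : ℝ} (hL : 0 < L) :
    (if (k : ℝ) < L then 1 else 0) ≤ Real.sqrt L * invSqrt k + if k = 0 then 1 else 0 := by
  rcases Nat.eq_zero_or_pos k with rfl | hk
  · simp [invSqrt_zero, hL]
  have hk' : (1 : ℝ) ≤ k := by exact_mod_cast hk
  have h0 := mul_nonneg (Real.sqrt_nonneg L) (invSqrt_nonneg k)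
  rw [if_neg (by omega : k ≠ 0), add_zero]
  split_ifs with h
  · rw [invSqrt, mul_one_div, le_div_iff₀ (Real.sqrt_pos.mpr (by linarith)), one_mul]
    exact Real.sqrt_le_sqrt (by linarith)
  · exact h0

/-- After `n log n` steps the number of entries outside a proper subgroup is of order `n`. -/
lemma avgOp_pow_nNon_lt_le (hn : 2 ≤ n) {H : Subgroup G} (hH : H ≠ ⊤) {σ : Config G n}
    (hσ : σ ∈ gens G n) {T : ℕ} (hT : n * Real.log n ≤ T) {c : ℝ} (hc : 0 < c) :
    (avgOp ^ T) (fun z => if (nNon G H z : ℝ) < c * n then 1 else 0) σ ≤ 22 * Real.sqrt c := by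
  have hn' : (2 : ℝ) ≤ n := by exact_mod_cast hn
  have h1 : (avgOp ^ T) (fun z => if (nNon G H z : ℝ) < c * n then 1 else 0) σ ≤
      (avgOp ^ T) (fun z => Real.sqrt (c * n) * invSqrt (nNon G H z)
        + if nNon G H z = 0 then 1 else 0) σ :=
    avgOp_pow_mono (fun z => indicator_le_invSqrt _ (by positivity)) T σ
  rw [avgOp_const_mul_add (Real.sqrt (c * n)) (fun z => invSqrt (nNon G H z))
    (fun z => if nNon G H z = 0 then 1 else 0)] at h1
  have h2 := avgOp_pow_nNon_eq_zero_le hn H σ T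
  rw [if_neg (one_le_nNon hH hσ)] at h2
  have h3 := mul_le_mul_of_nonneg_left (avgOp_pow_invSqrt_le hn H σ hT)
    (Real.sqrt_nonneg (c * n))
  have hs : 0 < Real.sqrt n := Real.sqrt_pos.mpr (by linarith)
  have h4 : Real.sqrt (c * n) * (22 / Real.sqrt n) = 22 * Real.sqrt c := by
    rw [Real.sqrt_mul hc.le]; field_simp
  linarith

/-- An exponentially decreasing function of the number of entries outside a subgroup. -/
def expNon (H : Subgroup G) (K : ℕ) (x : Config G n) : ℝ := 2 ^ K * (1 / 2) ^ nNon G H x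

lemma expNon_nonneg (H : Subgroup G) (K : ℕ) (x : Config G n) : 0 ≤ expNon H K x := by
  rw [expNon]; positivity

lemma one_le_expNon {H : Subgroup G} {K : ℕ} {x : Config G n} (h : nNon G H x ≤ K) :
    1 ≤ expNon H K x := by
  rw [expNon]
  have h1 : ((1 : ℝ) / 2) ^ K ≤ (1 / 2) ^ nNon G H x :=
    pow_le_pow_of_le_one (by norm_num) (by norm_num) h
  have h2 : (2 : ℝ) ^ K * (1 / 2) ^ K = 1 := by rw [← mul_pow]; norm_num
  nlinarith [pow_pos (by norm_num : (0 : ℝ) < 2) K]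

lemma two_pow_mul_half_pow {K l : ℕ} : (2 : ℝ) ^ K * (1 / 2) ^ (K + l) = (1 / 2) ^ l := by
  rw [pow_add, ← mul_assoc, ← mul_pow]; norm_num

lemma expNon_le {H : Subgroup G} {K : ℕ} {x : Config G n} (h : 2 * K ≤ nNon G H x) :
    expNon H K x ≤ (1 / 2) ^ K := by
  obtain ⟨l, hl⟩ : ∃ l, nNon G H x = K + l := ⟨nNon G H x - K, by omega⟩
  rw [expNon, hl, two_pow_mul_half_pow]
  exact pow_le_pow_of_le_one (by norm_num) (by norm_num) (by omega)

lemma avgOp_expNon_le (hn : 2 ≤ n) (H : Subgroup G) {K : ℕ} (hK : 6 * K ≤ n) (x : Config G n) :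
    avgOp (expNon H K) x ≤ 1 * expNon H K x + (1 / 2) ^ (n / 6) := by
  have hn' : (2 : ℝ) ≤ n := by exact_mod_cast hn
  have hφ : ∀ k, (2 : ℝ) ^ K * (1 / 2) ^ (k + 1) = 2 ^ K * (1 / 2) ^ k / 2 := by
    intro k; rw [pow_succ]; ring
  have h := avgOp_nNon_le hn H (φ := fun k => 2 ^ K * (1 / 2) ^ k) (fun k _ => by
    have : (0 : ℝ) ≤ 2 ^ K * (1 / 2) ^ k := by positivity
    rw [hφ]; linarith) x
  refine h.trans ?_
  have hkn := nNon_le H x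
  rw [one_mul, expNon]
  generalize nNon G H x = k at hkn
  have hpos : (0 : ℝ) < n * (n - 1) := mul_pos (by linarith) (by linarith)
  simp only [add_le_add_iff_left]
  rw [div_le_iff₀ hpos, hφ]
  have hh : (0 : ℝ) < (1 / 2) ^ (n / 6) := by positivity
  rcases Nat.eq_zero_or_pos k with rfl | hk
  · simp only [Nat.cast_zero, zero_mul, zero_add]
    exact mul_nonneg hh.le hpos.le
  have hk' : (1 : ℝ) ≤ k := by exact_mod_cast hk
  have hkn' : (k : ℝ) ≤ n := by exact_mod_cast hkn
  have hpred : (2 : ℝ) ^ K * (1 / 2) ^ (k - 1) = 2 * (2 ^ K * (1 / 2) ^ k) := by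
    have := hφ (k - 1)
    rw [Nat.sub_add_cancel hk] at this
    linarith
  rw [hpred]
  have hp0 : (0 : ℝ) < 2 ^ K * (1 / 2) ^ k := by positivity
  have e : ∀ p : ℝ, (k : ℝ) * (n - k) * (p / 2 - p) + k * (k - 1) * (2 * p - p) =
      p * (k * (3 * k - n - 2) / 2) := by intro p; ring
  rw [e]
  rcases le_or_gt (3 * k) (n + 2) with h3 | h3
  · have h3' : (3 * k : ℝ) ≤ n + 2 := by exact_mod_cast h3
    have : (k * (3 * k - n - 2) / 2 : ℝ) ≤ 0 := by nlinarith
    have h4 := mul_nonneg hh.le hpos.le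
    nlinarith
  · obtain ⟨l, rfl⟩ : ∃ l, k = K + l := ⟨k - K, by omega⟩
    rw [two_pow_mul_half_pow] at hp0 ⊢
    have h5 : ((1 : ℝ) / 2) ^ l ≤ (1 / 2) ^ (n / 6) :=
      pow_le_pow_of_le_one (by norm_num) (by norm_num) (by omega)
    generalize K + l = k at *
    have h3' : (n + 2 : ℝ) < 3 * k := by exact_mod_cast h3
    refine mul_le_mul h5 ?_ ?_ hh.le
    · nlinarith
    · have := mul_nonneg (by linarith : (0 : ℝ) ≤ k) (by linarith : (0 : ℝ) ≤ 3 * k - n - 2)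
      linarith

lemma diss_one (w : A → G → ℝ) : diss w 1 = 0 := by simp [diss]

lemma diss_mul_le (w : A → G → ℝ) (g h : G) : diss w (g * h) ≤ 2 * diss w g + 2 * diss w h := by
  have e : diss w h = ∑ a, ∑ b, (w a (b * g * h) - w a (b * g)) ^ 2 :=
    Finset.sum_congr rfl fun a _ => (sum_shift (fun b => (w a (b * h) - w a b) ^ 2) g).symm
  rw [e]
  simp only [diss, Finset.mul_sum, ← Finset.sum_add_distrib]
  refine Finset.sum_le_sum fun a _ => Finset.sum_le_sum fun b _ => ?_
  rw [← mul_assoc]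
  nlinarith [sq_nonneg ((w a (b * g * h) - w a (b * g)) - (w a (b * g) - w a b))]

lemma diss_inv (w : A → G → ℝ) (g : G) : diss w g⁻¹ = diss w g := by
  refine Finset.sum_congr rfl fun a _ => ?_
  rw [← sum_shift (fun b => (w a (b * g⁻¹) - w a b) ^ 2) g]
  refine Finset.sum_congr rfl fun b _ => ?_
  rw [mul_inv_cancel_right]
  ring

lemma exists_diss_le {S : Finset G} (hS : Subgroup.closure (S : Set G) = ⊤) (g : G) :
    ∃ D : ℝ, 0 ≤ D ∧ ∀ w : A → G → ℝ, diss w g ≤ D * ∑ s ∈ S, diss w s := by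
  have hg : g ∈ Subgroup.closure (S : Set G) := by rw [hS]; trivial
  induction hg using Subgroup.closure_induction with
  | mem g hg =>
    refine ⟨1, zero_le_one, fun w => ?_⟩
    rw [one_mul]
    exact Finset.single_le_sum (f := fun s => diss w s) (fun s _ => diss_nonneg w s)
      (Finset.mem_coe.mp hg)
  | one => exact ⟨0, le_rfl, fun w => by rw [diss_one, zero_mul]⟩
  | mul g h _ _ ihg ihh =>
    obtain ⟨D, hD, h1⟩ := ihg
    obtain ⟨D', hD', h2⟩ := ihh
    refine ⟨2 * D + 2 * D', by linarith, fun w => (diss_mul_le w g h).trans ?_⟩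
    have := h1 w
    have := h2 w
    linarith
  | inv g _ ih =>
    obtain ⟨D, hD, h1⟩ := ih
    exact ⟨D, hD, fun w => by rw [diss_inv]; exact h1 w⟩

variable (G) in
/-- A Poincaré inequality, uniform over all generating subsets. -/
lemma exists_sq_le : ∃ D : ℝ, 1 ≤ D ∧ ∀ S : Finset G, Subgroup.closure (S : Set G) = ⊤ →
    ∀ w : Unit → G → ℝ, (∀ a, ∑ b, w a b = 0) → sq w ≤ D * ∑ s ∈ S, diss w s := by
  have h : ∀ S : Finset G, ∃ D : ℝ, 0 ≤ D ∧ (Subgroup.closure (S : Set G) = ⊤ →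
      ∀ w : Unit → G → ℝ, (∀ a, ∑ b, w a b = 0) → sq w ≤ D * ∑ s ∈ S, diss w s) := by
    intro S
    by_cases hS : Subgroup.closure (S : Set G) = ⊤
    · choose D hD hD' using exists_diss_le (A := Unit) hS
      refine ⟨∑ g, D g, Finset.sum_nonneg fun g _ => hD g, fun _ w hw => ?_⟩
      have h1 := sum_diss w hw
      have h2 : ∑ g, diss w g ≤ (∑ g, D g) * ∑ s ∈ S, diss w s := by
        rw [Finset.sum_mul]
        exact Finset.sum_le_sum fun g _ => hD' g w
      have h3 := one_le_card (G := G)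
      have h4 := sq_nonneg' w
      nlinarith
    · exact ⟨0, le_rfl, fun h => absurd h hS⟩
  choose D hD hD' using h
  have hs : 0 ≤ ∑ S, D S := Finset.sum_nonneg fun S _ => hD S
  refine ⟨1 + ∑ S, D S, by linarith, fun S hS w hw => (hD' S hS w hw).trans ?_⟩
  refine mul_le_mul_of_nonneg_right ?_ (Finset.sum_nonneg fun s _ => diss_nonneg w s)
  have := Finset.single_le_sum (f := D) (fun S _ => hD S) (Finset.mem_univ S)
  linarith

lemma sum_nu_not_mem (H : Subgroup G) (x : Config G n) :
    ∑ g, nu x g * (if g ∈ H then 0 else 1) = 2 * nNon G H x := by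
  rw [← sum_src x (fun g => if g ∈ H then 0 else 1), nNon_cast, Finset.mul_sum]
  refine Finset.sum_congr rfl fun j _ => ?_
  simp [src_mem_iff]

lemma closure_nu_eq_top {x : Config G n} {K : ℝ} (hK : 0 ≤ K)
    (hx : ∀ H : Subgroup G, H ≠ ⊤ → K < nNon G H x) :
    Subgroup.closure ((Finset.univ.filter fun g => 2 * K / Fintype.card G ≤ nu x g : Finset G) :
      Set G) = ⊤ := by
  by_contra hH
  have h1 := hx _ hH
  have h2 := sum_nu_not_mem (Subgroup.closure ((Finset.univ.filter fun g =>
    2 * K / Fintype.card G ≤ nu x g : Finset G) : Set G)) x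
  have hq := card_pos' (G := G)
  have h3 : ∑ g, nu x g * (if g ∈ Subgroup.closure ((Finset.univ.filter fun g =>
    2 * K / Fintype.card G ≤ nu x g : Finset G) : Set G) then 0 else 1) ≤
      ∑ _g : G, 2 * K / Fintype.card G := by
    refine Finset.sum_le_sum fun g _ => ?_
    split_ifs with hg
    · rw [mul_zero]; positivity
    · rw [mul_one]
      by_contra! h
      replace h := h.le
      exact hg (Subgroup.subset_closure (by simpa using h))
  rw [h2, Finset.sum_const, Finset.card_univ, nsmul_eq_mul] at h3
  rw [mul_div_cancel₀ _ hq.ne'] at h3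
  linarith

/-- Away from the configurations concentrated on a proper subgroup, the squared deviation
contracts. -/
lemma avgOp_esq_le_of_good (hn : 2 ≤ n) {D : ℝ} (hD : 1 ≤ D)
    (hP : ∀ S : Finset G, Subgroup.closure (S : Set G) = ⊤ →
      ∀ w : Unit → G → ℝ, (∀ a, ∑ b, w a b = 0) → sq w ≤ D * ∑ s ∈ S, diss w s)
    {x : Config G n} {K : ℝ} (hK : 0 ≤ K) (hx : ∀ H : Subgroup G, H ≠ ⊤ → K < nNon G H x) :
    avgOp esq x ≤ (1 - K / (Fintype.card G * D * n ^ 2)) * esq x + 12 := by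
  have hM := card_move_pos hn
  have hn' : (2 : ℝ) ≤ n := by exact_mod_cast hn
  have hq := card_pos' (G := G)
  have h1 := avgOp_dsq_le hn (fun _ => ()) x
  have h2 := hP _ (closure_nu_eq_top hK hx) (dev (fun _ => ()) x) (sum_dev _ x)
  set w := dev (fun _ => ()) x with hw
  have h3 : ∑ s ∈ Finset.univ.filter (fun g => 2 * K / Fintype.card G ≤ nu x g),
      2 * K / Fintype.card G * diss w s ≤ ∑ g, nu x g * diss w g := by
    refine (Finset.sum_le_sum fun g hg => mul_le_mul_of_nonneg_right
      (Finset.mem_filter.mp hg).2 (diss_nonneg w g)).trans ?_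
    exact Finset.sum_le_sum_of_subset_of_nonneg (Finset.subset_univ _)
      fun g _ _ => mul_nonneg (nu_nonneg x g) (diss_nonneg w g)
  rw [← Finset.mul_sum] at h3
  have h4 : 2 * K / Fintype.card G * (esq x / D) ≤ ∑ g, nu x g * diss w g := by
    refine le_trans (mul_le_mul_of_nonneg_left ?_ (by positivity)) h3
    rw [div_le_iff₀ (by linarith), mul_comm]
    exact h2
  have h5 : K / (Fintype.card G * D * n ^ 2) * esq x ≤
      (∑ g, nu x g * diss w g) / Fintype.card (Move n) := by
    rw [le_div_iff₀ hM, card_move]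
    refine le_trans ?_ h4
    have e : 2 * K / Fintype.card G * (esq x / D) =
        K / (Fintype.card G * D * n ^ 2) * esq x * (2 * n ^ 2) := by
      field_simp
    rw [e]
    refine mul_le_mul_of_nonneg_left (by nlinarith) (mul_nonneg (by positivity) (esq_nonneg x))
  have h6 : avgOp esq x = avgOp (dsq fun _ => ()) x := rfl
  have h7 : esq x = dsq (fun _ => ()) x := rfl
  rw [h6]
  linarith

variable (G) in
/-- The proper subgroups. -/
def properSubgroups : Finset (Subgroup G) := (Set.toFinite {H : Subgroup G | H ≠ ⊤}).toFinset

lemma mem_properSubgroups {H : Subgroup G} : H ∈ properSubgroups G ↔ H ≠ ⊤ := by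
  simp [properSubgroups]

lemma esq_le (x : Config G n) : esq x ≤ Fintype.card G * n ^ 2 := by
  rw [esq, dsq, sq]
  simp only [Finset.univ_unique, Finset.sum_singleton]
  calc _ ≤ ∑ _b : G, (n : ℝ) ^ 2 := Finset.sum_le_sum fun b _ => by
        have := abs_dev_le (fun _ => ()) x () b
        exact sq_le_sq' (by linarith [neg_abs_le (dev (fun _ => ()) x () b)])
          ((le_abs_self _).trans this)
    _ = _ := by simp

lemma avgOp_pow_min_esq_le_add (hn : 2 ≤ n) {D : ℝ} (hD : 1 ≤ D)
    (hP : ∀ S : Finset G, Subgroup.closure (S : Set G) = ⊤ →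
      ∀ w : Unit → G → ℝ, (∀ a, ∑ b, w a b = 0) → sq w ≤ D * ∑ s ∈ S, diss w s)
    {K : ℕ} (hK : 6 * K ≤ n) {c : ℝ} (hc : 0 ≤ c) (k : ℕ) (x : Config G n) :
    (avgOp ^ k) (fun z => min 1 (c * esq z)) x ≤
      (1 - K / (Fintype.card G * D * n ^ 2)) ^ k * c * esq x + 12 * c * k
        + ∑ H ∈ properSubgroups G, expNon H K x
        + k * (properSubgroups G).card * (1 / 2) ^ (n / 6) := by
  have hn' : (2 : ℝ) ≤ n := by exact_mod_cast hn
  have hq := one_le_card (G := G)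
  have hK' : (6 * K : ℝ) ≤ n := by exact_mod_cast hK
  have hK0 : (0 : ℝ) ≤ K := Nat.cast_nonneg K
  obtain ⟨ρ, hρ⟩ : ∃ ρ : ℝ, ρ = 1 - K / (Fintype.card G * D * n ^ 2) := ⟨_, rfl⟩
  have hρ0 : 0 ≤ ρ := by
    rw [hρ, sub_nonneg, div_le_one (by positivity)]
    have h1 : (1 : ℝ) ≤ Fintype.card G * D := by nlinarith
    have h2 : (n : ℝ) ≤ n ^ 2 := by nlinarith
    nlinarith
  have hρ1 : ρ ≤ 1 := by
    rw [hρ]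
    have : (0 : ℝ) ≤ K / (Fintype.card G * D * n ^ 2) := by positivity
    linarith
  rw [← hρ]
  have hQ0 : ∀ z : Config G n, 0 ≤ ∑ H ∈ properSubgroups G, expNon H K z :=
    fun z => Finset.sum_nonneg fun H _ => expNon_nonneg H K z
  have hQ : ∀ z : Config G n, avgOp (fun z => ∑ H ∈ properSubgroups G, expNon H K z) z ≤
      ∑ H ∈ properSubgroups G, expNon H K z + (properSubgroups G).card * (1 / 2) ^ (n / 6) := by
    intro z
    have e : (fun z : Config G n => ∑ H ∈ properSubgroups G, expNon H K z) =
        ∑ H ∈ properSubgroups G, expNon H K := by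
      funext z; rw [Finset.sum_apply]
    rw [e, map_sum, Finset.sum_apply]
    calc _ ≤ ∑ H ∈ properSubgroups G, (expNon H K z + (1 / 2) ^ (n / 6)) :=
          Finset.sum_le_sum fun H _ => by simpa using avgOp_expNon_le hn H hK z
      _ = _ := by rw [Finset.sum_add_distrib, Finset.sum_const, nsmul_eq_mul]
  have hp : (0 : ℝ) ≤ (properSubgroups G).card * (1 / 2) ^ (n / 6) := by positivity
  induction k generalizing x with
  | zero =>
    simp only [pow_zero, Module.End.one_apply, Nat.cast_zero, mul_zero, zero_mul, add_zero, one_mul]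
    linarith [min_le_right 1 (c * esq x), hQ0 x]
  | succ k ih =>
    by_cases hx : ∀ H : Subgroup G, H ≠ ⊤ → (K : ℝ) < nNon G H x
    · rw [pow_succ', Module.End.mul_apply]
      have h1 : avgOp ((avgOp ^ k) fun z => min 1 (c * esq z)) x ≤
          1 * avgOp (fun z => (ρ ^ k * c) * esq z +
            ∑ H ∈ properSubgroups G, expNon H K z) x
          + (12 * c * k + k * (properSubgroups G).card * (1 / 2) ^ (n / 6)) :=
        avgOp_le_of_le hn fun m => (ih _).trans (by linarith)
      have h2 := avgOp_const_mul_add (ρ ^ k * c) esq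
        (fun z => ∑ H ∈ properSubgroups G, expNon H K z) 1 x
      rw [pow_one] at h2
      rw [h2] at h1
      have h3 := avgOp_esq_le_of_good hn hD hP hK0 hx
      rw [← hρ] at h3
      have h4 := mul_le_mul_of_nonneg_left h3 (mul_nonneg (pow_nonneg hρ0 k) hc)
      have h5 : ρ ^ k * c ≤ 1 * c := mul_le_mul_of_nonneg_right (pow_le_one₀ hρ0 hρ1) hc
      have h6 := hQ x
      push_cast
      rw [pow_succ]
      linarith
    · push Not at hx
      obtain ⟨H, hH, hx⟩ := hx
      have h1 := (avgOp_pow_mem hn (f := fun z => min 1 (c * esq z))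
        (fun z => le_min zero_le_one (mul_nonneg hc (esq_nonneg z)))
        (fun z => min_le_left _ _) (k + 1)).2 x
      have h2 := one_le_expNon (H := H) (K := K) (x := x) (by exact_mod_cast hx)
      have h3 := Finset.single_le_sum (f := fun H => expNon H K x)
        (fun H _ => expNon_nonneg H K x) (mem_properSubgroups.mpr hH)
      have h4 : 0 ≤ ρ ^ (k + 1) * c * esq x :=
        mul_nonneg (mul_nonneg (pow_nonneg hρ0 _) hc) (esq_nonneg x)
      have h5 : 0 ≤ 12 * c * (k + 1 : ℕ) := by positivity
      have h6 : (0 : ℝ) ≤ (k + 1 : ℕ) * (properSubgroups G).card * (1 / 2) ^ (n / 6) := by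
        positivity
      linarith

lemma avgOp_pow_min_esq_le (hn : 2 ≤ n) {D : ℝ} (hD : 1 ≤ D)
    (hP : ∀ S : Finset G, Subgroup.closure (S : Set G) = ⊤ →
      ∀ w : Unit → G → ℝ, (∀ a, ∑ b, w a b = 0) → sq w ≤ D * ∑ s ∈ S, diss w s)
    {K : ℕ} (hK : 6 * K ≤ n) {c : ℝ} (hc : 0 ≤ c) (k : ℕ) (x : Config G n) :
    (avgOp ^ k) (fun z => min 1 (c * esq z)) x ≤
      (Real.exp (-(K / (Fintype.card G * D * n ^ 2)) * k) * c * (Fintype.card G * n ^ 2)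
        + 12 * c * k + (properSubgroups G).card * ((1 / 2) ^ K + k * (1 / 2) ^ (n / 6)))
        + ∑ H ∈ properSubgroups G, if nNon G H x < 2 * K then 1 else 0 := by
  have hn' : (2 : ℝ) ≤ n := by exact_mod_cast hn
  have hq := one_le_card (G := G)
  have hK' : (6 * K : ℝ) ≤ n := by exact_mod_cast hK
  have hK0 : (0 : ℝ) ≤ K := Nat.cast_nonneg K
  by_cases hx : ∃ H : Subgroup G, H ≠ ⊤ ∧ nNon G H x < 2 * K
  · obtain ⟨H, hH, hx⟩ := hx
    have h1 := (avgOp_pow_mem hn (f := fun z => min 1 (c * esq z))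
      (fun z => le_min zero_le_one (mul_nonneg hc (esq_nonneg z)))
      (fun z => min_le_left _ _) k).2 x
    have h3 := Finset.single_le_sum (f := fun H => if nNon G H x < 2 * K then (1 : ℝ) else 0)
      (fun H _ => by split_ifs <;> norm_num) (mem_properSubgroups.mpr hH)
    rw [if_pos hx] at h3
    have h4 : 0 ≤ Real.exp (-(K / (Fintype.card G * D * n ^ 2)) * k) * c
      * (Fintype.card G * n ^ 2) + 12 * c * k
        + (properSubgroups G).card * ((1 / 2) ^ K + k * (1 / 2) ^ (n / 6)) := by positivity
    linarith
  · push Not at hx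
    refine (avgOp_pow_min_esq_le_add hn hD hP hK hc k x).trans ?_
    have h0 : 0 ≤ ∑ H ∈ properSubgroups G, if nNon G H x < 2 * K then (1 : ℝ) else 0 :=
      Finset.sum_nonneg fun H _ => by split_ifs <;> norm_num
    have h1 : ∑ H ∈ properSubgroups G, expNon H K x ≤ (properSubgroups G).card * (1 / 2) ^ K := by
      rw [← nsmul_eq_mul]
      exact Finset.sum_le_card_nsmul _ _ _ fun H hH => expNon_le (hx H (mem_properSubgroups.mp hH))
    have hρ : K / (Fintype.card G * D * n ^ 2) ≤ 1 := by
      rw [div_le_one (by positivity)]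
      have h1 : (1 : ℝ) ≤ Fintype.card G * D := by nlinarith
      have h2 : (n : ℝ) ≤ n ^ 2 := by nlinarith
      nlinarith
    have h2 := mul_le_mul (mul_le_mul_of_nonneg_right (one_sub_pow_le_exp hρ k) hc) (esq_le x)
      (esq_nonneg x) (by positivity)
    linarith

variable (G) in
/-- After a burn-in of `n log n + O(n)` steps the empirical counts are close to equidistributed. -/
lemma exists_avgOp_pow_min_esq_le : ∃ D : ℝ, 1 ≤ D ∧ ∀ (n K : ℕ), 2 ≤ n → 6 * K ≤ n →
    ∀ c : ℝ, 0 ≤ c → ∀ γ : ℝ, 0 < γ → 2 * K ≤ γ * n → ∀ σ ∈ gens G n, ∀ T k : ℕ,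
    n * Real.log n ≤ T →
    (avgOp ^ (T + k)) (fun z => min 1 (c * esq z)) σ ≤
      (Real.exp (-(K / (Fintype.card G * D * n ^ 2)) * k) * c * (Fintype.card G * n ^ 2)
        + 12 * c * k + (properSubgroups G).card * ((1 / 2) ^ K + k * (1 / 2) ^ (n / 6)))
        + (properSubgroups G).card * (22 * Real.sqrt γ) := by
  obtain ⟨D, hD, hP⟩ := exists_sq_le G
  refine ⟨D, hD, fun n K hn hK c hc γ hγ hKγ σ hσ T k hT => ?_⟩
  rw [avgOp_pow_add_apply]
  obtain ⟨E, hE⟩ : ∃ E : ℝ, E = Real.exp (-(K / (Fintype.card G * D * n ^ 2)) * k) * c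
    * (Fintype.card G * n ^ 2) + 12 * c * k
        + (properSubgroups G).card * ((1 / 2) ^ K + k * (1 / 2) ^ (n / 6)) := ⟨_, rfl⟩
  rw [← hE]
  have h1 : (avgOp ^ k) (fun z : Config G n => min 1 (c * esq z)) ≤
      (fun _ => E) + ∑ H ∈ properSubgroups G,
        fun z => if (nNon G H z : ℝ) < γ * n then (1 : ℝ) else 0 := by
    intro z
    refine (avgOp_pow_min_esq_le hn hD hP hK hc k z).trans ?_
    rw [← hE, Pi.add_apply, Finset.sum_apply]
    refine add_le_add_right (Finset.sum_le_sum fun H _ => ?_) _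
    by_cases h : nNon G H z < 2 * K
    · rw [if_pos h, if_pos]
      refine lt_of_lt_of_le ?_ hKγ
      exact_mod_cast h
    · rw [if_neg h]
      split_ifs <;> norm_num
  refine (avgOp_pow_mono h1 T σ).trans ?_
  rw [map_add, map_sum, avgOp_pow_const hn, Pi.add_apply, Finset.sum_apply]
  refine add_le_add_right ?_ _
  rw [← nsmul_eq_mul]
  exact Finset.sum_le_card_nsmul _ _ _ fun H hH =>
    avgOp_pow_nNon_lt_le hn (mem_properSubgroups.mp hH) hσ hT hγ

lemma abs_avgOp_pow_sub_le (hn : 2 ≤ n) {h V : Config G n → ℝ} {u E : ℝ}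
    (hle : ∀ z, |h z - u| ≤ E + V z) (m : ℕ) (σ : Config G n) :
    |(avgOp ^ m) h σ - u| ≤ E + (avgOp ^ m) V σ := by
  have h1 : (avgOp ^ m) h σ ≤ (avgOp ^ m) (fun z => 1 * V z + (fun _ => u + E) z) σ :=
    avgOp_pow_mono (fun z => by have := abs_le.mp (hle z); dsimp only; linarith) m σ
  have h2 : (avgOp ^ m) (fun _ => u - E) σ ≤ (avgOp ^ m) (fun z => 1 * V z + h z) σ :=
    avgOp_pow_mono (fun z => by have := abs_le.mp (hle z); dsimp only; linarith) m σ
  rw [avgOp_const_mul_add, avgOp_pow_const hn] at h1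
  rw [avgOp_const_mul_add, avgOp_pow_const hn] at h2
  rw [abs_le]
  constructor <;> linarith

lemma eventually_log_le {a b δ : ℝ} (hδ : 0 < δ) :
    ∀ᶠ n : ℕ in atTop, a * Real.log n + b ≤ (n : ℝ) ^ δ := by
  have hpos : ∀ᶠ n : ℕ in atTop, 0 ≤ Real.log n := eventually_atTop.mpr
    ⟨1, fun n hn => Real.log_nonneg (by exact_mod_cast hn)⟩
  have h1 := ((isLittleO_log_rpow_atTop hδ).comp_tendsto tendsto_natCast_atTop_atTop).bound
    (show (0 : ℝ) < 1 / (2 * (|a| + 1)) by positivity)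
  have h2 : ∀ᶠ n : ℕ in atTop, 2 * b ≤ (n : ℝ) ^ δ :=
    ((tendsto_rpow_atTop hδ).comp tendsto_natCast_atTop_atTop).eventually_ge_atTop _
  filter_upwards [h1, h2, hpos] with n h1 h2 h3
  have h4 : (0 : ℝ) ≤ (n : ℝ) ^ δ := by positivity
  simp only [Function.comp, Real.norm_eq_abs, abs_of_nonneg h3, abs_of_nonneg h4] at h1
  rw [div_mul_eq_mul_div, one_mul, le_div_iff₀ (by positivity)] at h1
  have h5 : a * Real.log n ≤ |a| * Real.log n := mul_le_mul_of_nonneg_right (le_abs_self a) h3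
  linarith

lemma eventually_mul_half_pow_le (a : ℝ) {ε : ℝ} (hε : 0 < ε) :
    ∀ᶠ n : ℕ in atTop, a * (n * (1 / 2) ^ (n / 6)) ≤ ε := by
  have h1 : Tendsto (fun m : ℕ => (m : ℝ) * (1 / 2) ^ m) atTop (nhds 0) :=
    tendsto_self_mul_const_pow_of_lt_one (by norm_num) (by norm_num)
  have h2 : Tendsto (fun m : ℕ => ((1 : ℝ) / 2) ^ m) atTop (nhds 0) :=
    tendsto_pow_atTop_nhds_zero_of_lt_one (by norm_num) (by norm_num)
  have h3 : Tendsto (fun m : ℕ => |a| * (6 * ((m : ℝ) * (1 / 2) ^ m) + 6 * (1 / 2) ^ m))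
      atTop (nhds 0) := by
    simpa using ((h1.const_mul 6).add (h2.const_mul 6)).const_mul |a|
  have h4 := (h3.comp (Nat.tendsto_div_const_atTop (show (6 : ℕ) ≠ 0 by norm_num))).eventually
    (ge_mem_nhds hε)
  filter_upwards [h4] with n h4
  simp only [Function.comp] at h4
  refine le_trans ?_ h4
  have h5 : (n : ℝ) ≤ 6 * (n / 6 : ℕ) + 6 := by exact_mod_cast (by omega : n ≤ 6 * (n / 6) + 6)
  have h6 : (0 : ℝ) < (1 / 2) ^ (n / 6) := by positivity
  calc a * (n * (1 / 2) ^ (n / 6)) ≤ |a| * (n * (1 / 2) ^ (n / 6)) :=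
        mul_le_mul_of_nonneg_right (le_abs_self a) (by positivity)
    _ ≤ |a| * ((6 * (n / 6 : ℕ) + 6) * (1 / 2) ^ (n / 6)) := by gcongr
    _ = _ := by ring

lemma exists_exp_neg_mul_le (a : ℝ) {b ε : ℝ} (hb : 0 < b) (hε : 0 < ε) :
    ∃ β : ℝ, 0 ≤ β ∧ a * Real.exp (-(b * β)) ≤ ε := by
  have h : Tendsto (fun β : ℝ => a * Real.exp (-(b * β))) atTop (nhds (a * 0)) :=
    (Real.tendsto_exp_neg_atTop_nhds_zero.comp (tendsto_id.const_mul_atTop hb)).const_mul a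
  rw [mul_zero] at h
  obtain ⟨β, h1, h2⟩ := ((eventually_ge_atTop 0).and (h.eventually (ge_mem_nhds hε))).exists
  exact ⟨β, h1, h2⟩

lemma eventually_div_le (a : ℝ) {ε : ℝ} (hε : 0 < ε) {u : ℕ → ℝ} (hu : Tendsto u atTop atTop) :
    ∀ᶠ n : ℕ in atTop, a / u n ≤ ε :=
  (hu.const_div_atTop a).eventually (ge_mem_nhds hε)

variable (G) in
/-- Mixing of test functions, uniformly over generating initial configurations. -/
lemma exists_eventually_abs_sub_unif_le {ε : ℝ} (hε : 0 < ε) :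
    ∃ B : ℝ, ∀ᶠ n : ℕ in atTop, ∃ T : ℕ, (T : ℝ) ≤ 3 / 2 * n * Real.log n + B * n ∧
      ∀ f : Config G n → ℝ, (∀ x, 0 ≤ f x) → (∀ x, f x ≤ 1) → ∀ σ ∈ gens G n,
        |(avgOp ^ T) f σ - unif f| ≤ ε := by
  obtain ⟨C, hC, R, hR⟩ := exists_abs_sub_unif_le G
  obtain ⟨D, hD, hburn⟩ := exists_avgOp_pow_min_esq_le G
  obtain ⟨q, hq⟩ : ∃ q : ℝ, q = Fintype.card G := ⟨_, rfl⟩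
  obtain ⟨p, hp⟩ : ∃ p : ℝ, p = (properSubgroups G).card := ⟨_, rfl⟩
  have hq1 : 1 ≤ q := hq ▸ one_le_card
  have hp0 : 0 ≤ p := hp ▸ Nat.cast_nonneg _
  obtain ⟨e, he⟩ : ∃ e, e = ε / 9 := ⟨_, rfl⟩
  have he0 : 0 < e := by rw [he]; positivity
  rw [← hq] at hR
  simp only [← hq, ← hp] at hburn
  obtain ⟨η, hη⟩ : ∃ η, η = e / C := ⟨_, rfl⟩
  have hη0 : 0 < η := by rw [hη]; positivity
  obtain ⟨β, hβ0, hβ⟩ := exists_exp_neg_mul_le (C / η) (show (0 : ℝ) < 2 by norm_num) he0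
  obtain ⟨κ, hκ0, hκ6, hκ⟩ : ∃ κ : ℝ, 0 < κ ∧ 6 * κ ≤ 1 ∧ p * (22 * Real.sqrt (2 * κ)) ≤ e := by
    refine ⟨min (1 / 6) ((e / (22 * (p + 1))) ^ 2 / 2), ?_, ?_, ?_⟩
    · exact lt_min (by norm_num) (by positivity)
    · have := min_le_left (1 / 6) ((e / (22 * (p + 1))) ^ 2 / 2)
      linarith
    · have h1 : Real.sqrt (2 * min (1 / 6) ((e / (22 * (p + 1))) ^ 2 / 2)) ≤
          e / (22 * (p + 1)) := by
        rw [Real.sqrt_le_left (by positivity)]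
        have := min_le_right (1 / 6) ((e / (22 * (p + 1))) ^ 2 / 2)
        linarith
      calc _ ≤ p * (22 * (e / (22 * (p + 1)))) := by gcongr
        _ = e * (p / (p + 1)) := by field_simp
        _ ≤ e * 1 := by
            refine mul_le_mul_of_nonneg_left ?_ he0.le
            rw [div_le_one (by linarith)]; linarith
        _ = e := mul_one e
  obtain ⟨B, hB0, hB⟩ := exists_exp_neg_mul_le (16 * q ^ 3)
    (show (0 : ℝ) < κ / (2 * q * D) by positivity) he0
  refine ⟨B + β + 4, ?_⟩
  have hcast : Tendsto (fun n : ℕ => (n : ℝ)) atTop atTop := tendsto_natCast_atTop_atTop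
  have hr4 : Tendsto (fun n : ℕ => (n : ℝ) ^ (1 / 4 : ℝ)) atTop atTop :=
    (tendsto_rpow_atTop (by norm_num)).comp hcast
  have hr2 : Tendsto (fun n : ℕ => ((n : ℝ) ^ (1 / 4 : ℝ)) ^ 2) atTop atTop :=
    (tendsto_pow_atTop (by norm_num)).comp hr4
  have hhalf : ∀ᶠ n : ℕ in atTop, p * (1 / 2) ^ ⌊κ * n⌋₊ ≤ e := by
    have h1 : Tendsto (fun m : ℕ => p * ((1 : ℝ) / 2) ^ m) atTop (nhds (p * 0)) :=
      (tendsto_pow_atTop_nhds_zero_of_lt_one (by norm_num) (by norm_num)).const_mul p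
    rw [mul_zero] at h1
    exact (h1.comp (tendsto_nat_floor_atTop.comp (hcast.const_mul_atTop hκ0))).eventually
      (ge_mem_nhds he0)
  filter_upwards [eventually_ge_atTop 2, hcast.eventually_ge_atTop (2 / κ),
    hr4.eventually_ge_atTop R, eventually_div_le (C / η) he0 hr2, eventually_div_le C he0 hr4,
    eventually_div_le (192 * q ^ 2 * (B + 1)) he0 hcast, hhalf,
    eventually_mul_half_pow_le (p * (B + 1)) he0,
    eventually_log_le (a := 19 * q / 2) (b := 19 * q * (β + 1)) (δ := 1 / 4) (by norm_num)]
    with n hn hnκ hRn hc1 hc2 hc3 hc4 hc5 hlog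
  obtain ⟨r, hr⟩ : ∃ r : ℝ, r = (n : ℝ) ^ (1 / 4 : ℝ) := ⟨_, rfl⟩
  rw [← hr] at hRn hc1 hc2 hlog
  have hn' : (2 : ℝ) ≤ n := by exact_mod_cast hn
  have hn0 : (0 : ℝ) < n := by linarith
  have hlog0 : 0 ≤ Real.log n := Real.log_nonneg (by linarith)
  have hr0 : 0 < r := by rw [hr]; positivity
  have hrn : r ^ 4 = n := by
    rw [hr, ← Real.rpow_natCast, ← Real.rpow_mul (by positivity)]; norm_num
  obtain ⟨T, hT⟩ : ∃ T : ℕ, T = ⌈1 / 2 * n * Real.log n + β * n⌉₊ := ⟨_, rfl⟩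
  obtain ⟨S, hS⟩ : ∃ S : ℕ, S = ⌈n * Real.log n⌉₊ := ⟨_, rfl⟩
  obtain ⟨k, hk⟩ : ∃ k : ℕ, k = ⌈B * n⌉₊ := ⟨_, rfl⟩
  obtain ⟨K, hK⟩ : ∃ K : ℕ, K = ⌊κ * n⌋₊ := ⟨_, rfl⟩
  rw [← hK] at hc4
  have hT1 : 1 / 2 * n * Real.log n + β * n ≤ T := hT ▸ Nat.le_ceil _
  have hT2 : (T : ℝ) ≤ 1 / 2 * n * Real.log n + β * n + 1 :=
    hT ▸ (Nat.ceil_lt_add_one (by positivity)).le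
  have hS1 : n * Real.log n ≤ S := hS ▸ Nat.le_ceil _
  have hS2 : (S : ℝ) ≤ n * Real.log n + 1 := hS ▸ (Nat.ceil_lt_add_one (by positivity)).le
  have hk1 : B * n ≤ k := hk ▸ Nat.le_ceil _
  have hk2 : (k : ℝ) ≤ B * n + 1 := hk ▸ (Nat.ceil_lt_add_one (by positivity)).le
  have hK1 : (K : ℝ) ≤ κ * n := hK ▸ Nat.floor_le (by positivity)
  have hK2 : κ * n - 1 ≤ K := hK ▸ (Nat.sub_one_lt_floor _).le
  have hK3 : κ * n / 2 ≤ K := by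
    rw [div_le_iff₀ hκ0] at hnκ
    linarith
  have hK6 : 6 * K ≤ n := by
    have : (6 * K : ℝ) ≤ n := by nlinarith
    exact_mod_cast this
  refine ⟨S + k + (T + (n - 1)), ?_, fun f h0 h1 σ hσ => ?_⟩
  · push_cast [Nat.cast_sub (by omega : 1 ≤ n)]
    linarith
  have hcond : 19 * q * T ≤ n * r := by
    calc 19 * q * T ≤ 19 * q * (1 / 2 * n * Real.log n + β * n + n) := by
          refine mul_le_mul_of_nonneg_left ?_ (by positivity); linarith
      _ = n * (19 * q / 2 * Real.log n + 19 * q * (β + 1)) := by ring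
      _ ≤ n * r := mul_le_mul_of_nonneg_left hlog hn0.le
  obtain ⟨E, hE⟩ : ∃ E, E = C * (Real.exp (-2 * T / n) * n / η + η + 1 / (η * r ^ 2) + 1 / r) :=
    ⟨_, rfl⟩
  have hE0 : 0 ≤ E := by rw [hE]; positivity
  have hE4 : E ≤ 4 * e := by
    have e1 : Real.exp (-2 * T / n) * n ≤ Real.exp (-(2 * β)) := by
      have h2 : Real.exp (-2 * T / n) ≤ Real.exp (-Real.log n + -(2 * β)) := by
        rw [Real.exp_le_exp, div_le_iff₀ hn0]
        linarith
      rw [Real.exp_add, Real.exp_neg, Real.exp_log hn0] at h2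
      calc _ ≤ (n : ℝ)⁻¹ * Real.exp (-(2 * β)) * n := mul_le_mul_of_nonneg_right h2 hn0.le
        _ = _ := by field_simp
    have e2 : C * (Real.exp (-2 * T / n) * n / η) ≤ e := by
      refine le_trans ?_ hβ
      rw [div_mul_eq_mul_div, ← mul_div_assoc]
      gcongr
    have e3 : C * η = e := by rw [hη]; field_simp
    have e4 : C * (1 / (η * r ^ 2)) ≤ e := by
      refine le_of_eq_of_le ?_ hc1
      field_simp
    have e5 : C * (1 / r) ≤ e := by rwa [mul_one_div]
    rw [hE, mul_add, mul_add, mul_add]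
    linarith
  have hun := unif_mem h0 h1
  have hmem := avgOp_pow_mem hn h0 h1 (T + (n - 1))
  have hle : ∀ z, |(avgOp ^ (T + (n - 1))) f z - unif f| ≤
      E + min 1 (16 * q ^ 2 / n ^ 2 * esq z) := by
    intro z
    rw [← min_add_add_left]
    refine le_min ?_ ?_
    · have h2 := hmem.1 z
      have h3 := hmem.2 z
      rw [abs_le]; constructor <;> linarith
    · have := hR n r hRn hrn T hcond η hη0 f h0 h1 z
      rw [← hE] at this
      refine this.trans (le_of_eq ?_)
      ring
  rw [avgOp_pow_add_apply]
  refine (abs_avgOp_pow_sub_le hn hle (S + k) σ).trans ?_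
  have hb := hburn n K hn hK6 (16 * q ^ 2 / n ^ 2) (by positivity) (2 * κ) (by positivity)
    (by linarith) σ hσ S k hS1
  have b1 : Real.exp (-(K / (q * D * n ^ 2)) * k) * (16 * q ^ 2 / n ^ 2) * (q * n ^ 2) ≤ e := by
    refine le_trans (le_of_eq_of_le (b := 16 * q ^ 3 * Real.exp (-(K / (q * D * n ^ 2)) * k))
      ?_ ?_) hB
    · field_simp
    · refine mul_le_mul_of_nonneg_left ?_ (by positivity)
      rw [Real.exp_le_exp, neg_mul, neg_le_neg_iff, div_mul_eq_mul_div, div_mul_eq_mul_div,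
        div_le_div_iff₀ (by positivity) (by positivity)]
      have h2 : κ * n / 2 * (B * n) ≤ K * k := by gcongr
      have h3 := mul_le_mul_of_nonneg_right h2 (by positivity : 0 ≤ 2 * q * D)
      calc _ = κ * n / 2 * (B * n) * (2 * q * D) := by ring
        _ ≤ _ := h3
  have b2 : 12 * (16 * q ^ 2 / n ^ 2) * k ≤ e := by
    refine le_trans ?_ hc3
    have h2 : (k : ℝ) ≤ (B + 1) * n := by linarith
    calc 12 * (16 * q ^ 2 / n ^ 2) * k ≤ 12 * (16 * q ^ 2 / n ^ 2) * ((B + 1) * n) := by gcongr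
      _ = _ := by field_simp; ring
  have b3 : p * (k * (1 / 2) ^ (n / 6)) ≤ e := by
    refine le_trans ?_ hc5
    have h2 : (k : ℝ) ≤ (B + 1) * n := by linarith
    calc p * (k * (1 / 2) ^ (n / 6)) ≤ p * ((B + 1) * n * (1 / 2) ^ (n / 6)) := by gcongr
      _ = _ := by ring
  linarith

lemma two_mul_card_le {H : Subgroup G} (hH : H ≠ ⊤) : 2 * Fintype.card H ≤ Fintype.card G := by
  have h1 := H.card_mul_index
  have h2 : H.index ≠ 1 := fun h => hH (Subgroup.index_eq_one.mp h)
  have h3 : H.index ≠ 0 := Subgroup.index_ne_zero_of_finite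
  rw [Nat.card_eq_fintype_card, Nat.card_eq_fintype_card] at h1
  rw [← h1, mul_comm]
  exact Nat.mul_le_mul_left _ (by omega)

lemma card_config : (Fintype.card (Config G n) : ℝ) = Fintype.card G ^ n := by
  simp [Config]

lemma card_forall_mem_le {H : Subgroup G} (hH : H ≠ ⊤) :
    ((Finset.univ.filter fun x : Config G n => ∀ i, x i ∈ H).card : ℝ) ≤
      (1 / 2) ^ n * Fintype.card (Config G n) := by
  have h1 : (Finset.univ.filter fun x : Config G n => ∀ i, x i ∈ H) =
      Fintype.piFinset fun _ => Finset.univ.filter fun g => g ∈ H := by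
    ext x; simp
  have h2 : (Finset.univ.filter fun g => g ∈ H).card = Fintype.card H :=
    (Fintype.card_subtype _).symm
  rw [h1, Fintype.card_piFinset, Finset.prod_const, Finset.card_univ, Fintype.card_fin, h2,
    card_config, ← mul_pow]
  push_cast
  refine pow_le_pow_left₀ (by positivity) ?_ n
  have : (2 * Fintype.card H : ℝ) ≤ Fintype.card G := by exact_mod_cast two_mul_card_le hH
  linarith

/-- Most configurations generate the group. -/
lemma card_not_gens_le :
    ((Finset.univ.filter fun x : Config G n => x ∉ gens G n).card : ℝ) ≤
      (properSubgroups G).card * (1 / 2) ^ n * Fintype.card (Config G n) := by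
  have h1 : (Finset.univ.filter fun x : Config G n => x ∉ gens G n) ⊆
      (properSubgroups G).biUnion fun H => Finset.univ.filter fun x => ∀ i, x i ∈ H := by
    intro x hx
    rw [Finset.mem_biUnion]
    refine ⟨Subgroup.closure (Set.range x), mem_properSubgroups.mpr (Finset.mem_filter.mp hx).2, ?_⟩
    rw [Finset.mem_filter]
    exact ⟨Finset.mem_univ _, fun i => Subgroup.subset_closure ⟨i, rfl⟩⟩
  have h2 := (Finset.card_le_card h1).trans Finset.card_biUnion_le
  calc ((Finset.univ.filter fun x : Config G n => x ∉ gens G n).card : ℝ)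
      ≤ ∑ H ∈ properSubgroups G,
        ((Finset.univ.filter fun x : Config G n => ∀ i, x i ∈ H).card : ℝ) := by exact_mod_cast h2
    _ ≤ (properSubgroups G).card • ((1 / 2) ^ n * (Fintype.card (Config G n) : ℝ)) :=
        Finset.sum_le_card_nsmul _ _ _ fun H hH => card_forall_mem_le (mem_properSubgroups.mp hH)
    _ = _ := by rw [nsmul_eq_mul, mul_assoc]

lemma abs_sum_statDist_sub_unif_le {A : Finset (Config G n)} (hA : (A : Set (Config G n)) ⊆ gens G n) :
    |∑ τ ∈ A, statDist G n τ - unif (fun τ => if τ ∈ A then 1 else 0)| ≤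
      (properSubgroups G).card * (1 / 2) ^ n := by
  obtain ⟨g, hg⟩ : ∃ g : ℕ, g = (Finset.univ.filter fun x : Config G n => x ∈ gens G n).card :=
    ⟨_, rfl⟩
  have hN := config_card_pos (G := G) (n := n)
  have h1 : ∑ τ ∈ A, statDist G n τ = A.card / g := by
    rw [Finset.sum_congr rfl fun τ hτ => show statDist G n τ = 1 / g by
      rw [statDist, if_pos (hA hτ), hg], Finset.sum_const, nsmul_eq_mul, mul_one_div]
  have h2 : unif (fun τ => if τ ∈ A then 1 else 0) = A.card / Fintype.card (Config G n) := by
    rw [unif]; simp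
  have hAg : (A.card : ℝ) ≤ g := by
    rw [hg]
    exact_mod_cast Finset.card_le_card fun τ hτ => by simpa using hA hτ
  have h3 : (g : ℝ) + (Finset.univ.filter fun x : Config G n => x ∉ gens G n).card =
      Fintype.card (Config G n) := by
    rw [hg]
    exact_mod_cast Finset.card_filter_add_card_filter_not (s := Finset.univ)
      (fun x : Config G n => x ∈ gens G n)
  have h4 := card_not_gens_le (G := G) (n := n)
  have hb0 : (0 : ℝ) ≤ (Finset.univ.filter fun x : Config G n => x ∉ gens G n).card :=
    Nat.cast_nonneg _
  generalize ((Finset.univ.filter fun x : Config G n => x ∉ gens G n).card : ℝ) = b at h3 h4 hb0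
  generalize (Fintype.card (Config G n) : ℝ) = N at *
  rw [h1, h2]
  have ha0 : (0 : ℝ) ≤ A.card := Nat.cast_nonneg _
  generalize (A.card : ℝ) = a at *
  have hg0 : (0 : ℝ) ≤ g := Nat.cast_nonneg g
  generalize (g : ℝ) = g at *
  rcases hg0.eq_or_lt with h0 | h0
  · have : a = 0 := by linarith
    rw [this, zero_div, zero_div, sub_zero, abs_zero]
    positivity
  · have e : a / g - a / N = a / g * (b / N) := by
      rw [← h3] at hN ⊢
      field_simp
      ring
    have h5 : a / g ≤ 1 := (div_le_one h0).mpr hAg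
    have h6 : b / N ≤ (properSubgroups G).card * (1 / 2) ^ n := by rwa [div_le_iff₀ hN]
    rw [e, abs_of_nonneg (by positivity)]
    calc a / g * (b / N) ≤ 1 * (b / N) := mul_le_mul_of_nonneg_right h5 (by positivity)
      _ ≤ _ := by rwa [one_mul]

lemma dMax_nonneg (t : ℕ) : 0 ≤ dMax G n t := by
  refine Real.sSup_nonneg ?_
  rintro _ ⟨σ, -, rfl⟩
  refine Real.sSup_nonneg ?_
  rintro _ ⟨A, -, rfl⟩
  exact abs_nonneg _

lemma dMax_le (hn : 2 ≤ n) {ε : ℝ} (hε : 0 ≤ ε) {T t : ℕ} (hTt : T ≤ t)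
    (h : ∀ f : Config G n → ℝ, (∀ x, 0 ≤ f x) → (∀ x, f x ≤ 1) → ∀ σ ∈ gens G n,
        |(avgOp ^ T) f σ - unif f| ≤ ε) :
    dMax G n t ≤ ε + (properSubgroups G).card * (1 / 2) ^ n := by
  have hb : 0 ≤ ε + (properSubgroups G).card * (1 / 2) ^ n := by positivity
  refine Real.sSup_le ?_ hb
  rintro _ ⟨σ, hσ, rfl⟩
  refine Real.sSup_le ?_ hb
  rintro _ ⟨A, hA, rfl⟩
  have h0 : ∀ x : Config G n, (0 : ℝ) ≤ if x ∈ A then 1 else 0 := fun x => by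
    split_ifs <;> norm_num
  have h1 : ∀ x : Config G n, (if x ∈ A then (1 : ℝ) else 0) ≤ 1 := fun x => by
    split_ifs <;> norm_num
  have hmem := avgOp_pow_mem hn h0 h1 (t - T)
  have h2 := h _ hmem.1 hmem.2 σ hσ
  rw [← avgOp_pow_add_apply, Nat.add_sub_cancel' hTt, unif_avgOp_pow hn, ← sum_law_mul] at h2
  simp only [mul_ite, mul_one, mul_zero, Finset.sum_ite_mem, Finset.univ_inter] at h2
  have h3 := abs_sum_statDist_sub_unif_le hA
  calc _ ≤ |∑ τ ∈ A, law G σ t τ - unif (fun τ => if τ ∈ A then 1 else 0)|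
        + |unif (fun τ => if τ ∈ A then 1 else 0) - ∑ τ ∈ A, statDist G n τ| := abs_sub_le _ _ _
    _ ≤ _ := by rw [abs_sub_comm (unif _)]; exact add_le_add h2 h3

variable (G) in
lemma exists_eventually_dMax_le {ε : ℝ} (hε : 0 < ε) : ∃ B : ℝ, ∀ β : ℝ, B ≤ β →
    ∀ᶠ n : ℕ in atTop, dMax G n ⌊(3 / 2 : ℝ) * n * Real.log n + β * n⌋₊ ≤ ε := by
  obtain ⟨B, hB⟩ := exists_eventually_abs_sub_unif_le G (half_pos hε)
  refine ⟨B, fun β hβ => ?_⟩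
  have hp : ∀ᶠ n : ℕ in atTop, ((properSubgroups G).card : ℝ) * (1 / 2) ^ n ≤ ε / 2 := by
    have h1 : Tendsto (fun m : ℕ => ((properSubgroups G).card : ℝ) * ((1 : ℝ) / 2) ^ m) atTop
        (nhds ((properSubgroups G).card * 0)) :=
      (tendsto_pow_atTop_nhds_zero_of_lt_one (by norm_num) (by norm_num)).const_mul _
    rw [mul_zero] at h1
    exact h1.eventually (ge_mem_nhds (half_pos hε))
  filter_upwards [eventually_ge_atTop 2, hB, hp] with n hn ⟨T, hT, hf⟩ hp
  have hTt : T ≤ ⌊(3 / 2 : ℝ) * n * Real.log n + β * n⌋₊ := by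
    refine Nat.le_floor (hT.trans ?_)
    gcongr
  refine (dMax_le hn (half_pos hε).le hTt hf).trans ?_
  linarith

end PR

/-- Theorem 1.1, upper bound: total-variation cutoff upper bound for the
product replacement chain at time `(3/2) n log n` with window of order `n`:
`lim_{β→∞} limsup_{n→∞} max_{σ∈S} d_σ((3/2) n log n + β n) = 0`. -/
theorem productReplacement_cutoff_upper_bound
    (G : Type) [Group G] [Fintype G] :
    Filter.Tendsto
      (fun β : ℝ => Filter.limsup
        (fun n : ℕ => PR.dMax G n ⌊(3 / 2 : ℝ) * n * Real.log n + β * n⌋₊) Filter.atTop)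
      Filter.atTop (nhds 0) := by
  rw [Metric.tendsto_atTop]
  intro ε hε
  obtain ⟨B, hB⟩ := PR.exists_eventually_dMax_le G (half_pos hε)
  refine ⟨B, fun β hβ => ?_⟩
  have h1 := hB β hβ
  have h0 : ∀ n : ℕ, 0 ≤ PR.dMax G n ⌊(3 / 2 : ℝ) * n * Real.log n + β * n⌋₊ :=
    fun n => PR.dMax_nonneg _
  have hle := limsup_le_of_le (isCoboundedUnder_le_of_le atTop h0) h1
  have hge := le_limsup_of_frequently_le (Frequently.of_forall h0) (isBoundedUnder_of_eventually_le h1)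
  rw [Real.dist_eq, sub_zero, abs_of_nonneg hge]
  linarith
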